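/- arXiv:1304.4368 — 3 statements merged into one kernel-verified Lean document; each statement's English description precedes it below -/
import Mathlib

section
/- (Proposition 2, characteristic-function form.) Fix an integer M ≥ 1, γ > 0 and a real number α. For every M×M Hermitian complex matrix X with pairwise distinct eigenvalues x_1, …, x_M: ∫ e^{-i·Tr(KX)} · det[ γ²·1_M + (K - γα·1_M)² ]^{-M} dK = F(x_1,…,x_M) · ∫ det[ γ²·1_M + (K - γα·1_M)² ]^{-M} dK, where both integrals are over the real vector space of M×M Hermitian complex matrices K with respect to an additive Haar (Lebesgue) measure, and F(x_1,…,x_M) = (-1)^{M(M-1)/2} · e^{-iγα·∑_{c=1}^M x_c} · det[ g_{M-i}(x_j) ]_{i,j=1}^{M} / ∏_{1≤i<j≤M}(x_i - x_j). In other words, F is the characteristic function of the matrix Cauchy distribution with density proportional to det[γ²·1_M + (K - γα·1_M)²]^{-M}. -/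
open MeasureTheory Matrix

/-- Matrices inherit the (Borel) measurable structure of the underlying pi type. -/
noncomputable instance matrixMeasurableSpace {m n α : Type*} [MeasurableSpace α] :
    MeasurableSpace (Matrix m n α) :=
  inferInstanceAs (MeasurableSpace (m → n → α))

/-- For integers `1 ≤ n ≤ M` and real `γ > 0`, the function
`g_{M-n}(x) = e^{-γ|x|} · x^{n-1} · ∑_{l=0}^{M-n} |γx|^l / l!`, given in terms of `n`. -/
noncomputable def gMn (γ : ℝ) (M n : ℕ) (x : ℝ) : ℝ :=
  Real.exp (-γ * |x|) * x ^ (n - 1) *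
    ∑ l ∈ Finset.range (M - n + 1), |γ * x| ^ l / (Nat.factorial l : ℝ)

/-- The real vector space of Hermitian `n × n` complex matrices. -/
abbrev HermitianSpace (n : ℕ) := selfAdjoint (Matrix (Fin n) (Fin n) ℂ)

namespace HermitianSpace

variable (n : ℕ)

instance : SecondCountableTopology (Matrix (Fin n) (Fin n) ℂ) :=
  inferInstanceAs (SecondCountableTopology (Fin n → Fin n → ℂ))

instance : BorelSpace (Matrix (Fin n) (Fin n) ℂ) :=
  inferInstanceAs (BorelSpace (Fin n → Fin n → ℂ))

instance : LocallyCompactSpace (Matrix (Fin n) (Fin n) ℂ) :=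
  inferInstanceAs (LocallyCompactSpace (Fin n → Fin n → ℂ))

instance : SecondCountableTopology (HermitianSpace n) :=
  TopologicalSpace.Subtype.secondCountableTopology
    (selfAdjoint (Matrix (Fin n) (Fin n) ℂ) : Set (Matrix (Fin n) (Fin n) ℂ))

instance : BorelSpace (HermitianSpace n) :=
  Subtype.borelSpace (selfAdjoint (Matrix (Fin n) (Fin n) ℂ) : Set (Matrix (Fin n) (Fin n) ℂ))

instance : LocallyCompactSpace (HermitianSpace n) := by
  have hc : IsClosed (selfAdjoint (Matrix (Fin n) (Fin n) ℂ) : Set (Matrix (Fin n) (Fin n) ℂ)) := by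
    have : (selfAdjoint (Matrix (Fin n) (Fin n) ℂ) : Set (Matrix (Fin n) (Fin n) ℂ)) =
        {K | star K = K} := by
      ext K; exact selfAdjoint.mem_iff
    rw [this]
    exact isClosed_eq continuous_star continuous_id
  exact hc.isClosedEmbedding_subtypeVal.locallyCompactSpace

variable {n}

/-- Any two Haar measures on Hermitian matrices are proportional. -/
theorem exists_smul_eq (μ ν : Measure (HermitianSpace n)) [μ.IsAddHaarMeasure]
    [ν.IsAddHaarMeasure] : ∃ c : NNReal, μ = c • ν :=
  ⟨_, Measure.isAddLeftInvariant_eq_smul μ ν⟩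

end HermitianSpace

/-- The matrix `[[K, v], [v*, t]]`. -/
def borderedMatrix {n : ℕ} (K : Matrix (Fin n) (Fin n) ℂ) (t : ℝ) (v : Fin n → ℂ) :
    Matrix (Fin (n + 1)) (Fin (n + 1)) ℂ :=
  Matrix.of (Fin.snoc (α := fun _ => Fin (n + 1) → ℂ)
    (fun i => Fin.snoc (α := fun _ => ℂ) (K i) (v i))
    (Fin.snoc (α := fun _ => ℂ) (star v) (t : ℂ)))

section borderedMatrix

variable {n : ℕ} (K : Matrix (Fin n) (Fin n) ℂ) (t : ℝ) (v : Fin n → ℂ) (i j : Fin n)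

@[simp] theorem borderedMatrix_castSucc_castSucc :
    borderedMatrix K t v i.castSucc j.castSucc = K i j := by simp [borderedMatrix]

@[simp] theorem borderedMatrix_castSucc_last :
    borderedMatrix K t v i.castSucc (Fin.last n) = v i := by simp [borderedMatrix]

@[simp] theorem borderedMatrix_last_castSucc :
    borderedMatrix K t v (Fin.last n) j.castSucc = star (v j) := by simp [borderedMatrix]

@[simp] theorem borderedMatrix_last_last :
    borderedMatrix K t v (Fin.last n) (Fin.last n) = t := by simp [borderedMatrix]

theorem continuous_borderedMatrix :
    Continuous fun p : Matrix (Fin n) (Fin n) ℂ × ℝ × (Fin n → ℂ) =>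
      borderedMatrix p.1 p.2.1 p.2.2 := by
  refine continuous_matrix fun i j => ?_
  refine Fin.lastCases ?_ (fun i => ?_) i <;> refine Fin.lastCases ?_ (fun j => ?_) j <;>
    simp only [borderedMatrix_castSucc_castSucc, borderedMatrix_castSucc_last,
      borderedMatrix_last_castSucc, borderedMatrix_last_last]
  · fun_prop
  · exact continuous_star.comp ((continuous_apply j).comp (continuous_snd.comp continuous_snd))
  · fun_prop
  · exact continuous_fst.matrix_elem i j

variable {K} in
theorem isHermitian_borderedMatrix (hK : K.IsHermitian) :
    (borderedMatrix K t v).IsHermitian := by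
  ext i j
  refine Fin.lastCases ?_ (fun i => ?_) i <;> refine Fin.lastCases ?_ (fun j => ?_) j <;>
    simp [Matrix.conjTranspose_apply]
  exact hK.apply i j

/-- The sum of the squared moduli of the entries. -/
noncomputable def entrySq {n : ℕ} (K : Matrix (Fin n) (Fin n) ℂ) : ℝ := ∑ i, ∑ j, ‖K i j‖ ^ 2

theorem entrySq_borderedMatrix :
    entrySq (borderedMatrix K t v) = entrySq K + 2 * ∑ i, ‖v i‖ ^ 2 + t ^ 2 := by
  simp only [entrySq, Fin.sum_univ_castSucc, borderedMatrix_castSucc_castSucc,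
    borderedMatrix_castSucc_last, borderedMatrix_last_castSucc, borderedMatrix_last_last,
    Finset.sum_add_distrib, norm_star, Complex.norm_real, Real.norm_eq_abs, sq_abs]
  ring

theorem entrySq_diagonal (k : Fin n → ℝ) :
    entrySq (diagonal fun i => (k i : ℂ)) = ∑ i, k i ^ 2 := by
  simp only [entrySq]
  refine Finset.sum_congr rfl fun i _ => ?_
  rw [Finset.sum_eq_single i]
  · simp
  · intro j _ hj; simp [diagonal_apply_ne' _ hj]
  · simp

theorem entrySq_nonneg : 0 ≤ entrySq K := by unfold entrySq; positivity

variable {K} in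
/-- The block unitary `diag(U, 1)`. -/
theorem exists_unitary_borderedMatrix {U : Matrix (Fin n) (Fin n) ℂ}
    (hU : U ∈ unitaryGroup (Fin n) ℂ) :
    ∃ V ∈ unitaryGroup (Fin (n + 1)) ℂ, ∀ (K : Matrix (Fin n) (Fin n) ℂ) (t : ℝ) (v : Fin n → ℂ),
      borderedMatrix (U * K * star U) t (U *ᵥ v) = V * borderedMatrix K t v * star V := by
  have hU' := mem_unitaryGroup_iff.1 hU
  let V : Matrix (Fin (n + 1)) (Fin (n + 1)) ℂ := borderedMatrix U 1 0
  refine ⟨V, ?_, ?_⟩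
  · rw [mem_unitaryGroup_iff]
    ext i j
    have key := fun i j => congrFun (congrFun hU' i) j
    simp only [Matrix.mul_apply, star_apply] at key
    refine Fin.lastCases ?_ (fun i => ?_) i <;> refine Fin.lastCases ?_ (fun j => ?_) j <;>
      simp [V, Matrix.mul_apply, Fin.sum_univ_castSucc, star_apply]
    · simp [Matrix.one_apply]
      exact (Fin.castSucc_lt_last j).ne'
    · have := key i j
      simpa [Matrix.one_apply] using this
  · intro K t v
    ext i j
    refine Fin.lastCases ?_ (fun i => ?_) i <;> refine Fin.lastCases ?_ (fun j => ?_) j <;>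
      simp [V, Matrix.mul_apply, Fin.sum_univ_castSucc, star_apply, mulVec, dotProduct, mul_comm]

end borderedMatrix

/-- Splitting off the last row and column of a Hermitian matrix. -/
noncomputable def borderedEquiv (n : ℕ) :
    (HermitianSpace n × ℝ × (Fin n → ℂ)) ≃ₜ+ HermitianSpace (n + 1) where
  toFun p := ⟨borderedMatrix p.1 p.2.1 p.2.2, isHermitian_borderedMatrix _ _ p.1.2⟩
  invFun K := (⟨K.1.submatrix Fin.castSucc Fin.castSucc, IsHermitian.submatrix K.2 _⟩,
    (K.1 (Fin.last n) (Fin.last n)).re, fun i => K.1 i.castSucc (Fin.last n))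
  left_inv p := by
    refine Prod.ext (Subtype.ext ?_) (Prod.ext ?_ ?_)
    · ext i j; simp
    · simp
    · ext i; simp
  right_inv K := by
    refine Subtype.ext ?_
    ext i j
    refine Fin.lastCases ?_ (fun i => ?_) i <;> refine Fin.lastCases ?_ (fun j => ?_) j <;> simp
    · exact Complex.conj_eq_iff_re.1 (IsHermitian.apply K.2 _ _)
    · exact IsHermitian.apply K.2 _ _
  map_add' p q := by
    refine Subtype.ext ?_
    ext i j
    refine Fin.lastCases ?_ (fun i => ?_) i <;> refine Fin.lastCases ?_ (fun j => ?_) j <;> simp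
  continuous_toFun := by
    refine Continuous.subtype_mk ?_ _
    exact continuous_borderedMatrix.comp
      ((continuous_subtype_val.comp continuous_fst).prodMk continuous_snd)
  continuous_invFun := by
    refine Continuous.prodMk (Continuous.subtype_mk ?_ _) (Continuous.prodMk ?_ ?_)
    · exact continuous_subtype_val.matrix_submatrix _ _
    · exact Complex.continuous_re.comp (continuous_subtype_val.matrix_elem _ _)
    · exact continuous_pi fun i => continuous_subtype_val.matrix_elem _ _

theorem borderedEquiv_apply {n : ℕ} (p : HermitianSpace n × ℝ × (Fin n → ℂ)) :
    ((borderedEquiv n p : HermitianSpace (n + 1)) : Matrix (Fin (n + 1)) (Fin (n + 1)) ℂ) =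
      borderedMatrix p.1 p.2.1 p.2.2 := rfl

theorem exists_unitary_diagonal {n : ℕ} {A : Matrix (Fin n) (Fin n) ℂ} (hA : A.IsHermitian)
    {k : Fin n → ℝ} (hk : Function.Injective k)
    (hev : ∀ j, ∃ w : Fin n → ℂ, w ≠ 0 ∧ A *ᵥ w = (k j : ℂ) • w) :
    ∃ U ∈ unitaryGroup (Fin n) ℂ, A = U * diagonal (fun j => (k j : ℂ)) * star U := by
  have hmem : ∀ j, k j ∈ Set.range hA.eigenvalues := by
    intro j
    rw [← hA.spectrum_real_eq_range_eigenvalues, spectrum.mem_iff]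
    intro hu
    obtain ⟨w, hw, hAw⟩ := hev j
    refine hw (mulVec_injective_of_isUnit hu ?_)
    rw [sub_mulVec, hAw, Algebra.algebraMap_eq_smul_one, smul_mulVec, one_mulVec]
    ext i; simp
  choose σ hσ using hmem
  have hσi : Function.Injective σ := fun a b hab => hk (by rw [← hσ a, ← hσ b, hab])
  let τ : Equiv.Perm (Fin n) := Equiv.ofBijective σ (Finite.injective_iff_bijective.1 hσi)
  let U : Matrix (Fin n) (Fin n) ℂ := hA.eigenvectorUnitary
  have hU : U * star U = 1 := mem_unitaryGroup_iff.1 hA.eigenvectorUnitary.2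
  refine ⟨U.submatrix id τ, ?_, ?_⟩
  · rw [mem_unitaryGroup_iff, ← hU]
    ext i j
    simp only [Matrix.mul_apply, star_apply, submatrix_apply, id]
    exact Equiv.sum_comp τ fun l => U i l * star (U j l)
  · have h := hA.spectral_theorem
    rw [Unitary.conjStarAlgAut_apply] at h
    ext i j
    conv_lhs => rw [h]
    rw [Matrix.mul_apply, Matrix.mul_apply]
    simp only [mul_diagonal, star_apply, submatrix_apply, id]
    rw [← Equiv.sum_comp τ]
    refine Finset.sum_congr rfl fun l _ => ?_
    have : hA.eigenvalues (τ l) = k l := hσ l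
    simp [this, U]

open Polynomial in
theorem degree_prod_X_sub_C_sub_lt {n : ℕ} {a b : Fin (n + 1) → ℝ} (h : ∑ i, a i = ∑ i, b i) :
    (∏ i, (X - C (a i)) - ∏ i, (X - C (b i))).degree < (n : WithBot ℕ) := by
  have hc : ∀ a : Fin (n + 1) → ℝ, (∏ i, (X - C (a i))).coeff n = -∑ i, a i := by
    intro a
    simpa using prod_X_sub_C_coeff_card_pred Finset.univ a (by simp)
  have hd : ∀ a : Fin (n + 1) → ℝ, (∏ i, (X - C (a i))).natDegree = n + 1 := by
    intro a; simp
  have hm : ∀ a : Fin (n + 1) → ℝ, (∏ i, (X - C (a i))).Monic := fun a =>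
    monic_prod_of_monic _ _ fun i _ => monic_X_sub_C _
  rw [degree_lt_iff_coeff_zero]
  intro m hmn
  rcases Nat.lt_or_ge (n + 1) m with h1 | h1
  · rw [coeff_sub, coeff_eq_zero_of_natDegree_lt (by rw [hd]; exact h1),
      coeff_eq_zero_of_natDegree_lt (by rw [hd]; exact h1), sub_zero]
  · obtain rfl | rfl : m = n ∨ m = n + 1 := by omega
    · rw [coeff_sub, hc, hc, h, sub_self]
    · have h1 := hm a
      have h2 := hm b
      rw [Monic, leadingCoeff, hd] at h1 h2
      rw [coeff_sub, h1, h2, sub_self]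

/-- The characteristic polynomial, evaluated at `z`, of a bordered diagonal matrix whose last
column has entries of squared moduli `u`. -/
noncomputable def secular {n : ℕ} (y u : Fin n → ℝ) (t : ℝ) : Polynomial ℝ :=
  (Polynomial.X - Polynomial.C t) * ∏ i, (Polynomial.X - Polynomial.C (y i)) -
    ∑ i, Polynomial.C (u i) * ∏ j ∈ Finset.univ.erase i, (Polynomial.X - Polynomial.C (y j))

open Polynomial in
theorem degree_secular_tail_lt {n : ℕ} (y u : Fin n → ℝ) :
    (∑ i, C (u i) * ∏ j ∈ Finset.univ.erase i, (X - C (y j))).degree < (n : WithBot ℕ) := by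
  refine (degree_sum_le _ _).trans_lt ?_
  rw [Finset.sup_lt_iff (by exact_mod_cast WithBot.bot_lt_coe n)]
  intro i _
  refine (degree_mul_le _ _).trans_lt ((add_le_add_left degree_C_le _).trans_lt ?_)
  rw [zero_add]
  rw [degree_prod]
  simp only [degree_X_sub_C, Finset.sum_const, Finset.card_erase_of_mem (Finset.mem_univ i),
    Finset.card_univ, Fintype.card_fin, nsmul_eq_mul, mul_one]
  have := i.pos
  exact_mod_cast Nat.sub_lt this one_pos

theorem eval_secular {n : ℕ} (y u : Fin n → ℝ) (t z : ℝ) :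
    (secular y u t).eval z = (z - t) * ∏ i, (z - y i) -
      ∑ i, u i * ∏ j ∈ Finset.univ.erase i, (z - y j) := by
  simp [secular, Polynomial.eval_prod, Polynomial.eval_finsetSum]

theorem eval_secular_of_ne {n : ℕ} (y u : Fin n → ℝ) (t : ℝ) {z : ℝ} (hz : ∀ i, z ≠ y i) :
    (secular y u t).eval z = (z - t - ∑ i, u i / (z - y i)) * ∏ i, (z - y i) := by
  rw [eval_secular, sub_mul (z - t), Finset.sum_mul]
  congr 1
  refine Finset.sum_congr rfl fun i _ => ?_
  rw [← Finset.mul_prod_erase _ _ (Finset.mem_univ i), ← mul_assoc,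
    div_mul_cancel₀ _ (sub_ne_zero.2 (hz i))]

theorem eval_secular_self {n : ℕ} (y u : Fin n → ℝ) (t : ℝ) (i : Fin n) :
    (secular y u t).eval (y i) = - (u i * ∏ j ∈ Finset.univ.erase i, (y i - y j)) := by
  rw [eval_secular, Finset.prod_eq_zero (Finset.mem_univ i) (sub_self _), mul_zero, zero_sub,
    Finset.sum_eq_single i]
  · intro l _ hl
    rw [Finset.prod_eq_zero (Finset.mem_erase.2 ⟨hl.symm, Finset.mem_univ i⟩) (sub_self _),
      mul_zero]
  · simp

open Polynomial in
theorem secular_eq_prod_sub {n : ℕ} (y u : Fin n → ℝ) (t : ℝ) :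
    secular y u t = ∏ i, (X - C (Fin.cons (α := fun _ => ℝ) t y i)) -
      ∑ i, C (u i) * ∏ j ∈ Finset.univ.erase i, (X - C (y j)) := by
  simp [secular, Fin.prod_univ_succ]

open Polynomial in
theorem secular_eq_of_eval {n : ℕ} {y : Fin n → ℝ} (hy : Function.Injective y) {u : Fin n → ℝ}
    {t : ℝ} {k : Fin (n + 1) → ℝ}
    (hu : ∀ i, ∏ j, (y i - k j) = -(u i * ∏ j ∈ Finset.univ.erase i, (y i - y j)))
    (ht : t + ∑ i, y i = ∑ j, k j) : secular y u t = ∏ j, (X - C (k j)) := by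
  refine Polynomial.eq_of_degree_sub_lt_of_eval_index_eq Finset.univ (v := y) hy.injOn ?_ ?_
  · rw [secular_eq_prod_sub, sub_right_comm, Finset.card_univ, Fintype.card_fin]
    refine (degree_sub_le _ _).trans_lt (max_lt ?_ (degree_secular_tail_lt y u))
    exact degree_prod_X_sub_C_sub_lt (by simpa [Fin.sum_univ_succ] using ht)
  · intro i _
    rw [eval_secular_self, ← hu, eval_prod]
    simp

open Polynomial in
theorem secular_eq_of_roots {n : ℕ} {y u : Fin n → ℝ} {t : ℝ} {k : Fin (n + 1) → ℝ}
    (hk : Function.Injective k) (hr : ∀ j, (secular y u t).eval (k j) = 0) :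
    secular y u t = ∏ j, (X - C (k j)) := by
  have hd : ∀ a : Fin (n + 1) → ℝ, (∏ i, (X - C (a i))).degree = ((n + 1 : ℕ) : WithBot ℕ) := by
    intro a; rw [degree_prod]; simp
  have hm : ∀ a : Fin (n + 1) → ℝ, (∏ i, (X - C (a i))).Monic := fun a =>
    monic_prod_of_monic _ _ fun i _ => monic_X_sub_C _
  refine Polynomial.eq_of_degree_sub_lt_of_eval_index_eq Finset.univ (v := k) hk.injOn ?_ ?_
  · rw [secular_eq_prod_sub, sub_right_comm, Finset.card_univ, Fintype.card_fin]
    refine (degree_sub_le _ _).trans_lt (max_lt ?_ ((degree_secular_tail_lt y u).trans ?_))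
    · have := degree_sub_lt_left (p := ∏ i, (X - C (Fin.cons (α := fun _ => ℝ) t y i)))
        (q := ∏ j, (X - C (k j))) (by rw [hd, hd]) (hm _).ne_zero
        (by rw [(hm _).leadingCoeff, (hm _).leadingCoeff])
      rwa [hd] at this
    · exact_mod_cast Nat.lt_succ_self n
  · intro i _
    rw [hr, eval_prod, Finset.prod_eq_zero (Finset.mem_univ i) (by simp)]

open Polynomial in
theorem sum_eq_of_secular_eq {n : ℕ} {y u : Fin n → ℝ} {t : ℝ} {k : Fin (n + 1) → ℝ}
    (h : secular y u t = ∏ j, (X - C (k j))) : t + ∑ i, y i = ∑ j, k j := by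
  have hc : ∀ a : Fin (n + 1) → ℝ, (∏ i, (X - C (a i))).coeff n = -∑ i, a i := by
    intro a
    simpa using prod_X_sub_C_coeff_card_pred Finset.univ a (by simp)
  have := congrArg (fun p => p.coeff n) h
  simp only [secular_eq_prod_sub, coeff_sub, hc, Fin.sum_univ_succ (Fin.cons _ _), Fin.cons_zero,
    Fin.cons_succ] at this
  rw [coeff_eq_zero_of_degree_lt (degree_secular_tail_lt y u)] at this
  linarith

theorem exists_unitary_borderedMatrix_diagonal {n : ℕ} {y : Fin n → ℝ} {v : Fin n → ℂ} {t : ℝ}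
    {k : Fin (n + 1) → ℝ} (hk : Function.Injective k) (hky : ∀ i j, k j ≠ y i)
    (hr : ∀ j, (secular y (fun i => ‖v i‖ ^ 2) t).eval (k j) = 0) :
    ∃ U ∈ unitaryGroup (Fin (n + 1)) ℂ,
      borderedMatrix (diagonal fun i => (y i : ℂ)) t v =
        U * diagonal (fun j => (k j : ℂ)) * star U := by
  have hD : (diagonal fun i => (y i : ℂ)).IsHermitian := by
    refine isHermitian_diagonal_of_self_adjoint _ ?_
    ext i; simp
  refine exists_unitary_diagonal (isHermitian_borderedMatrix t v hD) hk fun j => ?_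
  refine ⟨Fin.snoc (α := fun _ => ℂ) (fun i => v i / ((k j - y i : ℝ) : ℂ)) 1, ?_, ?_⟩
  · intro h
    simpa using congrFun h (Fin.last n)
  have hne : ∀ i, k j - y i ≠ 0 := fun i => sub_ne_zero.2 (hky i j)
  have hsec : k j - t = ∑ i, ‖v i‖ ^ 2 / (k j - y i) := by
    have h := hr j
    rw [eval_secular_of_ne _ _ _ (fun i => hky i j), mul_eq_zero, sub_eq_zero] at h
    exact h.resolve_right (Finset.prod_ne_zero_iff.2 fun i _ => hne i)
  ext i
  refine Fin.lastCases ?_ (fun i => ?_) i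
  · simp only [mulVec, dotProduct, Fin.sum_univ_castSucc, borderedMatrix_last_castSucc,
      borderedMatrix_last_last, Fin.snoc_castSucc, Fin.snoc_last, Pi.smul_apply, smul_eq_mul,
      mul_one]
    have : ∀ i, star (v i) * (v i / ((k j - y i : ℝ) : ℂ)) = ((‖v i‖ ^ 2 / (k j - y i) : ℝ) : ℂ) := by
      intro i
      rw [← mul_div_assoc, Complex.star_def, Complex.conj_mul']
      push_cast; rfl
    simp only [this]
    rw [← Complex.ofReal_sum, ← hsec]
    push_cast; ring
  · simp only [mulVec, dotProduct, Fin.sum_univ_castSucc, borderedMatrix_castSucc_castSucc,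
      borderedMatrix_castSucc_last, Fin.snoc_castSucc, Fin.snoc_last, Pi.smul_apply, smul_eq_mul,
      mul_one, diagonal_apply, ite_mul, zero_mul, Finset.sum_ite_eq, Finset.mem_univ, if_true]
    have : ((k j - y i : ℝ) : ℂ) ≠ 0 := Complex.ofReal_ne_zero.2 (hne i)
    field_simp
    push_cast
    ring

/-- The Vandermonde product `∏_{i<j} (a_j - a_i)`. -/
def vandermondeProd {R : Type*} [CommRing R] {n : ℕ} (a : Fin n → R) : R :=
  ∏ i, ∏ j ∈ Finset.Ioi i, (a j - a i)

theorem vandermondeProd_pos {n : ℕ} {a : Fin n → ℝ} (ha : StrictMono a) :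
    0 < vandermondeProd a :=
  Finset.prod_pos fun _ _ => Finset.prod_pos fun _ hj => sub_pos.2 (ha (Finset.mem_Ioi.1 hj))

theorem vandermondeProd_ne_zero {R : Type*} [CommRing R] [IsDomain R] {n : ℕ} {a : Fin n → R}
    (ha : Function.Injective a) : vandermondeProd a ≠ 0 :=
  Finset.prod_ne_zero_iff.2 fun _ _ => Finset.prod_ne_zero_iff.2 fun _ hj =>
    sub_ne_zero.2 (ha.ne (Finset.mem_Ioi.1 hj).ne')

theorem prod_univ_prod_Ioi_succ {R : Type*} [CommMonoid R] {n : ℕ}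
    (f : Fin (n + 1) → Fin (n + 1) → R) :
    ∏ i, ∏ j ∈ Finset.Ioi i, f i j =
      (∏ i : Fin n, ∏ j ∈ Finset.Ioi i, f i.castSucc j.castSucc) *
        ∏ i : Fin n, f i.castSucc (Fin.last n) := by
  rw [Fin.prod_univ_castSucc, ← Finset.prod_mul_distrib]
  rw [show (Finset.Ioi (Fin.last n)) = ∅ from by ext i; simp [Fin.le_last]]
  rw [Finset.prod_empty, mul_one]
  refine Finset.prod_congr rfl fun i _ => ?_
  have : Finset.Ioi i.castSucc = insert (Fin.last n) ((Finset.Ioi i).map Fin.castSuccEmb) := by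
    ext j
    refine Fin.lastCases ?_ (fun j => ?_) j
    · simp [Fin.castSucc_lt_last]
    · simpa using fun _ => Fin.le_last _
  rw [this, Finset.prod_insert (by simp), Finset.prod_map, mul_comm]
  simp

theorem vandermondeProd_succ {R : Type*} [CommRing R] {n : ℕ} (a : Fin (n + 1) → R) :
    vandermondeProd a =
      vandermondeProd (fun i : Fin n => a i.castSucc) *
        ∏ i : Fin n, (a (Fin.last n) - a i.castSucc) :=
  prod_univ_prod_Ioi_succ _

theorem abs_prod_erase_sub {n : ℕ} (a : Fin n → ℝ) :
    |∏ i, ∏ j ∈ Finset.univ.erase i, (a i - a j)| = vandermondeProd a ^ 2 := by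
  have h := Finset.prod_prod_Ioi_mul_eq_prod_prod_off_diag fun i j : Fin n => |a i - a j|
  rw [Finset.abs_prod]
  simp only [Finset.abs_prod]
  have h2 : ∀ i : Fin n, Finset.univ.erase i = {i}ᶜ := fun i => by ext; simp
  simp only [h2]
  have h3 : ∀ i j, |a i - a j| = |a j - a i| := fun i j => abs_sub_comm _ _
  calc _ = ∏ i, ∏ j ∈ ({i} : Finset (Fin n))ᶜ, |a j - a i| := by simp only [h3]
    _ = _ := h.symm
    _ = _ := by
      rw [vandermondeProd, ← Finset.prod_pow]
      refine Finset.prod_congr rfl fun i _ => ?_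
      rw [← Finset.prod_pow]
      refine Finset.prod_congr rfl fun j _ => ?_
      rw [abs_sub_comm (a i), abs_mul_abs_self, sq]

/-- `k` interlaces `y`: `k₀ < y₀ < k₁ < ⋯ < yₙ₋₁ < kₙ`. -/
def Interlaces {n : ℕ} (y : Fin n → ℝ) (k : Fin (n + 1) → ℝ) : Prop :=
  ∀ i, k i.castSucc < y i ∧ y i < k i.succ

namespace Interlaces

variable {n : ℕ} {y : Fin n → ℝ} {k : Fin (n + 1) → ℝ}

theorem strictMono (h : Interlaces y k) : StrictMono k :=
  Fin.strictMono_iff_lt_succ.2 fun i => (h i).1.trans (h i).2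

theorem lt_of_le (h : Interlaces y k) {i : Fin n} {j : Fin (n + 1)} (hj : j ≤ i.castSucc) :
    k j < y i := (h.strictMono.monotone hj).trans_lt (h i).1

theorem lt_of_ge (h : Interlaces y k) {i : Fin n} {j : Fin (n + 1)} (hj : i.succ ≤ j) :
    y i < k j := (h i).2.trans_le (h.strictMono.monotone hj)

theorem ne (h : Interlaces y k) (i : Fin n) (j : Fin (n + 1)) : k j ≠ y i := by
  rcases le_or_gt j i.castSucc with hj | hj
  · exact (h.lt_of_le hj).ne
  · exact (h.lt_of_ge (Fin.castSucc_lt_iff_succ_le.1 hj)).ne'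

theorem strictMono_left (h : Interlaces y k) : StrictMono y := by
  intro i j hij
  exact (h i).2.trans ((h.lt_of_le (i := j) (j := i.succ) (Fin.succ_le_castSucc_iff.2 hij)))

end Interlaces

theorem measurableSet_interlaces {n : ℕ} :
    MeasurableSet {p : (Fin n → ℝ) × (Fin (n + 1) → ℝ) | Interlaces p.1 p.2} := by
  simp only [Interlaces, Set.ofPred_forall, Set.ofPred_and]
  refine MeasurableSet.iInter fun i => MeasurableSet.inter ?_ ?_ <;>
    exact measurableSet_lt (by fun_prop) (by fun_prop)

/-- The map from eigenvalues `k` of a bordered diagonal matrix to the squared moduli of the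
border entries and the corner entry. -/
noncomputable def borderData {n : ℕ} (y : Fin n → ℝ) (k : Fin (n + 1) → ℝ) : Fin (n + 1) → ℝ :=
  Fin.snoc (α := fun _ => ℝ)
    (fun i => -(∏ j, (y i - k j)) / ∏ j ∈ Finset.univ.erase i, (y i - y j)) (∑ j, k j - ∑ i, y i)

section borderData

variable {n : ℕ} {y : Fin n → ℝ}

theorem prod_erase_ne_zero (hy : Function.Injective y) (i : Fin n) :
    ∏ j ∈ Finset.univ.erase i, (y i - y j) ≠ 0 :=
  Finset.prod_ne_zero_iff.2 fun _ hj => sub_ne_zero.2 (hy.ne (Finset.ne_of_mem_erase hj).symm)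

theorem secular_borderData (hy : Function.Injective y) (k : Fin (n + 1) → ℝ) :
    secular y (fun i => borderData y k i.castSucc) (borderData y k (Fin.last n)) =
      ∏ j, (Polynomial.X - Polynomial.C (k j)) := by
  refine secular_eq_of_eval hy (fun i => ?_) ?_
  · rw [borderData, Fin.snoc_castSucc, div_mul_cancel₀ _ (prod_erase_ne_zero hy i), neg_neg]
  · rw [borderData, Fin.snoc_last, sub_add_cancel]

theorem borderData_pos {k : Fin (n + 1) → ℝ} (h : Interlaces y k) (i : Fin n) :
    0 < borderData y k i.castSucc := by
  rw [borderData, Fin.snoc_castSucc, Fin.prod_univ_succAbove _ i.castSucc,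
    ← Finset.mul_prod_erase _ _ (Finset.mem_univ i), Fin.succAbove_castSucc_self, ← mul_assoc,
    ← neg_mul, mul_div_assoc, ← Finset.prod_div_distrib]
  refine mul_pos ?_ (Finset.prod_pos fun j hj => ?_)
  · rw [← mul_neg]
    exact mul_pos (sub_pos.2 (h i).1) (by linarith [(h i).2])
  · rcases lt_or_gt_of_ne (Finset.ne_of_mem_erase hj) with hji | hji
    · rw [Fin.succAbove_of_castSucc_lt _ _ (by simpa using hji)]
      exact div_pos (sub_pos.2 (h.lt_of_le (by simpa using hji.le)))
        (sub_pos.2 (h.strictMono_left hji))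
    · rw [Fin.succAbove_of_le_castSucc _ _ (by simpa using hji.le)]
      exact div_pos_of_neg_of_neg (sub_neg.2 (h.lt_of_ge (by simpa using hji.le)))
        (sub_neg.2 (h.strictMono_left hji))

theorem borderData_injOn (hy : Function.Injective y) :
    Set.InjOn (borderData y) {k | Interlaces y k} := by
  intro k hk k' hk' hkk
  have h : ∏ j, (Polynomial.X - Polynomial.C (k j)) =
      ∏ j, (Polynomial.X - Polynomial.C (k' j)) := by
    rw [← secular_borderData hy, ← secular_borderData hy, hkk]
  have key : ∀ {a b : Fin (n + 1) → ℝ}, ∏ j, (Polynomial.X - Polynomial.C (a j)) =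
      ∏ j, (Polynomial.X - Polynomial.C (b j)) → Set.range a ⊆ Set.range b := by
    rintro a b hab _ ⟨j, rfl⟩
    have := congrArg (Polynomial.eval (a j)) hab
    simp only [Polynomial.eval_prod, Polynomial.eval_sub, Polynomial.eval_X,
      Polynomial.eval_C] at this
    rw [Finset.prod_eq_zero (Finset.mem_univ j) (sub_self _), eq_comm,
      Finset.prod_eq_zero_iff] at this
    obtain ⟨l, -, hl⟩ := this
    exact ⟨l, (sub_eq_zero.1 hl).symm⟩
  exact ((Interlaces.strictMono hk).range_inj (Interlaces.strictMono hk')).1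
    (Set.Subset.antisymm (key h) (key h.symm))

theorem exists_root_between {f : ℝ → ℝ} (hf : Continuous f) {a b e : ℝ} (hab : a < b)
    (ha : 0 < -e * f a) (hb : 0 < e * f b) : ∃ z, a < z ∧ z < b ∧ f z = 0 := by
  have hg : ContinuousOn (fun z => e * f z) (Set.Icc a b) := by fun_prop
  obtain ⟨z, hz, hz0⟩ := intermediate_value_Ioo hab.le hg (show (0 : ℝ) ∈ _ from ⟨by linarith, hb⟩)
  refine ⟨z, hz.1, hz.2, (mul_eq_zero.1 hz0).resolve_left ?_⟩
  rintro rfl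
  simp at hb

theorem secular_sign (hy : StrictMono y) {u : Fin n → ℝ} (hu : ∀ i, 0 < u i) (t : ℝ) (i : Fin n) :
    0 < (-1) ^ (n - i : ℕ) * (secular y u t).eval (y i) := by
  have hsplit : Finset.univ.erase i = (Finset.Ioi i).disjUnion (Finset.Iio i)
      (Finset.disjoint_Ioi_Iio i) := by
    ext j; simp [lt_or_lt_iff_ne, eq_comm]
  have hcard : (Finset.Ioi i).card = n - 1 - i := by simp
  have h1 : ∏ j ∈ Finset.Ioi i, (y i - y j) = (-1) ^ (n - 1 - i : ℕ) *
      ∏ j ∈ Finset.Ioi i, (y j - y i) := by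
    rw [← hcard, ← Finset.prod_const, ← Finset.prod_mul_distrib]
    exact Finset.prod_congr rfl fun j _ => by ring
  have hp1 : 0 < ∏ j ∈ Finset.Ioi i, (y j - y i) :=
    Finset.prod_pos fun j hj => sub_pos.2 (hy (Finset.mem_Ioi.1 hj))
  have hp2 : 0 < ∏ j ∈ Finset.Iio i, (y i - y j) :=
    Finset.prod_pos fun j hj => sub_pos.2 (hy (Finset.mem_Iio.1 hj))
  rw [eval_secular_self, hsplit, Finset.prod_disjUnion, h1]
  have hni : n - (i : ℕ) = n - 1 - i + 1 := by have := i.2; omega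
  rw [hni, pow_succ]
  have hsq : ((-1 : ℝ) ^ (n - 1 - i : ℕ)) * (-1) ^ (n - 1 - i : ℕ) = 1 := by
    rw [← mul_pow]; simp
  have : (-1 : ℝ) ^ (n - 1 - i : ℕ) * -1 * -(u i * ((-1) ^ (n - 1 - i : ℕ) *
      (∏ j ∈ Finset.Ioi i, (y j - y i)) * ∏ j ∈ Finset.Iio i, (y i - y j))) =
      u i * ((∏ j ∈ Finset.Ioi i, (y j - y i)) * ∏ j ∈ Finset.Iio i, (y i - y j)) := by
    linear_combination (u i * ((∏ j ∈ Finset.Ioi i, (y j - y i)) *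
      ∏ j ∈ Finset.Iio i, (y i - y j))) * hsq
  rw [this]
  exact mul_pos (hu i) (mul_pos hp1 hp2)

theorem exists_interlacing_roots (hy : StrictMono y) {u : Fin n → ℝ} (hu : ∀ i, 0 < u i) (t : ℝ) :
    ∃ k, Interlaces y k ∧ ∀ j, (secular y u t).eval (k j) = 0 := by
  set f : ℝ → ℝ := fun z => (secular y u t).eval z
  have hf : Continuous f := (secular y u t).continuous
  set R : ℝ := ∑ i, |y i| + 1 + |t| + ∑ i, u i
  have hsu : 0 ≤ ∑ i, u i := Finset.sum_nonneg fun i _ => (hu i).le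
  have hyR : ∀ i, |y i| + 1 ≤ R := by
    intro i
    have := Finset.single_le_sum (f := fun i => |y i|) (fun i _ => abs_nonneg _) (Finset.mem_univ i)
    simp only [R]; linarith [abs_nonneg t]
  have htR : |t| + ∑ i, u i < R := by
    have : 0 ≤ ∑ i, |y i| := Finset.sum_nonneg fun i _ => abs_nonneg _
    simp only [R]; linarith
  have hlt : ∀ i, y i + 1 ≤ R := fun i => by linarith [hyR i, le_abs_self (y i)]
  have hgt : ∀ i, 1 ≤ R + y i := fun i => by linarith [hyR i, neg_abs_le (y i)]
  have hR : 0 < f R := by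
    simp only [f]
    rw [eval_secular_of_ne _ _ _ (fun i => by linarith [hlt i] : ∀ i, R ≠ y i)]
    refine mul_pos ?_ (Finset.prod_pos fun i _ => by linarith [hlt i])
    have : ∑ i, u i / (R - y i) ≤ ∑ i, u i :=
      Finset.sum_le_sum fun i _ => div_le_self (hu i).le (by linarith [hlt i])
    linarith [le_abs_self t]
  have hR' : 0 < (-1) ^ (n + 1) * f (-R) := by
    simp only [f]
    rw [eval_secular_of_ne _ _ _ (fun i => by linarith [hgt i] : ∀ i, -R ≠ y i)]
    have h1 : ∏ i, (-R - y i) = (-1) ^ n * ∏ i, (R + y i) := by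
      rw [show (-1 : ℝ) ^ n = ∏ _i : Fin n, (-1 : ℝ) from by simp, ← Finset.prod_mul_distrib]
      exact Finset.prod_congr rfl fun j _ => by ring
    have h2 : ∑ i, u i / (-R - y i) = -∑ i, u i / (R + y i) := by
      rw [← Finset.sum_neg_distrib]
      refine Finset.sum_congr rfl fun j _ => ?_
      rw [← div_neg]; ring_nf
    have h3 : ∑ i, u i / (R + y i) ≤ ∑ i, u i :=
      Finset.sum_le_sum fun i _ => div_le_self (hu i).le (by linarith [hgt i])
    have h4 : 0 < ∏ i, (R + y i) := Finset.prod_pos fun i _ => by linarith [hgt i]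
    have hsq : ((-1 : ℝ) ^ n) * (-1) ^ n = 1 := by
      rw [← mul_pow]; simp
    rw [h1, h2, pow_succ]
    have : (-1 : ℝ) ^ n * -1 * ((-R - t - -∑ i, u i / (R + y i)) * ((-1) ^ n * ∏ i, (R + y i))) =
        (R + t - ∑ i, u i / (R + y i)) * ∏ i, (R + y i) := by
      linear_combination ((R + t - ∑ i, u i / (R + y i)) * ∏ i, (R + y i)) * hsq
    rw [this]
    exact mul_pos (by linarith [neg_abs_le t]) h4
  let z : Fin (n + 2) → ℝ :=
    Fin.cons (α := fun _ => ℝ) (-R) (Fin.snoc (α := fun _ => ℝ) y R)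
  have hzsign : ∀ a : Fin (n + 2), 0 < (-1) ^ (n + 1 - a : ℕ) * f (z a) := by
    intro a
    refine Fin.cases ?_ (fun a => Fin.lastCases ?_ (fun i => ?_) a) a
    · simpa [z] using hR'
    · simpa [z] using hR
    · simpa [z] using secular_sign hy hu t i
  have hzmono : ∀ a : Fin (n + 1), z a.castSucc < z a.succ := by
    refine Fin.strictMono_iff_lt_succ.1 ?_
    have h1 : StrictMono (Fin.snoc (α := fun _ => ℝ) y R : Fin (n + 1) → ℝ) := by
      intro a b
      refine Fin.lastCases ?_ (fun b => ?_) b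
      · refine Fin.lastCases (by simp) (fun a _ => ?_) a
        simp; linarith [hlt a]
      · refine Fin.lastCases (fun h => absurd h (Fin.le_last _).not_gt) (fun a h => ?_) a
        simpa using hy (by simpa using h)
    intro a b
    refine Fin.cases ?_ (fun b => ?_) b
    · simp
    · refine Fin.cases (fun _ => ?_) (fun a h => ?_) a
      · simp only [z, Fin.cons_zero, Fin.cons_succ]
        refine Fin.lastCases ?_ (fun b => ?_) b
        · simp; linarith [abs_nonneg t]
        · simp; linarith [hgt b]
      · simpa [z] using h1 (by simpa using h)
  have hroot : ∀ a : Fin (n + 1), ∃ x, z a.castSucc < x ∧ x < z a.succ ∧ f x = 0 := by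
    intro a
    refine exists_root_between hf (e := (-1) ^ (n - a : ℕ)) (hzmono a) ?_ ?_
    · have := hzsign a.castSucc
      rwa [Fin.val_castSucc, show n + 1 - (a : ℕ) = n - a + 1 by have := a.2; omega, pow_succ,
        mul_neg_one] at this
    · have := hzsign a.succ
      rwa [Fin.val_succ, Nat.add_sub_add_right] at this
  choose k hk1 hk2 hk3 using hroot
  refine ⟨k, fun i => ⟨?_, ?_⟩, hk3⟩
  · have := hk2 i.castSucc
    simpa [z] using this
  · have := hk1 i.succ
    rw [← Fin.succ_castSucc] at this
    simpa [z] using this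

theorem borderData_image (hy : StrictMono y) :
    borderData y '' {k | Interlaces y k} = {w | ∀ i : Fin n, 0 < w i.castSucc} := by
  ext w
  constructor
  · rintro ⟨k, hk, rfl⟩ i
    exact borderData_pos hk i
  · intro hw
    obtain ⟨k, hk, hr⟩ := exists_interlacing_roots hy (u := fun i => w i.castSucc) hw
      (w (Fin.last n))
    have hs := secular_eq_of_roots hk.strictMono.injective hr
    refine ⟨k, hk, ?_⟩
    funext j
    refine Fin.lastCases ?_ (fun i => ?_) j
    · rw [borderData, Fin.snoc_last, ← sum_eq_of_secular_eq hs, add_sub_cancel_right]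
    · rw [borderData, Fin.snoc_castSucc, div_eq_iff (prod_erase_ne_zero hy.injective i)]
      have := congrArg (Polynomial.eval (y i)) hs
      rw [eval_secular_self, Polynomial.eval_prod] at this
      simp only [Polynomial.eval_sub, Polynomial.eval_X, Polynomial.eval_C] at this
      rw [← this, neg_neg]

end borderData

/-- The numerators of the Jacobian matrix of `borderData y` at `k`. -/
def borderJacobian {n : ℕ} (y : Fin n → ℝ) (k : Fin (n + 1) → ℝ) :
    Matrix (Fin (n + 1)) (Fin (n + 1)) ℝ :=
  .of fun i j => Fin.lastCases (motive := fun _ => ℝ) 1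
    (fun i => ∏ l ∈ Finset.univ.erase j, (y i - k l)) i

theorem abs_det_borderJacobian {n : ℕ} {y : Fin n → ℝ} {k : Fin (n + 1) → ℝ}
    (hk : StrictMono k) (hy : StrictMono y) :
    |(borderJacobian y k).det| = vandermondeProd k * vandermondeProd y := by
  have hmul : borderJacobian y k *
      (.of fun j m => (∏ l ∈ Finset.univ.erase j, (k j - k l))⁻¹ * vandermonde k j m) =
      projVandermonde (Fin.snoc (α := fun _ => ℝ) y 1) (Fin.snoc (α := fun _ => ℝ) 1 0) := by
    ext i m
    rw [mul_apply, projVandermonde_apply]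
    have hdeg : ((Polynomial.X : Polynomial ℝ) ^ (m : ℕ)).degree <
        (Finset.univ : Finset (Fin (n + 1))).card := by
      simp only [Polynomial.degree_X_pow, Finset.card_univ, Fintype.card_fin]
      exact_mod_cast m.2
    refine Fin.lastCases ?_ (fun i => ?_) i
    · have h := Lagrange.coeff_eq_sum (s := Finset.univ) hk.injective.injOn hdeg
      simp only [Polynomial.coeff_X_pow, Finset.card_univ, Fintype.card_fin,
        Nat.add_sub_cancel, Polynomial.eval_pow, Polynomial.eval_X] at h
      simp only [borderJacobian, of_apply, Fin.lastCases_last, Fin.snoc_last, one_pow, one_mul,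
        vandermonde_apply]
      rw [zero_pow_eq]
      simp only [Fin.val_rev]
      have hm : (n + 1 - ((m : ℕ) + 1) = 0) ↔ n = (m : ℕ) := by
        have := m.2
        omega
      simp only [hm, h]
      exact Finset.sum_congr rfl fun j _ => by rw [div_eq_inv_mul]
    · have h := Lagrange.eq_interpolate (s := Finset.univ) hk.injective.injOn hdeg
      have h2 := congrArg (Polynomial.eval (y i)) h
      rw [Lagrange.interpolate_apply, Polynomial.eval_finsetSum] at h2
      simp only [Polynomial.eval_pow, Polynomial.eval_X, Polynomial.eval_mul,
        Polynomial.eval_C] at h2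
      simp only [borderJacobian, of_apply, Fin.lastCases_castSucc, Fin.snoc_castSucc,
        vandermonde_apply, Pi.one_apply, one_pow, mul_one]
      rw [h2]
      refine Finset.sum_congr rfl fun j _ => ?_
      rw [Lagrange.basis, Polynomial.eval_prod]
      simp only [Lagrange.basisDivisor, Polynomial.eval_mul, Polynomial.eval_C,
        Polynomial.eval_sub, Polynomial.eval_X, Finset.prod_mul_distrib, Finset.prod_inv_distrib]
      ring
  have hdet := congrArg (fun A => |A.det|) hmul
  have hproj : (projVandermonde (Fin.snoc (α := fun _ => ℝ) y 1)
      (Fin.snoc (α := fun _ => ℝ) 1 0)).det = vandermondeProd y := by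
    rw [det_projVandermonde, prod_univ_prod_Ioi_succ]
    simp [vandermondeProd]
  rw [det_mul, det_mul_column, det_vandermonde, hproj, Finset.prod_inv_distrib, abs_mul, abs_mul,
    abs_inv, abs_prod_erase_sub] at hdet
  change _ * (_ * |vandermondeProd k|) = |vandermondeProd y| at hdet
  have hk0 := vandermondeProd_pos hk
  rw [abs_of_pos hk0, abs_of_pos (vandermondeProd_pos hy)] at hdet
  rw [← hdet]
  field_simp

theorem hasFDerivAt_borderData {n : ℕ} {y : Fin n → ℝ} (k : Fin (n + 1) → ℝ) :
    HasFDerivAt (borderData y) (LinearMap.toContinuousLinearMap (toLin' (.of fun i j =>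
      Fin.lastCases (motive := fun _ => ℝ) 1
        (fun i => (∏ l ∈ Finset.univ.erase i, (y i - y l))⁻¹) i * borderJacobian y k i j))) k := by
  rw [hasFDerivAt_pi']
  intro i
  refine Fin.lastCases ?_ (fun i => ?_) i
  · simp only [borderData, Fin.snoc_last]
    have h : HasFDerivAt (fun k : Fin (n + 1) → ℝ => ∑ j, k j - ∑ i, y i)
        (∑ j, ContinuousLinearMap.proj (R := ℝ) (φ := fun _ => ℝ) j) k :=
      (HasFDerivAt.fun_sum fun j _ => hasFDerivAt_apply j k).sub_const _
    refine h.congr_fderiv ?_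
    ext v
    simp [borderJacobian, mulVec, dotProduct]
  · simp only [borderData, Fin.snoc_castSucc]
    have h : HasFDerivAt (fun k : Fin (n + 1) → ℝ => ∏ j, (y i - k j))
        (∑ j, (∏ l ∈ Finset.univ.erase j, (y i - k l)) •
          -ContinuousLinearMap.proj (R := ℝ) (φ := fun _ => ℝ) j) k :=
      HasFDerivAt.finsetProd fun j _ => (hasFDerivAt_apply j k).const_sub _
    refine (h.neg.mul_const (∏ l ∈ Finset.univ.erase i, (y i - y l))⁻¹).congr_fderiv ?_
    ext v
    simp [borderJacobian, mulVec, dotProduct, Finset.mul_sum, mul_assoc]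

/-- Change of variables from the bordering data to the interlacing eigenvalues. -/
theorem setIntegral_borderData {n : ℕ} {y : Fin n → ℝ} (hy : StrictMono y)
    (G : (Fin (n + 1) → ℝ) → ℂ) :
    ∫ w in {w | ∀ i : Fin n, 0 < w i.castSucc}, G w =
      ∫ k in {k | Interlaces y k},
        ((vandermondeProd k / vandermondeProd y : ℝ) : ℂ) * G (borderData y k) := by
  have hm : MeasurableSet {k | Interlaces y k} :=
    measurableSet_interlaces.preimage measurable_prodMk_left
  rw [← borderData_image hy, integral_image_eq_integral_abs_det_fderiv_smul volume hm
    (fun k _ => (hasFDerivAt_borderData k).hasFDerivWithinAt) (borderData_injOn hy.injective)]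
  refine setIntegral_congr_fun hm fun k hk => ?_
  have hy0 := vandermondeProd_pos hy
  have hP := abs_prod_erase_sub y
  rw [LinearMap.det_toContinuousLinearMap, LinearMap.det_toLin', det_mul_column, abs_mul,
    abs_det_borderJacobian (Interlaces.strictMono hk) hy, Fin.prod_univ_castSucc]
  simp only [Fin.lastCases_castSucc, Fin.lastCases_last, mul_one, Finset.prod_inv_distrib]
  rw [abs_inv, hP, Complex.real_smul]
  congr 2
  field_simp

theorem map_norm_sq_volume :
    Measure.map (fun z : ℂ => ‖z‖ ^ 2) volume = NNReal.pi • volume.restrict (Set.Ioi (0 : ℝ)) := by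
  refine (Real.measure_ext_Ioo_rat fun a b => ?_).symm
  have hmeas : Measurable fun z : ℂ => ‖z‖ ^ 2 := by fun_prop
  have key : ∀ a b : ℝ, 0 ≤ a → a < b →
      volume ((fun z : ℂ => ‖z‖ ^ 2) ⁻¹' Set.Ioo a b) = ENNReal.ofReal (b - a) * NNReal.pi := by
    intro a b ha hab
    have hb := ha.trans_lt hab
    have : (fun z : ℂ => ‖z‖ ^ 2) ⁻¹' Set.Ioo a b =
        Metric.ball 0 √b \ Metric.closedBall 0 √a := by
      ext z
      simp only [Set.mem_preimage, Set.mem_Ioo, Set.mem_sdiff, Metric.mem_ball, dist_zero_right,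
        Metric.mem_closedBall, not_le]
      rw [Real.lt_sqrt (norm_nonneg z), Real.sqrt_lt ha (norm_nonneg z), and_comm]
    rw [this, measure_sdiff (Metric.closedBall_subset_ball (Real.sqrt_lt_sqrt ha hab))
      measurableSet_closedBall.nullMeasurableSet (by simp [Complex.volume_closedBall,
        ENNReal.mul_eq_top]),
      Complex.volume_ball, Complex.volume_closedBall, ← ENNReal.ofReal_pow (Real.sqrt_nonneg _),
      ← ENNReal.ofReal_pow (Real.sqrt_nonneg _), Real.sq_sqrt hb.le, Real.sq_sqrt ha,
      ← ENNReal.sub_mul (by simp), ENNReal.ofReal_sub _ ha]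
  rw [Measure.map_apply hmeas measurableSet_Ioo, Measure.smul_apply,
    Measure.restrict_apply measurableSet_Ioo, Set.Ioo_inter_Ioi]
  rcases le_or_gt (b : ℝ) ((a : ℝ) ⊔ 0) with h | h
  · rw [Set.Ioo_eq_empty (not_lt.2 h)]
    have : (fun z : ℂ => ‖z‖ ^ 2) ⁻¹' Set.Ioo (a : ℝ) b ⊆ {0} := by
      intro z hz
      simp only [Set.mem_preimage, Set.mem_Ioo] at hz
      rcases le_sup_iff.1 h with h | h
      · linarith
      · nlinarith [sq_nonneg ‖z‖]
    rw [measure_mono_null this (measure_singleton 0)]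
    simp
  · have hmax : 0 ≤ (a : ℝ) ⊔ 0 := le_sup_right
    have : volume ((fun z : ℂ => ‖z‖ ^ 2) ⁻¹' Set.Ioo (a : ℝ) b) =
        volume ((fun z : ℂ => ‖z‖ ^ 2) ⁻¹' Set.Ioo ((a : ℝ) ⊔ 0) b) := by
      rcases le_or_gt 0 (a : ℝ) with ha | ha
      · rw [sup_of_le_left ha]
      · rw [sup_of_le_right ha.le]
        refine measure_congr ?_
        have h0 : ∀ᵐ z : ℂ, z ≠ 0 := Measure.ae_ne volume 0
        filter_upwards [h0] with z hz
        have hz' : 0 < ‖z‖ ^ 2 := by positivity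
        apply propext
        change (_ ∧ _) ↔ (_ ∧ _)
        constructor
        · exact fun h => ⟨hz', h.2⟩
        · exact fun h => ⟨ha.trans h.1, h.2⟩
    rw [this, key _ _ hmax h, Real.volume_Ioo, mul_comm]
    rfl

theorem map_norm_sq_pi_volume (n : ℕ) :
    Measure.map (fun (v : Fin n → ℂ) i => ‖v i‖ ^ 2) volume =
      NNReal.pi ^ n • volume.restrict (Set.univ.pi fun _ : Fin n => Set.Ioi (0 : ℝ)) := by
  have hs : SigmaFinite (Measure.map (fun z : ℂ => ‖z‖ ^ 2) volume) := by
    rw [map_norm_sq_volume]; infer_instance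
  rw [volume_pi, volume_pi, Measure.restrict_pi_pi,
    Measure.pi_map_pi (f := fun _ (z : ℂ) => ‖z‖ ^ 2) fun i => by fun_prop]
  refine Measure.pi_eq fun s _ => ?_
  simp only [map_norm_sq_volume, Measure.smul_apply, Measure.pi_pi]
  simp only [ENNReal.smul_def, smul_eq_mul, Finset.prod_mul_distrib]
  simp

theorem map_snoc_norm_sq_volume (n : ℕ) :
    Measure.map (fun p : ℝ × (Fin n → ℂ) =>
        (Fin.snoc (α := fun _ => ℝ) (fun i => ‖p.2 i‖ ^ 2) p.1 : Fin (n + 1) → ℝ)) volume =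
      NNReal.pi ^ n • volume.restrict {w : Fin (n + 1) → ℝ | ∀ i : Fin n, 0 < w i.castSucc} := by
  set e := MeasurableEquiv.piFinSuccAbove (fun _ : Fin (n + 1) => ℝ) (Fin.last n)
  have he : MeasurePreserving e volume volume := volume_preserving_piFinSuccAbove _ _
  have hcomp : (fun p : ℝ × (Fin n → ℂ) =>
      (Fin.snoc (α := fun _ => ℝ) (fun i => ‖p.2 i‖ ^ 2) p.1 : Fin (n + 1) → ℝ)) =
      e.symm ∘ Prod.map id fun (v : Fin n → ℂ) i => ‖v i‖ ^ 2 := by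
    ext p j
    simp [e, MeasurableEquiv.piFinSuccAbove, Fin.insertNthEquiv]
  have hm : Measurable fun (v : Fin n → ℂ) i => ‖v i‖ ^ 2 := by fun_prop
  rw [hcomp, ← Measure.map_map e.symm.measurable (by fun_prop), Measure.volume_eq_prod,
    ← Measure.map_prod_map _ _ measurable_id hm, Measure.map_id, map_norm_sq_pi_volume,
    Measure.prod_smul_right, Measure.map_smul]
  congr 1
  have hset : (e ⁻¹' (Set.univ ×ˢ (Set.univ.pi fun _ : Fin n => Set.Ioi (0 : ℝ)))) =
      {w : Fin (n + 1) → ℝ | ∀ i : Fin n, 0 < w i.castSucc} := by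
    ext w
    simp [e, MeasurableEquiv.piFinSuccAbove, Fin.insertNthEquiv, Fin.init]
  have hms : MeasurableSet ((Set.univ : Set ℝ) ×ˢ (Set.univ.pi fun _ : Fin n => Set.Ioi (0 : ℝ))) :=
    MeasurableSet.univ.prod (MeasurableSet.univ_pi fun _ => measurableSet_Ioi)
  have h2 := (he.restrict_preimage hms).map_eq
  rw [hset] at h2
  rw [← Measure.restrict_univ (μ := (volume : Measure ℝ)), Measure.prod_restrict,
    ← Measure.volume_eq_prod, ← h2, Measure.map_map e.symm.measurable e.measurable]
  simp

/-- The action of a unitary matrix on `ℂⁿ` preserves the volume. -/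
theorem map_unitary_mulVec_volume {n : ℕ} {U : Matrix (Fin n) (Fin n) ℂ}
    (hU : U ∈ unitaryGroup (Fin n) ℂ) :
    Measure.map (fun v : Fin n → ℂ => U *ᵥ v) volume = volume := by
  have hdet : LinearMap.det ((toLin' U).restrictScalars ℝ) = 1 := by
    rw [LinearMap.det_restrictScalars, LinearMap.det_toLin', Algebra.norm_complex_apply]
    have h := congrArg det (mem_unitaryGroup_iff.1 hU)
    rw [det_mul, star_eq_conjTranspose, det_conjTranspose, det_one] at h
    have h2 : ((Complex.normSq U.det : ℝ) : ℂ) = 1 := by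
      rw [← Complex.mul_conj]; exact h
    exact_mod_cast h2
  have h := Measure.map_linearMap_addHaar_eq_smul_addHaar (volume : Measure (Fin n → ℂ))
    (f := (toLin' U).restrictScalars ℝ) (by simp [hdet])
  rw [hdet, inv_one, abs_one, ENNReal.ofReal_one, one_smul] at h
  exact h

/-- The integral over the border of a bordered diagonal matrix, in terms of the interlacing
eigenvalues. -/
theorem integral_border {n : ℕ} {y : Fin n → ℝ} (hy : StrictMono y)
    {G : (Fin (n + 1) → ℝ) → ℂ} (hG : Measurable G) :
    ∫ p : ℝ × (Fin n → ℂ), G (Fin.snoc (α := fun _ => ℝ) (fun i => ‖p.2 i‖ ^ 2) p.1) =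
      (Real.pi : ℂ) ^ n * ∫ k in {k | Interlaces y k},
        ((vandermondeProd k / vandermondeProd y : ℝ) : ℂ) * G (borderData y k) := by
  have hm : Measurable fun p : ℝ × (Fin n → ℂ) =>
      (Fin.snoc (α := fun _ => ℝ) (fun i => ‖p.2 i‖ ^ 2) p.1 : Fin (n + 1) → ℝ) := by
    refine measurable_pi_iff.2 fun j => ?_
    refine Fin.lastCases ?_ (fun j => ?_) j
    · simp only [Fin.snoc_last]; fun_prop
    · simp only [Fin.snoc_castSucc]; fun_prop
  rw [← setIntegral_borderData hy, ← integral_map hm.aemeasurable hG.aestronglyMeasurable,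
    map_snoc_norm_sq_volume, integral_smul_nnreal_measure, NNReal.smul_def, Complex.real_smul]
  simp

instance isAddHaarMeasure_volume_border (n : ℕ) :
    (volume : Measure (ℝ × (Fin n → ℂ))).IsAddHaarMeasure :=
  Measure.prod.instIsAddHaarMeasure (volume : Measure ℝ) (volume : Measure (Fin n → ℂ))

namespace HermitianSpace

/-- Haar measure on Hermitian matrices, disintegrated along the last row and column. -/
theorem exists_eq_smul_map_borderedEquiv {n : ℕ} (ν : Measure (HermitianSpace n))
    [ν.IsAddHaarMeasure] (μ : Measure (HermitianSpace (n + 1))) [μ.IsAddHaarMeasure] :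
    ∃ c : NNReal, μ = c • Measure.map (borderedEquiv n) (ν.prod volume) := by
  have : (ν.prod (volume : Measure (ℝ × (Fin n → ℂ)))).IsAddHaarMeasure :=
    Measure.prod.instIsAddHaarMeasure _ _
  have : (Measure.map (borderedEquiv n) (ν.prod volume)).IsAddHaarMeasure :=
    (borderedEquiv n).isAddHaarMeasure_map (ν.prod volume)
  exact exists_smul_eq μ _

end HermitianSpace

theorem integrable_exp_neg_mul_norm_sq {ε : ℝ} (hε : 0 < ε) :
    Integrable fun z : ℂ => Real.exp (-ε * ‖z‖ ^ 2) := by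
  have h := (GaussianFourier.integrable_cexp_neg_mul_sq_norm_add (b := (ε : ℂ)) (V := ℂ)
    (by simpa using hε) 0 0).norm
  refine h.congr (Filter.Eventually.of_forall fun z => ?_)
  simp only [Complex.norm_exp]
  congr 1
  simp [← Complex.ofReal_pow]

theorem integrable_exp_neg_mul_sum_sq {n : ℕ} {ε : ℝ} (hε : 0 < ε) :
    Integrable fun k : Fin n → ℝ => Real.exp (-ε * ∑ i, k i ^ 2) := by
  have h := Integrable.fintype_prod (ι := Fin n) (μ := fun _ => (volume : Measure ℝ))
    fun _ => integrable_exp_neg_mul_sq hε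
  refine h.congr (Filter.Eventually.of_forall fun k => ?_)
  simp only [← Real.exp_sum, Finset.mul_sum]

theorem integrable_border {n : ℕ} {ε : ℝ} (hε : 0 < ε) :
    Integrable fun p : ℝ × (Fin n → ℂ) =>
      Real.exp (-ε * (2 * ∑ i, ‖p.2 i‖ ^ 2 + p.1 ^ 2)) := by
  have h := Integrable.fintype_prod (ι := Fin n) (μ := fun _ => (volume : Measure ℂ))
    fun _ => integrable_exp_neg_mul_norm_sq (mul_pos hε two_pos)
  refine ((integrable_exp_neg_mul_sq hε).mul_prod h).congr
    (Filter.Eventually.of_forall fun p => ?_)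
  simp only [← Real.exp_sum, ← Real.exp_add, ← Finset.mul_sum]
  congr 1
  ring

theorem integrable_exp_neg_mul_entrySq {n : ℕ} (μ : Measure (HermitianSpace n))
    [μ.IsAddHaarMeasure] {ε : ℝ} (hε : 0 < ε) :
    Integrable (fun K : HermitianSpace n => Real.exp (-ε * entrySq (K : Matrix (Fin n) (Fin n) ℂ))) μ := by
  induction n with
  | zero =>
    have hfin : IsFiniteMeasure μ := by
      have : Subsingleton (HermitianSpace 0) := ⟨fun a b => Subtype.ext (Subsingleton.elim _ _)⟩
      have : CompactSpace (HermitianSpace 0) := inferInstance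
      infer_instance
    simp only [entrySq, Finset.univ_eq_empty, Finset.sum_empty]
    exact integrable_const _
  | succ n ih =>
    obtain ⟨c, rfl⟩ := HermitianSpace.exists_eq_smul_map_borderedEquiv Measure.addHaar μ
    refine Integrable.smul_measure_nnreal ?_
    refine ((borderedEquiv n).toHomeomorph.toMeasurableEquiv.measurableEmbedding.integrable_map_iff).2
      ?_
    refine ((ih Measure.addHaar).mul_prod (integrable_border hε)).congr
      (Filter.Eventually.of_forall fun p => ?_)
    change _ = Real.exp (-ε * entrySq (borderedMatrix p.1.1 p.2.1 p.2.2))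
    beta_reduce
    rw [entrySq_borderedMatrix, ← Real.exp_add]
    congr 1
    ring

theorem abs_vandermondeProd_le {n : ℕ} {ε : ℝ} (hε : 0 < ε) (k : Fin n → ℝ) :
    |vandermondeProd k| ≤ Real.exp (n * (n ^ 2 / ε)) * Real.exp (ε * ∑ i, k i ^ 2) := by
  have h1 : ∀ i j, |k j - k i| ≤ Real.exp (|k i| + |k j|) := fun i j => by
    have := Real.add_one_le_exp (|k i| + |k j|)
    have := abs_sub (k j) (k i)
    linarith
  have h2 : |vandermondeProd k| ≤ ∏ i, ∏ j, Real.exp (|k i| + |k j|) := by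
    rw [vandermondeProd, Finset.abs_prod]
    refine Finset.prod_le_prod (fun _ _ => abs_nonneg _) fun i _ => ?_
    rw [Finset.abs_prod]
    refine (Finset.prod_le_prod (fun _ _ => abs_nonneg _) fun j _ => h1 i j).trans ?_
    exact Finset.prod_le_prod_of_subset_of_one_le (Finset.subset_univ _)
      (fun _ _ => (Real.exp_pos _).le) fun _ _ _ => Real.one_le_exp (by positivity)
  refine h2.trans ?_
  simp only [← Real.exp_sum, ← Real.exp_add]
  rw [Real.exp_le_exp]
  have h3 : ∀ i, 2 * n * |k i| ≤ (n : ℝ) ^ 2 / ε + ε * k i ^ 2 := fun i => by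
    have : (n : ℝ) ^ 2 / ε + ε * k i ^ 2 - 2 * n * |k i| = (n - ε * |k i|) ^ 2 / ε := by
      rw [← sq_abs (k i)]
      field_simp
      ring
    have : 0 ≤ (n - ε * |k i|) ^ 2 / ε := by positivity
    linarith
  calc ∑ i, ∑ j, (|k i| + |k j|) = ∑ i, 2 * n * |k i| := by
        simp only [Finset.sum_add_distrib, Finset.sum_const, Finset.card_univ, Fintype.card_fin,
          nsmul_eq_mul, ← Finset.mul_sum]
        ring
    _ ≤ ∑ i, ((n : ℝ) ^ 2 / ε + ε * k i ^ 2) := Finset.sum_le_sum fun i _ => h3 i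
    _ = _ := by simp [Finset.sum_add_distrib, Finset.mul_sum]

theorem integral_pi_det {n : ℕ} {α : Type*} [MeasurableSpace α] {μ : Fin n → Measure α}
    [∀ i, SigmaFinite (μ i)] {f : Fin n → Fin n → α → ℂ} (hf : ∀ i j, Integrable (f i j) (μ i)) :
    ∫ y, det (of fun i j => f i j (y i)) ∂Measure.pi μ =
      det (of fun i j => ∫ z, f i j z ∂μ i) := by
  have h : ∀ A : Matrix (Fin n) (Fin n) ℂ, A.det =
      ∑ σ : Equiv.Perm (Fin n), (Equiv.Perm.sign σ : ℂ) * ∏ i, A i (σ i) := fun A => by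
    rw [← det_transpose, det_apply']
    rfl
  simp only [h, of_apply]
  rw [integral_finsetSum]
  · refine Finset.sum_congr rfl fun σ _ => ?_
    rw [integral_const_mul, integral_fintype_prod_eq_prod (fun i => f i (σ i))]
  · exact fun σ _ => (Integrable.fintype_prod_dep fun i => hf i (σ i)).const_mul _

theorem det_eq_det_sub_of_last_eq_one {R : Type*} [CommRing R] {n : ℕ}
    (E : Matrix (Fin (n + 1)) (Fin (n + 1)) R) (hE : ∀ i, E i (Fin.last n) = 1) :
    E.det = (-1) ^ n *
      det (of fun i j : Fin n => E i.succ j.castSucc - E i.castSucc j.castSucc) := by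
  set D : Matrix (Fin (n + 1)) (Fin (n + 1)) R :=
    of fun i j => Fin.cases (motive := fun _ => R) (E 0 j)
      (fun i => E i.succ j - E i.castSucc j) i with hD
  have h : E.det = D.det :=
    det_eq_of_forall_row_eq_smul_add_pred 1 (fun j => by simp [hD]) fun i j => by simp [hD]
  rw [h, det_succ_column D (Fin.last n), Fin.sum_univ_succ, Finset.sum_eq_zero]
  · simp only [hD, of_apply, Fin.cases_zero, hE, Fin.val_zero, Fin.val_last, zero_add, mul_one,
      add_zero]
    congr 2
    ext i j
    simp
  · intro i _
    simp [hD, hE]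

theorem setIntegral_Ioo_cexp {a b : ℝ} (hab : a ≤ b) {c : ℂ} (hc : c ≠ 0) :
    ∫ z in Set.Ioo a b, Complex.exp (c * z) = c⁻¹ * (Complex.exp (c * b) - Complex.exp (c * a)) := by
  rw [← integral_Ioc_eq_integral_Ioo, ← intervalIntegral.integral_of_le hab,
    integral_exp_mul_complex hc, div_eq_inv_mul]

theorem setIntegral_interlaces_det {n : ℕ} {x k : Fin (n + 1) → ℝ} (hx : Function.Injective x)
    (hk : StrictMono k) :
    ∫ y in {y | Interlaces y k}, det (of fun i j : Fin n =>
        Complex.exp (-Complex.I * (x j.castSucc - x (Fin.last n)) * y i)) =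
      Complex.I ^ n * (∏ j : Fin n, ((x (Fin.last n) : ℂ) - x j.castSucc))⁻¹ *
        Complex.exp (Complex.I * x (Fin.last n) * ∑ i, (k i : ℂ)) *
        det (of fun i j => Complex.exp (-Complex.I * x j * k i)) := by
  have hset : {y | Interlaces y k} =
      Set.univ.pi fun i : Fin n => Set.Ioo (k i.castSucc) (k i.succ) := by
    ext y
    simp [Interlaces]
  have hc : ∀ j : Fin n, -Complex.I * (x j.castSucc - x (Fin.last n)) ≠ 0 := fun j => by
    refine mul_ne_zero (by simp) (sub_ne_zero.2 fun h => ?_)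
    exact (Fin.castSucc_lt_last j).ne (hx (by exact_mod_cast h))
  have hdet : det (of fun i j => Complex.exp (-Complex.I * x j * k i)) =
      Complex.exp (-Complex.I * x (Fin.last n) * ∑ i, (k i : ℂ)) *
        det (of fun i j => Complex.exp (-Complex.I * (x j - x (Fin.last n)) * k i)) := by
    rw [Finset.mul_sum, Complex.exp_sum, ← det_mul_column]
    congr 1
    ext i j
    rw [of_apply, of_apply, of_apply, ← Complex.exp_add]
    congr 1
    ring
  rw [hset, volume_pi, Measure.restrict_pi_pi, integral_pi_det (μ := fun i : Fin n =>
    volume.restrict (Set.Ioo (k i.castSucc) (k i.succ))) (f := fun _ j z =>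
    Complex.exp (-Complex.I * (x j.castSucc - x (Fin.last n)) * z))]
  · simp only [fun (i j : Fin n) => setIntegral_Ioo_cexp
      (hk (Fin.castSucc_lt_succ (i := i))).le (hc j)]
    have := det_mul_row (fun j : Fin n => (-Complex.I * (x j.castSucc - x (Fin.last n)))⁻¹)
      (of fun i j : Fin n => Complex.exp (-Complex.I * (x j.castSucc - x (Fin.last n)) * k i.succ) -
        Complex.exp (-Complex.I * (x j.castSucc - x (Fin.last n)) * k i.castSucc))
    simp only [of_apply] at this
    rw [this, hdet, det_eq_det_sub_of_last_eq_one (of fun i j => _) fun i => by simp]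
    simp only [of_apply]
    have h1 : Complex.exp (Complex.I * x (Fin.last n) * ∑ i, (k i : ℂ)) *
        Complex.exp (-Complex.I * x (Fin.last n) * ∑ i, (k i : ℂ)) = 1 := by
      rw [← Complex.exp_add]
      simp
    have h2 : ∏ j : Fin n, (-Complex.I * ((x j.castSucc : ℂ) - x (Fin.last n)))⁻¹ =
        Complex.I ^ n * (∏ j : Fin n, ((x (Fin.last n) : ℂ) - x j.castSucc))⁻¹ * (-1) ^ n := by
      rw [← Finset.prod_inv_distrib]
      have : ∀ m : ℕ, ∀ z : ℂ, z ^ n = ∏ _j : Fin n, z := by simp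
      rw [this n Complex.I, this n (-1), ← Finset.prod_mul_distrib, ← Finset.prod_mul_distrib]
      refine Finset.prod_congr rfl fun j _ => ?_
      have h3 := right_ne_zero_of_mul (hc j)
      have h4 : (x (Fin.last n) : ℂ) - x j.castSucc ≠ 0 := by
        rw [← neg_sub]; exact neg_ne_zero.2 h3
      have h5 := Complex.I_sq
      field_simp
      linear_combination (-(x (Fin.last n) : ℂ) + x j.castSucc) * h5
    rw [h2]
    linear_combination -(Complex.I ^ n * (∏ j : Fin n, ((x (Fin.last n) : ℂ) - x j.castSucc))⁻¹ *
      (-1) ^ n * det (of fun i j : Fin n =>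
        Complex.exp (-Complex.I * (x j.castSucc - x (Fin.last n)) * k i.succ) -
        Complex.exp (-Complex.I * (x j.castSucc - x (Fin.last n)) * k i.castSucc))) * h1
  · intro i j
    exact (Continuous.integrableOn_Icc (by fun_prop)).mono_set Set.Ioo_subset_Icc_self

/-- A unitarily invariant function of Hermitian matrices with Gaussian decay. -/
structure IsGaussianClassFunction {n : ℕ} (Φ : Matrix (Fin n) (Fin n) ℂ → ℂ) : Prop where
  measurable : Measurable Φ
  conj {K U : Matrix (Fin n) (Fin n) ℂ} (hK : K.IsHermitian) (hU : U ∈ unitaryGroup (Fin n) ℂ) :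
    Φ (U * K * star U) = Φ K
  bound : ∃ C ε : ℝ, 0 < ε ∧ ∀ K : Matrix (Fin n) (Fin n) ℂ, K.IsHermitian →
    ‖Φ K‖ ≤ C * Real.exp (-ε * entrySq K)

theorem isHermitian_diagonal_ofReal {n : ℕ} (k : Fin n → ℝ) :
    (diagonal fun i => (k i : ℂ)).IsHermitian :=
  isHermitian_diagonal_of_self_adjoint _ (by ext i; simp)

theorem norm_cexp_neg_I_mul (a b : ℝ) : ‖Complex.exp (-Complex.I * a * b)‖ = 1 := by
  rw [show -Complex.I * a * b = ((-(a * b) : ℝ) : ℂ) * Complex.I by push_cast; ring]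
  exact Complex.norm_exp_ofReal_mul_I _

theorem norm_cexp_neg_I_mul_sum_diag {n : ℕ} {K : Matrix (Fin n) (Fin n) ℂ} (hK : K.IsHermitian)
    (x : Fin n → ℝ) : ‖Complex.exp (-Complex.I * ∑ i, K i i * (x i : ℂ))‖ = 1 := by
  have h2 : ∀ i, K i i = ((K i i).re : ℂ) := fun i =>
    (Complex.conj_eq_iff_re.1 (hK.apply i i)).symm
  have h3 : (∑ i, K i i * (x i : ℂ)) = ((∑ i, (K i i).re * x i : ℝ) : ℂ) := by
    push_cast
    exact Finset.sum_congr rfl fun i _ => by rw [← h2]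
  rw [h3]
  simpa using norm_cexp_neg_I_mul 1 (∑ i, (K i i).re * x i)

theorem HermitianSpace.continuous_cexp_sum_diag {n : ℕ} (x : Fin n → ℝ) :
    Continuous fun K : HermitianSpace n =>
      Complex.exp (-Complex.I * ∑ i, K.1 i i * (x i : ℂ)) :=
  Complex.continuous_exp.comp (continuous_const.mul (continuous_finsetSum _ fun i _ =>
    (continuous_subtype_val.matrix_elem i i).mul continuous_const))

/-- The Fourier transform of a function of Hermitian matrices with respect to the last row and
column, evaluated at a diagonal frequency. -/
noncomputable def borderTransform {n : ℕ} (s : ℝ)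
    (Φ : Matrix (Fin (n + 1)) (Fin (n + 1)) ℂ → ℂ) (K : Matrix (Fin n) (Fin n) ℂ) : ℂ :=
  ∫ p : ℝ × (Fin n → ℂ), Complex.exp (-Complex.I * s * p.1) * Φ (borderedMatrix K p.1 p.2)

namespace IsGaussianClassFunction

variable {n : ℕ} {Φ : Matrix (Fin (n + 1)) (Fin (n + 1)) ℂ → ℂ}

theorem measurable_border (hΦ : IsGaussianClassFunction Φ) (s : ℝ) :
    Measurable fun q : Matrix (Fin n) (Fin n) ℂ × ℝ × (Fin n → ℂ) =>
      Complex.exp (-Complex.I * s * q.2.1) * Φ (borderedMatrix q.1 q.2.1 q.2.2) := by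
  refine Measurable.mul ?_ (hΦ.measurable.comp continuous_borderedMatrix.measurable)
  have : Measurable fun q : Matrix (Fin n) (Fin n) ℂ × ℝ × (Fin n → ℂ) => q.2.1 :=
    measurable_fst.comp measurable_snd
  fun_prop

theorem borderTransform (hΦ : IsGaussianClassFunction Φ) (s : ℝ) :
    IsGaussianClassFunction (borderTransform s Φ) where
  measurable :=
    (hΦ.measurable_border s).stronglyMeasurable.integral_prod_right'.measurable
  conj {K U} hK hU := by
    obtain ⟨V, hV, h⟩ := exists_unitary_borderedMatrix hU
    have hmp : MeasurePreserving (Prod.map id fun v : Fin n → ℂ => U *ᵥ v)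
        (volume : Measure (ℝ × (Fin n → ℂ))) volume :=
      (MeasurePreserving.id volume).prod
        ⟨(Continuous.matrix_mulVec continuous_const continuous_id).measurable,
          map_unitary_mulVec_volume hU⟩
    have hm : Measurable fun p : ℝ × (Fin n → ℂ) => Complex.exp (-Complex.I * s * p.1) *
        Φ (borderedMatrix (U * K * star U) p.1 p.2) :=
      (hΦ.measurable_border s).comp (measurable_prodMk_left (x := U * K * star U))
    unfold _root_.borderTransform
    conv_lhs => rw [← hmp.map_eq]
    rw [integral_map hmp.aemeasurable hm.aestronglyMeasurable]
    refine integral_congr_ae (Filter.Eventually.of_forall fun p => ?_)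
    simp only [Prod.map_fst, Prod.map_snd, id_eq, h,
      hΦ.conj (isHermitian_borderedMatrix _ _ hK) hV]
  bound := by
    obtain ⟨C, ε, hε, hb⟩ := hΦ.bound
    refine ⟨C * ∫ p : ℝ × (Fin n → ℂ), Real.exp (-ε * (2 * ∑ i, ‖p.2 i‖ ^ 2 + p.1 ^ 2)), ε, hε,
      fun K hK => ?_⟩
    rw [mul_assoc, mul_comm (integral _ _), ← mul_assoc, ← integral_const_mul]
    refine norm_integral_le_of_norm_le ((integrable_border hε).const_mul _)
      (Filter.Eventually.of_forall fun p => ?_)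
    rw [norm_mul, norm_cexp_neg_I_mul, one_mul]
    refine (hb _ (isHermitian_borderedMatrix _ _ hK)).trans_eq ?_
    rw [entrySq_borderedMatrix, mul_assoc, ← Real.exp_add]
    congr 2
    ring

theorem integral_hermitianSpace_succ (hΦ : IsGaussianClassFunction Φ)
    (ν : Measure (HermitianSpace n)) [ν.IsAddHaarMeasure] (x : Fin (n + 1) → ℝ) :
    ∫ K : HermitianSpace (n + 1), Complex.exp (-Complex.I * ∑ i, K.1 i i * x i) * Φ K.1
        ∂(Measure.map (borderedEquiv n) (ν.prod volume)) =
      ∫ K : HermitianSpace n, Complex.exp (-Complex.I * ∑ i : Fin n, K.1 i i * x i.castSucc) *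
        _root_.borderTransform (x (Fin.last n)) Φ K.1 ∂ν := by
  obtain ⟨C, ε, hε, hb⟩ := hΦ.bound
  refine ((borderedEquiv n).toHomeomorph.toMeasurableEquiv.measurableEmbedding.integral_map
    _).trans ?_
  have hfun : (fun p : HermitianSpace n × ℝ × (Fin n → ℂ) =>
      Complex.exp (-Complex.I * ∑ i, (borderedEquiv n p).1 i i * (x i : ℂ)) *
        Φ (borderedEquiv n p).1) = fun p =>
      Complex.exp (-Complex.I * ∑ i : Fin n, p.1.1 i i * (x i.castSucc : ℂ)) *
        (Complex.exp (-Complex.I * x (Fin.last n) * p.2.1) *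
          Φ (borderedMatrix p.1.1 p.2.1 p.2.2)) := by
    ext p
    rw [borderedEquiv_apply, ← mul_assoc, ← Complex.exp_add, Fin.sum_univ_castSucc]
    congr 2
    simp only [borderedMatrix_castSucc_castSucc, borderedMatrix_last_last]
    ring
  change (∫ p : HermitianSpace n × ℝ × (Fin n → ℂ),
      Complex.exp (-Complex.I * ∑ i, (borderedEquiv n p).1 i i * (x i : ℂ)) *
        Φ (borderedEquiv n p).1 ∂(ν.prod volume)) = _
  rw [hfun, integral_prod]
  · simp only [integral_const_mul]
    rfl
  · refine (((integrable_exp_neg_mul_entrySq ν hε).mul_prod (integrable_border hε)).const_mul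
      C).mono' ?_ (Filter.Eventually.of_forall fun p => ?_)
    · refine Measurable.aestronglyMeasurable (Measurable.mul ?_ ?_)
      · exact (HermitianSpace.continuous_cexp_sum_diag fun i => x i.castSucc).measurable.comp
          measurable_fst
      · exact (hΦ.measurable_border (x (Fin.last n))).comp
          ((measurable_subtype_coe.comp measurable_fst).prodMk measurable_snd)
    · rw [norm_mul, norm_mul, norm_cexp_neg_I_mul, one_mul,
        norm_cexp_neg_I_mul_sum_diag p.1.2 fun i => x i.castSucc, one_mul]
      refine (hb _ (isHermitian_borderedMatrix _ _ p.1.2)).trans_eq ?_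
      rw [entrySq_borderedMatrix, ← Real.exp_add]
      congr 2
      ring

theorem apply_borderedMatrix_diagonal_norm (hΦ : IsGaussianClassFunction Φ) (y : Fin n → ℝ)
    (t : ℝ) (v : Fin n → ℂ) :
    Φ (borderedMatrix (diagonal fun i => (y i : ℂ)) t v) =
      Φ (borderedMatrix (diagonal fun i => (y i : ℂ)) t fun i => (‖v i‖ : ℂ)) := by
  have hph : ∀ z : ℂ, ∃ u : ℂ, u * star u = 1 ∧ u * ‖z‖ = z := fun z => by
    refine ⟨Complex.exp (Complex.arg z * Complex.I), ?_, ?_⟩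
    · rw [Complex.star_def, Complex.mul_conj, Complex.normSq_eq_norm_sq,
        Complex.norm_exp_ofReal_mul_I]
      simp
    · rw [mul_comm]; exact Complex.norm_mul_exp_arg_mul_I z
  choose u hu huz using fun i => hph (v i)
  have hU : diagonal u ∈ unitaryGroup (Fin n) ℂ := by
    rw [mem_unitaryGroup_iff, star_eq_conjTranspose, diagonal_conjTranspose,
      diagonal_mul_diagonal, ← diagonal_one]
    congr 1
    ext i
    exact hu i
  obtain ⟨V, hV, h⟩ := exists_unitary_borderedMatrix hU
  have h2 := h (diagonal fun i => (y i : ℂ)) t fun i => (‖v i‖ : ℂ)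
  have h3 : diagonal u * (diagonal fun i => (y i : ℂ)) * star (diagonal u) =
      diagonal fun i => (y i : ℂ) := by
    rw [star_eq_conjTranspose, diagonal_conjTranspose, diagonal_mul_diagonal,
      diagonal_mul_diagonal]
    congr 1
    ext i
    have := hu i
    simp only [Pi.star_apply]
    linear_combination (y i : ℂ) * this
  have h4 : (diagonal u *ᵥ fun i => (‖v i‖ : ℂ)) = v := by
    ext i
    rw [mulVec_diagonal, huz]
  rw [h3, h4] at h2
  rw [h2, hΦ.conj (isHermitian_borderedMatrix _ _ (isHermitian_diagonal_ofReal y)) hV]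

theorem borderTransform_diagonal (hΦ : IsGaussianClassFunction Φ) (s : ℝ) {y : Fin n → ℝ}
    (hy : StrictMono y) :
    _root_.borderTransform s Φ (diagonal fun i => (y i : ℂ)) =
      (Real.pi : ℂ) ^ n * ∫ k in {k | Interlaces y k},
        ((vandermondeProd k / vandermondeProd y : ℝ) : ℂ) *
          (Complex.exp (-Complex.I * s * (∑ j, (k j : ℂ) - ∑ i, (y i : ℂ))) *
            Φ (diagonal fun i => (k i : ℂ))) := by
  set G : (Fin (n + 1) → ℝ) → ℂ := fun w => Complex.exp (-Complex.I * s * w (Fin.last n)) *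
    Φ (borderedMatrix (diagonal fun i => (y i : ℂ)) (w (Fin.last n))
      fun i => (√(w i.castSucc) : ℂ)) with hG
  have hGm : Measurable G := by
    have h1 : Measurable fun w : Fin (n + 1) → ℝ =>
        (w (Fin.last n), fun i : Fin n => (√(w i.castSucc) : ℂ)) := by fun_prop
    exact ((hΦ.measurable_border s).comp measurable_prodMk_left).comp h1
  have h := integral_border hy hGm
  have hm : MeasurableSet {k | Interlaces y k} :=
    measurableSet_interlaces.preimage measurable_prodMk_left
  calc _ = ∫ p : ℝ × (Fin n → ℂ), G (Fin.snoc (α := fun _ => ℝ) (fun i => ‖p.2 i‖ ^ 2) p.1) := by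
        refine integral_congr_ae (Filter.Eventually.of_forall fun p => ?_)
        simp only [hG, Fin.snoc_last, Fin.snoc_castSucc, Real.sqrt_sq (norm_nonneg _)]
        rw [hΦ.apply_borderedMatrix_diagonal_norm]
    _ = _ := h
    _ = _ := by
        congr 1
        refine setIntegral_congr_fun hm fun k hk => ?_
        have hk : Interlaces y k := hk
        congr 1
        simp only [hG]
        congr 1
        · simp [borderData]
        · have hsq : (fun i : Fin n => ‖((√(borderData y k i.castSucc) : ℝ) : ℂ)‖ ^ 2) =
              fun i => borderData y k i.castSucc := by
            ext i
            rw [Complex.norm_real, Real.norm_eq_abs, sq_abs, Real.sq_sqrt (borderData_pos hk i).le]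
          obtain ⟨U, hU, h⟩ := exists_unitary_borderedMatrix_diagonal
            (v := fun i => ((√(borderData y k i.castSucc) : ℝ) : ℂ))
            (t := borderData y k (Fin.last n)) hk.strictMono.injective hk.ne fun j => by
              rw [hsq, secular_borderData hy.injective, Polynomial.eval_prod]
              exact Finset.prod_eq_zero (Finset.mem_univ j) (by simp)
          rw [h, hΦ.conj (isHermitian_diagonal_ofReal k) hU]

end IsGaussianClassFunction

theorem norm_det_le_factorial {n : ℕ} {A : Matrix (Fin n) (Fin n) ℂ} (hA : ∀ i j, ‖A i j‖ ≤ 1) :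
    ‖A.det‖ ≤ n.factorial := by
  rw [det_apply]
  refine (norm_sum_le _ _).trans ?_
  have h : ∀ σ ∈ (Finset.univ : Finset (Equiv.Perm (Fin n))),
      ‖Equiv.Perm.sign σ • ∏ i, A (σ i) i‖ ≤ 1 := fun σ _ => by
    have h1 : ‖∏ i, A (σ i) i‖ ≤ 1 := by
      rw [norm_prod]
      exact Finset.prod_le_one (fun _ _ => norm_nonneg _) fun _ _ => hA _ _
    rcases Int.units_eq_one_or (Equiv.Perm.sign σ) with h | h <;> simpa [h] using h1
  refine (Finset.sum_le_sum h).trans ?_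
  simp [Fintype.card_perm]

/-- The alternating sum of plane waves with frequencies `x` at the points `k`. -/
noncomputable def planeWaveDet {n : ℕ} (x k : Fin n → ℝ) : ℂ :=
  det (of fun i j => Complex.exp (-Complex.I * x j * k i))

theorem continuous_planeWaveDet {n : ℕ} (x : Fin n → ℝ) : Continuous (planeWaveDet x) :=
  Continuous.matrix_det (continuous_matrix fun i j => by simp only [of_apply]; fun_prop)

theorem norm_planeWaveDet_le {n : ℕ} (x k : Fin n → ℝ) : ‖planeWaveDet x k‖ ≤ n.factorial :=
  norm_det_le_factorial fun i j => (norm_cexp_neg_I_mul (x j) (k i)).le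

theorem continuous_vandermondeProd (n : ℕ) :
    Continuous (vandermondeProd : (Fin n → ℝ) → ℝ) := by
  unfold vandermondeProd
  fun_prop

theorem measurable_diagonal_ofReal (n : ℕ) :
    Measurable fun k : Fin n → ℝ => (diagonal fun i => (k i : ℂ)) :=
  (Continuous.matrix_diagonal (continuous_pi fun i =>
    Complex.continuous_ofReal.comp (continuous_apply i))).measurable

theorem Interlaces.sum_sq_le {n : ℕ} {y : Fin n → ℝ} {k : Fin (n + 1) → ℝ} (h : Interlaces y k) :
    ∑ i, y i ^ 2 ≤ 2 * ∑ i, k i ^ 2 := by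
  have h1 : ∀ i, y i ^ 2 ≤ k i.castSucc ^ 2 + k i.succ ^ 2 := fun i => by
    obtain ⟨h1, h2⟩ := h i
    rcases le_total 0 (y i) with hy | hy
    · nlinarith [sq_nonneg (k i.castSucc)]
    · nlinarith [sq_nonneg (k i.succ)]
  refine (Finset.sum_le_sum fun i _ => h1 i).trans ?_
  rw [Finset.sum_add_distrib, two_mul]
  refine add_le_add ?_ ?_
  · rw [Fin.sum_univ_castSucc (fun i => k i ^ 2)]
    exact le_add_of_nonneg_right (sq_nonneg _)
  · rw [Fin.sum_univ_succ (fun i => k i ^ 2)]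
    exact le_add_of_nonneg_left (sq_nonneg _)

theorem measurableSet_strictMono (n : ℕ) : MeasurableSet {k : Fin n → ℝ | StrictMono k} := by
  have : {k : Fin n → ℝ | StrictMono k} = ⋂ i, ⋂ j, {k | i < j → k i < k j} := by
    ext k
    simp [StrictMono]
  rw [this]
  refine MeasurableSet.iInter fun i => MeasurableSet.iInter fun j => ?_
  by_cases hij : i < j
  · simpa [hij] using measurableSet_lt (measurable_pi_apply i) (measurable_pi_apply j)
  · simp [hij]

namespace IsGaussianClassFunction

variable {n : ℕ}

theorem measurable_diagonal {Φ : Matrix (Fin n) (Fin n) ℂ → ℂ} (hΦ : IsGaussianClassFunction Φ) :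
    Measurable fun k : Fin n → ℝ => Φ (diagonal fun i => (k i : ℂ)) :=
  hΦ.measurable.comp (measurable_diagonal_ofReal n)

theorem exists_bound_vandermondeProd {Φ : Matrix (Fin n) (Fin n) ℂ → ℂ}
    (hΦ : IsGaussianClassFunction Φ) : ∃ C ε : ℝ, 0 < ε ∧ ∀ k : Fin n → ℝ,
      ‖((vandermondeProd k : ℝ) : ℂ) * Φ (diagonal fun i => (k i : ℂ))‖ ≤
        C * Real.exp (-ε * ∑ i, k i ^ 2) := by
  obtain ⟨C, ε, hε, hb⟩ := hΦ.bound
  refine ⟨Real.exp (n * (n ^ 2 / (ε / 2))) * C, ε / 2, half_pos hε, fun k => ?_⟩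
  have h := hb _ (isHermitian_diagonal_ofReal k)
  rw [norm_mul, Complex.norm_real, Real.norm_eq_abs]
  refine (mul_le_mul (abs_vandermondeProd_le (half_pos hε) k) h (norm_nonneg _)
    (by positivity)).trans_eq ?_
  rw [entrySq_diagonal]
  have : Real.exp (-(ε / 2) * ∑ i, k i ^ 2) =
      Real.exp (ε / 2 * ∑ i, k i ^ 2) * Real.exp (-ε * ∑ i, k i ^ 2) := by
    rw [← Real.exp_add]
    congr 1
    ring
  rw [this]
  ring

variable {Φ : Matrix (Fin (n + 1)) (Fin (n + 1)) ℂ → ℂ}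

theorem integrable_interlaces (hΦ : IsGaussianClassFunction Φ) (s : ℝ) (a : Fin n → ℝ) :
    Integrable ({p : (Fin n → ℝ) × (Fin (n + 1) → ℝ) | Interlaces p.1 p.2}.indicator fun p =>
      planeWaveDet a p.1 * (Complex.exp (-Complex.I * s * (∑ j, p.2 j : ℝ)) *
        (((vandermondeProd p.2 : ℝ) : ℂ) * Φ (diagonal fun i => (p.2 i : ℂ))))) := by
  obtain ⟨C, ε, hε, hb⟩ := hΦ.exists_bound_vandermondeProd
  have hC : 0 ≤ C := nonneg_of_mul_nonneg_left ((norm_nonneg _).trans (hb 0)) (Real.exp_pos _)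
  have h4 : 0 < ε / 4 := by positivity
  refine (((integrable_exp_neg_mul_sum_sq (n := n) h4).mul_prod
    (integrable_exp_neg_mul_sum_sq (n := n + 1) (half_pos hε))).const_mul
      (n.factorial * C)).mono' ?_ (Filter.Eventually.of_forall fun p => ?_)
  · refine (Measurable.indicator ?_ measurableSet_interlaces).aestronglyMeasurable
    refine ((continuous_planeWaveDet a).measurable.comp measurable_fst).mul
      (Measurable.mul ?_ (Measurable.mul ?_ (hΦ.measurable_diagonal.comp measurable_snd)))
    · fun_prop
    · exact Complex.measurable_ofReal.comp
        ((continuous_vandermondeProd _).measurable.comp measurable_snd)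
  · by_cases hp : Interlaces p.1 p.2
    · rw [Set.indicator_of_mem (show p ∈ {p : (Fin n → ℝ) × _ | Interlaces p.1 p.2} from hp),
        norm_mul, norm_mul, norm_cexp_neg_I_mul, one_mul, mul_assoc]
      refine mul_le_mul (norm_planeWaveDet_le _ _) ((hb p.2).trans ?_) (norm_nonneg _)
        (by positivity)
      refine mul_le_mul_of_nonneg_left ?_ hC
      rw [← Real.exp_add, Real.exp_le_exp]
      have := hp.sum_sq_le
      nlinarith
    · rw [Set.indicator_of_notMem (show p ∉ {p : (Fin n → ℝ) × _ | Interlaces p.1 p.2} from hp),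
        norm_zero]
      positivity

theorem setIntegral_borderTransform (hΦ : IsGaussianClassFunction Φ) {x : Fin (n + 1) → ℝ}
    (hx : Function.Injective x) :
    ∫ y in {y | StrictMono y}, planeWaveDet (fun j : Fin n => x j.castSucc) y *
        (((vandermondeProd y : ℝ) : ℂ) * _root_.borderTransform (x (Fin.last n)) Φ
          (diagonal fun i => (y i : ℂ))) =
      Real.pi ^ n * Complex.I ^ n * (∏ j : Fin n, ((x (Fin.last n) : ℂ) - x j.castSucc))⁻¹ *
        ∫ k in {k | StrictMono k}, planeWaveDet x k *
          (((vandermondeProd k : ℝ) : ℂ) * Φ (diagonal fun i => (k i : ℂ))) := by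
  set s := x (Fin.last n) with hs
  set a : Fin n → ℝ := fun j => x j.castSucc - s with ha
  have hfi := hΦ.integrable_interlaces s a
  set F := fun p : (Fin n → ℝ) × (Fin (n + 1) → ℝ) =>
    planeWaveDet a p.1 * (Complex.exp (-Complex.I * s * (∑ j, p.2 j : ℝ)) *
        (((vandermondeProd p.2 : ℝ) : ℂ) * Φ (diagonal fun i => (p.2 i : ℂ)))) with hF
  have hwave : ∀ y, planeWaveDet a y =
      planeWaveDet (fun j : Fin n => x j.castSucc) y * Complex.exp (Complex.I * s * ∑ i, (y i : ℂ)) := by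
    intro y
    rw [Finset.mul_sum, Complex.exp_sum, mul_comm, planeWaveDet, planeWaveDet, ← det_mul_column]
    congr 1
    ext i j
    rw [of_apply, of_apply, of_apply, ← Complex.exp_add]
    congr 1
    simp only [ha]
    push_cast
    ring
  have hleft : ∀ y : Fin n → ℝ, {y : Fin n → ℝ | StrictMono y}.indicator (fun y =>
      planeWaveDet (fun j : Fin n => x j.castSucc) y * (((vandermondeProd y : ℝ) : ℂ) *
        _root_.borderTransform s Φ (diagonal fun i => (y i : ℂ)))) y =
      Real.pi ^ n * ∫ k, {p : (Fin n → ℝ) × (Fin (n + 1) → ℝ) | Interlaces p.1 p.2}.indicator F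
        (y, k) := by
    intro y
    by_cases hy : StrictMono y
    · rw [Set.indicator_of_mem (show y ∈ {y : Fin n → ℝ | StrictMono y} from hy),
        hΦ.borderTransform_diagonal s hy, ← mul_assoc, mul_left_comm, ← integral_const_mul]
      congr 1
      have hm : MeasurableSet {k | Interlaces y k} :=
        measurableSet_interlaces.preimage measurable_prodMk_left
      rw [← integral_indicator hm]
      refine integral_congr_ae (Filter.Eventually.of_forall fun k => ?_)
      by_cases hk : Interlaces y k
      · beta_reduce
        rw [Set.indicator_of_mem (show k ∈ {k | Interlaces y k} from hk), Set.indicator_of_mem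
          (show (y, k) ∈ {p : (Fin n → ℝ) × (Fin (n + 1) → ℝ) | Interlaces p.1 p.2} from hk), hF]
        simp only
        rw [hwave, mul_sub, sub_eq_add_neg, Complex.exp_add,
          show -(-Complex.I * (s : ℂ) * ∑ i, (y i : ℂ)) = Complex.I * s * ∑ i, (y i : ℂ) by ring]
        have hy0 : ((vandermondeProd y : ℝ) : ℂ) ≠ 0 := by
          exact_mod_cast (vandermondeProd_pos hy).ne'
        push_cast
        field_simp
      · beta_reduce
        rw [Set.indicator_of_notMem (show k ∉ {k | Interlaces y k} from hk),
          Set.indicator_of_notMem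
          (show (y, k) ∉ {p : (Fin n → ℝ) × (Fin (n + 1) → ℝ) | Interlaces p.1 p.2} from hk)]
    · rw [Set.indicator_of_notMem (show y ∉ {y : Fin n → ℝ | StrictMono y} from hy)]
      have h0 : ∀ k, {p : (Fin n → ℝ) × (Fin (n + 1) → ℝ) | Interlaces p.1 p.2}.indicator F
          (y, k) = 0 := fun k => Set.indicator_of_notMem (fun h => hy h.strictMono_left) _
      simp [h0]
  have hright : ∀ k : Fin (n + 1) → ℝ,
      ∫ y, {p : (Fin n → ℝ) × (Fin (n + 1) → ℝ) | Interlaces p.1 p.2}.indicator F (y, k) =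
      {k : Fin (n + 1) → ℝ | StrictMono k}.indicator (fun k =>
        Complex.I ^ n * (∏ j : Fin n, ((s : ℂ) - x j.castSucc))⁻¹ * (planeWaveDet x k *
          (((vandermondeProd k : ℝ) : ℂ) * Φ (diagonal fun i => (k i : ℂ))))) k := by
    intro k
    by_cases hk : StrictMono k
    · rw [Set.indicator_of_mem (show k ∈ {k : Fin (n + 1) → ℝ | StrictMono k} from hk)]
      have hm : MeasurableSet {y | Interlaces y k} :=
        measurableSet_interlaces.preimage measurable_prodMk_right
      have h := setIntegral_interlaces_det hx hk
      have h1 : ∀ y, {p : (Fin n → ℝ) × (Fin (n + 1) → ℝ) | Interlaces p.1 p.2}.indicator F (y, k)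
          = {y | Interlaces y k}.indicator (fun y => planeWaveDet a y *
            (Complex.exp (-Complex.I * s * (∑ j, k j : ℝ)) *
            (((vandermondeProd k : ℝ) : ℂ) * Φ (diagonal fun i => (k i : ℂ))))) y := fun y => rfl
      have h2 : ∀ y, planeWaveDet a y = det (of fun i j : Fin n =>
        Complex.exp (-Complex.I * (x j.castSucc - x (Fin.last n)) * y i)) := fun y => by
        simp only [planeWaveDet, ha, Complex.ofReal_sub, hs]
      simp only [h1]
      rw [integral_indicator hm, integral_mul_const]
      simp only [h2]
      rw [h, ← hs, ← planeWaveDet]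
      have h3 : Complex.exp (Complex.I * s * ∑ i, (k i : ℂ)) *
          Complex.exp (-Complex.I * s * (∑ j, k j : ℝ)) = 1 := by
        rw [← Complex.exp_add]
        simp
      linear_combination (Complex.I ^ n * (∏ j : Fin n, ((s : ℂ) - x j.castSucc))⁻¹ *
        (planeWaveDet x k * (((vandermondeProd k : ℝ) : ℂ) * Φ (diagonal fun i => (k i : ℂ))))) * h3
    · rw [Set.indicator_of_notMem (show k ∉ {k : Fin (n + 1) → ℝ | StrictMono k} from hk)]
      have h0 : ∀ y, {p : (Fin n → ℝ) × (Fin (n + 1) → ℝ) | Interlaces p.1 p.2}.indicator F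
          (y, k) = 0 := fun y => Set.indicator_of_notMem (fun h => hk h.strictMono) _
      simp [h0]
  rw [← integral_indicator (measurableSet_strictMono n),
    ← integral_indicator (measurableSet_strictMono (n + 1))]
  simp only [hleft]
  rw [integral_const_mul, integral_integral_swap (f := fun y k =>
    {p : (Fin n → ℝ) × (Fin (n + 1) → ℝ) | Interlaces p.1 p.2}.indicator F (y, k)) hfi]
  simp only [hright]
  rw [integral_indicator (measurableSet_strictMono (n + 1)), integral_const_mul,
    integral_indicator (measurableSet_strictMono (n + 1))]
  ring

end IsGaussianClassFunction

/-- The Fourier transform of a unitarily invariant function of Hermitian matrices. -/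
theorem exists_fourier_classFunction {n : ℕ} (μ : Measure (HermitianSpace n))
    [μ.IsAddHaarMeasure] : ∃ c : ℂ, ∀ Φ : Matrix (Fin n) (Fin n) ℂ → ℂ,
      IsGaussianClassFunction Φ → ∀ x : Fin n → ℝ, Function.Injective x →
      ((vandermondeProd x : ℝ) : ℂ) * ∫ K : HermitianSpace n,
          Complex.exp (-Complex.I * ∑ i, K.1 i i * (x i : ℂ)) * Φ K.1 ∂μ =
        c * ∫ k in {k | StrictMono k}, planeWaveDet x k *
          (((vandermondeProd k : ℝ) : ℂ) * Φ (diagonal fun i => (k i : ℂ))) := by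
  induction n with
  | zero =>
    have hsub : Subsingleton (HermitianSpace 0) :=
      ⟨fun a b => Subtype.ext (Subsingleton.elim _ _)⟩
    have hvol : (volume : Measure (Fin 0 → ℝ)) = Measure.dirac 0 := by
      rw [volume_pi, Measure.pi_of_empty]
      congr 1
      exact Subsingleton.elim _ _
    refine ⟨(μ.real Set.univ : ℂ), fun Φ _ x _ => ?_⟩
    have h1 : ∀ K : HermitianSpace 0,
        Complex.exp (-Complex.I * ∑ i, K.1 i i * (x i : ℂ)) * Φ K.1 = Φ 0 := fun K => by
      rw [Subsingleton.elim K.1 0]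
      simp
    have h2 : {k : Fin 0 → ℝ | StrictMono k} = Set.univ :=
      Set.eq_univ_of_forall fun k => Subsingleton.strictMono k
    simp only [h1, integral_const, h2, Measure.restrict_univ]
    rw [hvol, integral_dirac, Subsingleton.elim (diagonal _) (0 : Matrix (Fin 0) (Fin 0) ℂ)]
    simp [planeWaveDet, vandermondeProd]
  | succ n ih =>
    obtain ⟨c, hc⟩ := ih Measure.addHaar
    obtain ⟨c', rfl⟩ := HermitianSpace.exists_eq_smul_map_borderedEquiv Measure.addHaar μ
    refine ⟨c' * c * (Real.pi ^ n * Complex.I ^ n), fun Φ hΦ x hx => ?_⟩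
    have h := hc _ (hΦ.borderTransform (x (Fin.last n))) (fun j => x j.castSucc)
      (hx.comp (Fin.castSucc_injective n))
    rw [hΦ.setIntegral_borderTransform hx] at h
    rw [integral_smul_nnreal_measure, hΦ.integral_hermitianSpace_succ Measure.addHaar x,
      NNReal.smul_def, Complex.real_smul, vandermondeProd_succ]
    have h3 : ∏ j : Fin n, ((x (Fin.last n) : ℂ) - x j.castSucc) ≠ 0 :=
      Finset.prod_ne_zero_iff.2 fun j _ => sub_ne_zero.2 fun h =>
        (Fin.castSucc_lt_last j).ne' (hx (by exact_mod_cast h))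
    push_cast
    linear_combination (∏ j : Fin n, ((x (Fin.last n) : ℂ) - x j.castSucc)) * c' * h + c' * c *
      (Real.pi ^ n * Complex.I ^ n) * (∫ k in {k | StrictMono k}, planeWaveDet x k *
          (((vandermondeProd k : ℝ) : ℂ) * Φ (diagonal fun i => (k i : ℂ)))) * mul_inv_cancel₀ h3

theorem existsUnique_perm_strictMono {n : ℕ} {k : Fin n → ℝ} (hk : Function.Injective k) :
    ∃! σ : Equiv.Perm (Fin n), StrictMono (k ∘ σ) := by
  refine ⟨Tuple.sort k, (Tuple.monotone_sort k).strictMono_of_injective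
    (hk.comp (Tuple.sort k).injective), fun τ hτ => ?_⟩
  have h := Tuple.unique_monotone hτ.monotone (Tuple.monotone_sort k)
  exact Equiv.ext fun i => hk (congrFun h i)

theorem ae_injective_pi (n : ℕ) : ∀ᵐ k : Fin n → ℝ, Function.Injective k := by
  have h : ∀ i j : Fin n, ∀ᵐ k : Fin n → ℝ, k i = k j → i = j := fun i j => by
    by_cases hij : i = j
    · simp [hij]
    · have h0 := Measure.addHaar_submodule (volume : Measure (Fin n → ℝ))
        (LinearMap.ker (LinearMap.proj (R := ℝ) (φ := fun _ : Fin n => ℝ) i - LinearMap.proj j))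
        fun h => by
          have : (Pi.single i 1 : Fin n → ℝ) ∈ (⊤ : Submodule ℝ (Fin n → ℝ)) := trivial
          rw [← h] at this
          simp [Ne.symm hij] at this
      rw [ae_iff]
      convert h0 using 2
      ext k
      simp [hij, sub_eq_zero]
  filter_upwards [ae_all_iff.2 fun i => ae_all_iff.2 fun j => h i j] with k hk i j hij
  exact hk i j hij

theorem measurePreserving_comp_perm {n : ℕ} (σ : Equiv.Perm (Fin n)) :
    MeasurePreserving (fun k : Fin n → ℝ => k ∘ σ) :=
  volume_preserving_arrowCongr' σ.symm (MeasurableEquiv.refl ℝ) (MeasurePreserving.id _)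

theorem integral_eq_setIntegral_strictMono_sum_perm {n : ℕ} {h : (Fin n → ℝ) → ℂ}
    (hh : Integrable h) :
    ∫ k, h k = ∫ k in {k | StrictMono k}, ∑ σ : Equiv.Perm (Fin n), h (k ∘ σ) := by
  have hcomp : ∀ σ : Equiv.Perm (Fin n), Integrable fun k => h (k ∘ σ) := fun σ =>
    (measurePreserving_comp_perm σ).integrable_comp_of_integrable hh
  rw [integral_finsetSum _ fun σ _ => (hcomp σ).integrableOn]
  have hσ : ∀ σ : Equiv.Perm (Fin n), ∫ k in {k | StrictMono k}, h (k ∘ σ) =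
      ∫ k, {k | StrictMono (k ∘ σ.symm)}.indicator h k := fun σ => by
    have hemb : MeasurableEmbedding fun k : Fin n → ℝ => k ∘ σ :=
      (MeasurableEquiv.arrowCongr' σ.symm (MeasurableEquiv.refl ℝ)).measurableEmbedding
    rw [← (measurePreserving_comp_perm σ).integral_comp hemb,
      ← integral_indicator (measurableSet_strictMono n)]
    refine integral_congr_ae (Filter.Eventually.of_forall fun k => ?_)
    have : (k ∘ σ) ∘ σ.symm = k := by ext i; simp
    simp only [Set.indicator, Set.mem_ofPred_eq, this]
  simp only [hσ]
  rw [← integral_finsetSum]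
  · refine integral_congr_ae ?_
    filter_upwards [ae_injective_pi n] with k hk
    obtain ⟨τ, hτ, huniq⟩ := existsUnique_perm_strictMono hk
    rw [Finset.sum_eq_single τ.symm]
    · rw [Set.indicator_of_mem]
      exact hτ
    · intro σ _ hσ
      refine Set.indicator_of_notMem (fun hmem => hσ ?_) _
      rw [← huniq _ hmem, Equiv.symm_symm]
    · simp
  · intro σ _
    exact hh.indicator ((measurableSet_strictMono n).preimage
      (measurePreserving_comp_perm σ.symm).measurable)

/-- The Andréief identity over the chamber of increasing tuples. -/
theorem setIntegral_strictMono_det_mul_det {n : ℕ} {φ ψ : Fin n → ℝ → ℂ}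
    (h : ∀ i j, Integrable fun z => ψ i z * φ j z) :
    ∫ k in {k : Fin n → ℝ | StrictMono k},
        det (of fun i j => φ j (k i)) * det (of fun i j => ψ j (k i)) =
      det (of fun i j => ∫ z, ψ i z * φ j z) := by
  rw [← integral_pi_det h, ← volume_pi, integral_eq_setIntegral_strictMono_sum_perm]
  · refine setIntegral_congr_fun (measurableSet_strictMono n) fun k _ => ?_
    have h1 : ∀ σ : Equiv.Perm (Fin n),
        det (of fun i j => ψ i ((k ∘ σ) i) * φ j ((k ∘ σ) i)) =
          det (of fun i j => φ j (k i)) * (Equiv.Perm.sign σ * ∏ i, ψ i (k (σ i))) := fun σ => by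
      have := det_mul_column (fun i => ψ i (k (σ i))) (of fun i j => φ j (k (σ i)))
      simp only [of_apply] at this
      simp only [Function.comp_apply]
      rw [this, show (of fun i j => φ j (k (σ i))) = (of fun i j => φ j (k i)).submatrix σ id from rfl,
        det_permute]
      ring
    simp only [h1]
    rw [← Finset.mul_sum, det_apply' (of fun i j => ψ j (k i))]
    rfl
  · have h2 : ∀ A : Matrix (Fin n) (Fin n) ℂ, A.det =
        ∑ σ : Equiv.Perm (Fin n), (Equiv.Perm.sign σ : ℂ) * ∏ i, A i (σ i) := fun A => by
      rw [← det_transpose, det_apply']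
      rfl
    simp only [h2, of_apply]
    exact integrable_finsetSum _ fun σ _ =>
      (Integrable.fintype_prod_dep fun i => h i (σ i)).const_mul _

theorem setIntegral_strictMono_planeWaveDet {n : ℕ} {w : ℝ → ℂ}
    (hw : ∀ i : Fin n, Integrable fun z : ℝ => (z : ℂ) ^ (i : ℕ) * w z) (x : Fin n → ℝ) :
    ∫ k in {k : Fin n → ℝ | StrictMono k},
        planeWaveDet x k * (((vandermondeProd k : ℝ) : ℂ) * ∏ i, w (k i)) =
      det (of fun i j : Fin n =>
        ∫ z : ℝ, (z : ℂ) ^ (i : ℕ) * w z * Complex.exp (-Complex.I * x j * z)) := by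
  rw [← setIntegral_strictMono_det_mul_det]
  · refine setIntegral_congr_fun (measurableSet_strictMono n) fun k _ => ?_
    congr 1
    have h1 : ((vandermondeProd k : ℝ) : ℂ) = det (vandermonde fun i => (k i : ℂ)) := by
      rw [det_vandermonde, vandermondeProd]
      push_cast
      rfl
    have h2 := det_mul_column (fun i => w (k i)) (vandermonde fun i => (k i : ℂ))
    rw [h1, mul_comm, ← h2]
    congr 1
    ext i j
    simp [vandermonde_apply, mul_comm]
  · intro i j
    refine (hw i).mul_bdd (c := 1) ?_ ?_
    · exact Continuous.aestronglyMeasurable (by fun_prop)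
    · exact Filter.Eventually.of_forall fun z => (norm_cexp_neg_I_mul (x j) z).le

theorem trace_mul_star_self_eq_entrySq {n : ℕ} (K : Matrix (Fin n) (Fin n) ℂ) :
    trace (K * star K) = (entrySq K : ℂ) := by
  simp only [trace, diag_apply, mul_apply, star_apply, entrySq]
  push_cast
  exact Finset.sum_congr rfl fun i _ => Finset.sum_congr rfl fun j _ => Complex.mul_conj' _

theorem entrySq_unitary_conj {n : ℕ} {U : Matrix (Fin n) (Fin n) ℂ}
    (hU : U ∈ unitaryGroup (Fin n) ℂ) (K : Matrix (Fin n) (Fin n) ℂ) :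
    entrySq (U * K * star U) = entrySq K := by
  have h : (entrySq (U * K * star U) : ℂ) = entrySq K := by
    rw [← trace_mul_star_self_eq_entrySq, ← trace_mul_star_self_eq_entrySq,
      show U * K * star U * star (U * K * star U) = U * (K * (star U * U) * star K * star U) by
        simp only [star_mul, star_star, Matrix.mul_assoc],
      mem_unitaryGroup_iff'.1 hU, trace_mul_comm]
    rw [Matrix.mul_assoc, mem_unitaryGroup_iff'.1 hU, Matrix.mul_one, Matrix.mul_one]
  exact_mod_cast h

theorem exists_unitary_eq_conj_diagonal {n : ℕ} {K : Matrix (Fin n) (Fin n) ℂ}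
    (hK : K.IsHermitian) : ∃ U ∈ unitaryGroup (Fin n) ℂ,
      K = U * diagonal (fun i => (hK.eigenvalues i : ℂ)) * star U :=
  ⟨hK.eigenvectorUnitary, hK.eigenvectorUnitary.2, by
    conv_lhs => rw [hK.spectral_theorem]
    rfl⟩

/-- The unnormalized density of the matrix Cauchy distribution. -/
noncomputable def cauchyWeight (γ α : ℝ) (M : ℕ) (K : Matrix (Fin M) (Fin M) ℂ) : ℂ :=
  (det (((γ : ℂ) ^ 2) • (1 : Matrix (Fin M) (Fin M) ℂ) +
    (K - ((γ : ℂ) * (α : ℂ)) • 1) ^ 2) ^ M)⁻¹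

/-- The one-dimensional weight `(γ² + (z - γα)²)^{-M}`. -/
noncomputable def cauchyWeightReal (γ α : ℝ) (M : ℕ) (z : ℝ) : ℝ :=
  ((γ ^ 2 + (z - γ * α) ^ 2) ^ M)⁻¹

section

variable (γ α : ℝ) {M : ℕ}

theorem measurable_cauchyWeight : Measurable (cauchyWeight γ α M) := by
  unfold cauchyWeight
  refine (Continuous.measurable ?_).inv
  fun_prop

theorem continuous_cauchyWeightReal (hγ : 0 < γ) : Continuous (cauchyWeightReal γ α M) := by
  unfold cauchyWeightReal
  exact Continuous.inv₀ (by fun_prop) fun z => by positivity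

theorem cauchyWeight_unitary_conj {U : Matrix (Fin M) (Fin M) ℂ}
    (hU : U ∈ unitaryGroup (Fin M) ℂ) (K : Matrix (Fin M) (Fin M) ℂ) :
    cauchyWeight γ α M (U * K * star U) = cauchyWeight γ α M K := by
  have h1 := mem_unitaryGroup_iff.1 hU
  have h2 := mem_unitaryGroup_iff'.1 hU
  have h3 : U * K * star U - ((γ : ℂ) * α) • 1 = U * (K - ((γ : ℂ) * α) • 1) * star U := by
    simp [mul_sub, sub_mul, h1]
  have h4 : ∀ A : Matrix (Fin M) (Fin M) ℂ, (U * A * star U) ^ 2 = U * A ^ 2 * star U := fun A => by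
    rw [sq, sq, show U * A * star U * (U * A * star U) = U * (A * (star U * U) * A) * star U by
      simp only [Matrix.mul_assoc], h2, Matrix.mul_one]
  have h5 : ∀ A : Matrix (Fin M) (Fin M) ℂ, ((γ : ℂ) ^ 2) • 1 + U * A * star U =
      U * (((γ : ℂ) ^ 2) • 1 + A) * star U := fun A => by
    simp [mul_add, add_mul, h1]
  have h6 : U.det * (star U).det = 1 := by rw [← det_mul, h1, det_one]
  rw [cauchyWeight, cauchyWeight, h3, h4, h5, det_mul, det_mul, mul_right_comm, h6, one_mul]

theorem cauchyWeight_diagonal (k : Fin M → ℝ) :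
    cauchyWeight γ α M (diagonal fun i => (k i : ℂ)) =
      ∏ i, (cauchyWeightReal γ α M (k i) : ℂ) := by
  have : ((γ : ℂ) ^ 2) • (1 : Matrix (Fin M) (Fin M) ℂ) +
      ((diagonal fun i => (k i : ℂ)) - ((γ : ℂ) * (α : ℂ)) • 1) ^ 2 =
      diagonal fun i => (γ : ℂ) ^ 2 + (k i - (γ : ℂ) * α) ^ 2 := by
    rw [← diagonal_one, ← diagonal_smul, ← diagonal_smul, diagonal_sub, diagonal_pow,
      diagonal_add]
    congr 1
    ext i
    simp
  rw [cauchyWeight, this, det_diagonal, ← Finset.prod_pow, ← Finset.prod_inv_distrib]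
  simp [cauchyWeightReal]

variable {γ α}

theorem cauchyWeightReal_nonneg (z : ℝ) : 0 ≤ cauchyWeightReal γ α M z := by
  unfold cauchyWeightReal
  positivity

theorem norm_cauchyWeight_le (hγ : 0 < γ) {K : Matrix (Fin M) (Fin M) ℂ} (hK : K.IsHermitian) :
    ‖cauchyWeight γ α M K‖ ≤ (((γ ^ 2) ^ M)⁻¹) ^ M := by
  obtain ⟨U, hU, h⟩ := exists_unitary_eq_conj_diagonal hK
  rw [h, cauchyWeight_unitary_conj γ α hU, cauchyWeight_diagonal, norm_prod]
  refine (Finset.prod_le_prod (fun _ _ => norm_nonneg _) (g := fun _ => ((γ ^ 2) ^ M)⁻¹)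
    fun i _ => ?_).trans_eq (by simp)
  rw [Complex.norm_real, Real.norm_of_nonneg (cauchyWeightReal_nonneg _)]
  unfold cauchyWeightReal
  have := sq_nonneg (hK.eigenvalues i - γ * α)
  gcongr
  linarith

theorem isGaussianClassFunction_cauchyWeight (hγ : 0 < γ) (α : ℝ) {ε : ℝ} (hε : 0 < ε) :
    IsGaussianClassFunction fun K : Matrix (Fin M) (Fin M) ℂ =>
      cauchyWeight γ α M K * (Real.exp (-ε * entrySq K) : ℂ) where
  measurable := by
    refine (measurable_cauchyWeight γ α).mul (Continuous.measurable ?_)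
    unfold entrySq
    fun_prop
  conj {K U} hK hU := by rw [cauchyWeight_unitary_conj γ α hU, entrySq_unitary_conj hU]
  bound := by
    refine ⟨(((γ ^ 2) ^ M)⁻¹) ^ M, ε, hε, fun K hK => ?_⟩
    rw [norm_mul, Complex.norm_real, Real.norm_of_nonneg (Real.exp_pos _).le]
    exact mul_le_mul_of_nonneg_right (norm_cauchyWeight_le hγ hK) (Real.exp_pos _).le

theorem exists_abs_pow_mul_cauchyWeightReal_le (hγ : 0 < γ) (α : ℝ) (M : ℕ) :
    ∃ C : ℝ, ∀ i < M, ∀ z : ℝ, |z| ^ i * cauchyWeightReal γ α M z ≤ C * (1 + z ^ 2)⁻¹ := by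
  set C := max 2 ((1 + 2 * (γ * α) ^ 2) / γ ^ 2) with hC
  have hC0 : 0 < C := by positivity
  have hq : ∀ z : ℝ, 1 + z ^ 2 ≤ C * (γ ^ 2 + (z - γ * α) ^ 2) := fun z => by
    have h1 : (1 + 2 * (γ * α) ^ 2) ≤ C * γ ^ 2 := by
      rw [← div_le_iff₀ (by positivity)]
      exact le_max_right _ _
    have h2 : 2 * (z - γ * α) ^ 2 ≤ C * (z - γ * α) ^ 2 :=
      mul_le_mul_of_nonneg_right (le_max_left _ _) (sq_nonneg _)
    nlinarith [sq_nonneg (z - 2 * (γ * α))]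
  refine ⟨C ^ M, fun i hi z => ?_⟩
  have hz : |z| ≤ 1 + z ^ 2 := by
    rw [← sq_abs]
    nlinarith [sq_nonneg (|z| - 1), abs_nonneg z]
  have h1 : 1 ≤ 1 + z ^ 2 := by nlinarith
  have h3 : |z| ^ i ≤ (1 + z ^ 2) ^ (M - 1) :=
    (pow_le_pow_left₀ (abs_nonneg z) hz i).trans (pow_le_pow_right₀ h1 (by omega))
  have hpos : 0 < γ ^ 2 + (z - γ * α) ^ 2 := by positivity
  have h4 : (1 + z ^ 2) ^ M ≤ C ^ M * (γ ^ 2 + (z - γ * α) ^ 2) ^ M := by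
    rw [← mul_pow]
    exact pow_le_pow_left₀ (by positivity) (hq z) M
  obtain ⟨m, rfl⟩ : ∃ m, M = m + 1 := ⟨M - 1, by omega⟩
  rw [cauchyWeightReal, ← div_eq_mul_inv, ← div_eq_mul_inv, div_le_div_iff₀ (by positivity)
    (by positivity)]
  refine (mul_le_mul_of_nonneg_right h3 (by positivity)).trans ?_
  rw [Nat.add_sub_cancel, ← pow_succ]
  exact h4

theorem integrable_pow_mul_cauchyWeightReal (hγ : 0 < γ) (α : ℝ) {i : ℕ} (hi : i < M) :
    Integrable fun z : ℝ => (z : ℂ) ^ i * (cauchyWeightReal γ α M z : ℂ) := by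
  obtain ⟨C, hC⟩ := exists_abs_pow_mul_cauchyWeightReal_le hγ α M
  have := continuous_cauchyWeightReal (M := M) γ α hγ
  refine (integrable_inv_one_add_sq.const_mul C).mono'
    (Continuous.aestronglyMeasurable (by fun_prop)) (Filter.Eventually.of_forall fun z => ?_)
  rw [norm_mul, norm_pow, Complex.norm_real, Complex.norm_real,
    Real.norm_of_nonneg (cauchyWeightReal_nonneg z)]
  exact hC i hi z

theorem tendsto_integral_pow_mul_cauchyWeightReal (hγ : 0 < γ) (α : ℝ) {i : ℕ} (hi : i < M)
    (y : ℝ) {ε : ℕ → ℝ} (hlim : Filter.Tendsto ε Filter.atTop (nhds 0)) (hε : ∀ m, 0 < ε m) :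
    Filter.Tendsto (fun m => ∫ z : ℝ, (z : ℂ) ^ i *
      ((cauchyWeightReal γ α M z : ℂ) * (Real.exp (-ε m * z ^ 2) : ℂ)) *
        Complex.exp (-Complex.I * y * z)) Filter.atTop
      (nhds (∫ z : ℝ, (z : ℂ) ^ i * (cauchyWeightReal γ α M z : ℂ) *
        Complex.exp (-Complex.I * y * z))) := by
  have hcont := continuous_cauchyWeightReal (M := M) γ α hγ
  refine tendsto_integral_of_dominated_convergence
    (fun z => ‖(z : ℂ) ^ i * (cauchyWeightReal γ α M z : ℂ)‖)
    (fun m => Continuous.aestronglyMeasurable (by fun_prop))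
    (integrable_pow_mul_cauchyWeightReal hγ α hi).norm
    (fun m => Filter.Eventually.of_forall fun z => ?_)
    (Filter.Eventually.of_forall fun z => ?_)
  · rw [norm_mul, norm_cexp_neg_I_mul, mul_one, ← mul_assoc, norm_mul _ (Complex.ofReal _)]
    refine mul_le_of_le_one_right (norm_nonneg _) ?_
    rw [Complex.norm_real, Real.norm_of_nonneg (Real.exp_pos _).le, Real.exp_le_one_iff]
    nlinarith [hε m, sq_nonneg z]
  · refine Filter.Tendsto.mul_const _ (Filter.Tendsto.const_mul _ ?_)
    have : Continuous fun e : ℝ =>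
      (cauchyWeightReal γ α M z : ℂ) * (Real.exp (-e * z ^ 2) : ℂ) := by fun_prop
    have h := (this.tendsto 0).comp hlim
    simpa [Function.comp_def] using h

/-- The Fourier transform of the matrix Cauchy density as a determinant of one-dimensional
transforms. -/
theorem exists_fourier_cauchyWeight (hγ : 0 < γ) (α : ℝ) (μ : Measure (HermitianSpace M))
    [μ.IsAddHaarMeasure]
    (hfi : Integrable (fun K : HermitianSpace M => cauchyWeight γ α M K.1) μ) :
    ∃ c : ℂ, ∀ x : Fin M → ℝ, Function.Injective x →
      ((vandermondeProd x : ℝ) : ℂ) * ∫ K : HermitianSpace M,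
          Complex.exp (-Complex.I * ∑ i, K.1 i i * (x i : ℂ)) * cauchyWeight γ α M K.1 ∂μ =
        c * det (of fun i j : Fin M => ∫ z : ℝ, (z : ℂ) ^ (i : ℕ) *
          (cauchyWeightReal γ α M z : ℂ) * Complex.exp (-Complex.I * x j * z)) := by
  obtain ⟨c, hc⟩ := exists_fourier_classFunction μ
  refine ⟨c, fun x hx => ?_⟩
  set ε : ℕ → ℝ := fun m => 1 / ((m : ℝ) + 1) with hεdef
  have hε : ∀ m, 0 < ε m := fun m => by positivity
  have hlim : Filter.Tendsto ε Filter.atTop (nhds 0) := tendsto_one_div_add_atTop_nhds_zero_nat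
  have hexp : ∀ t : ℝ, Filter.Tendsto (fun m => (Real.exp (-ε m * t) : ℂ)) Filter.atTop (nhds 1) := by
    intro t
    have : Continuous fun e : ℝ => (Real.exp (-e * t) : ℂ) := by fun_prop
    have h := (this.tendsto 0).comp hlim
    simpa [Function.comp_def] using h
  have hle : ∀ m (t : ℝ), 0 ≤ t → ‖(Real.exp (-ε m * t) : ℂ)‖ ≤ 1 := fun m t ht => by
    rw [Complex.norm_real, Real.norm_of_nonneg (Real.exp_pos _).le, Real.exp_le_one_iff]
    nlinarith [hε m]
  have key : ∀ m, ((vandermondeProd x : ℝ) : ℂ) * ∫ K : HermitianSpace M,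
      Complex.exp (-Complex.I * ∑ i, K.1 i i * (x i : ℂ)) *
        (cauchyWeight γ α M K.1 * (Real.exp (-ε m * entrySq K.1) : ℂ)) ∂μ =
      c * det (of fun i j : Fin M => ∫ z : ℝ, (z : ℂ) ^ (i : ℕ) *
        ((cauchyWeightReal γ α M z : ℂ) * (Real.exp (-ε m * z ^ 2) : ℂ)) *
          Complex.exp (-Complex.I * x j * z)) := fun m => by
    rw [hc _ (isGaussianClassFunction_cauchyWeight hγ α (hε m)) x hx,
      ← setIntegral_strictMono_planeWaveDet]
    · simp only [cauchyWeight_diagonal, entrySq_diagonal, Finset.prod_mul_distrib, Finset.mul_sum,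
        Real.exp_sum, Complex.ofReal_prod]
    · intro i
      simp only [← mul_assoc]
      refine (integrable_pow_mul_cauchyWeightReal hγ α i.2).mul_bdd (c := 1)
        (Continuous.aestronglyMeasurable (by fun_prop)) (Filter.Eventually.of_forall fun z => ?_)
      exact hle m _ (sq_nonneg z)
  have hL : Filter.Tendsto (fun m => ∫ K : HermitianSpace M,
      Complex.exp (-Complex.I * ∑ i, K.1 i i * (x i : ℂ)) *
        (cauchyWeight γ α M K.1 * (Real.exp (-ε m * entrySq K.1) : ℂ)) ∂μ) Filter.atTop
      (nhds (∫ K : HermitianSpace M, Complex.exp (-Complex.I * ∑ i, K.1 i i * (x i : ℂ)) *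
        cauchyWeight γ α M K.1 ∂μ)) := by
    refine tendsto_integral_of_dominated_convergence (fun K => ‖cauchyWeight γ α M K.1‖)
      (fun m => ?_) hfi.norm (fun m => Filter.Eventually.of_forall fun K => ?_)
      (Filter.Eventually.of_forall fun K => ?_)
    · refine Measurable.aestronglyMeasurable ?_
      exact (HermitianSpace.continuous_cexp_sum_diag x).measurable.mul
        ((isGaussianClassFunction_cauchyWeight hγ α (hε m)).measurable.comp measurable_subtype_coe)
    · rw [norm_mul, norm_cexp_neg_I_mul_sum_diag K.2, one_mul, norm_mul]
      exact mul_le_of_le_one_right (norm_nonneg _) (hle m _ (entrySq_nonneg _))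
    · simpa using ((hexp (entrySq K.1)).const_mul (cauchyWeight γ α M K.1)).const_mul
        (Complex.exp (-Complex.I * ∑ i, K.1 i i * (x i : ℂ)))
  refine tendsto_nhds_unique (hL.const_mul _) ?_
  simp only [key]
  exact ((continuous_id.matrix_det).tendsto _).comp
      (tendsto_pi_nhds.2 fun i => tendsto_pi_nhds.2 fun j =>
        tendsto_integral_pow_mul_cauchyWeightReal hγ α i.2 (x j) hlim hε) |>.const_mul c

end

/-- The Fourier transform of `x ^ i * exp (-γ|x|) * ∑ l ≤ m, (γ|x|) ^ l / l!` at `k`. -/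
noncomputable def laplaceSum (γ : ℝ) (m i : ℕ) (k : ℂ) : ℂ :=
  ∑ l ∈ Finset.range (m + 1), (γ : ℂ) ^ l / l.factorial * (i + l).factorial *
    (((γ + Complex.I * k) ^ (i + l + 1))⁻¹ + (-1) ^ i * ((γ - Complex.I * k) ^ (i + l + 1))⁻¹)

section

variable {γ : ℝ}

theorem ofReal_add_I_mul_ne_zero (hγ : 0 < γ) (k : ℝ) : (γ : ℂ) + Complex.I * k ≠ 0 := fun h => by
  have := congrArg Complex.re h
  simp at this
  exact hγ.ne' this

theorem ofReal_sub_I_mul_ne_zero (hγ : 0 < γ) (k : ℝ) : (γ : ℂ) - Complex.I * k ≠ 0 := fun h => by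
  have := congrArg Complex.re h
  simp at this
  exact hγ.ne' this

theorem hasDerivAt_laplaceSum (hγ : 0 < γ) (m i : ℕ) (k : ℝ) :
    HasDerivAt (laplaceSum γ m i) (-Complex.I * laplaceSum γ m (i + 1) k) (k : ℂ) := by
  have h1 := ofReal_add_I_mul_ne_zero hγ k
  have h2 := ofReal_sub_I_mul_ne_zero hγ k
  have hid : HasDerivAt (fun z : ℂ => Complex.I * z) Complex.I (k : ℂ) := by
    simpa using (hasDerivAt_id (k : ℂ)).const_mul Complex.I
  have hp := hid.const_add (γ : ℂ)
  have hm := hid.const_sub (γ : ℂ)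
  unfold laplaceSum
  rw [Finset.mul_sum]
  refine HasDerivAt.fun_sum fun l _ => ?_
  have h := (((hp.fun_pow (i + l + 1)).fun_inv (pow_ne_zero _ h1)).add
    (((hm.fun_pow (i + l + 1)).fun_inv (pow_ne_zero _ h2)).const_mul ((-1 : ℂ) ^ i))).const_mul
      ((γ : ℂ) ^ l / l.factorial * (i + l).factorial)
  refine h.congr_deriv ?_
  rw [show i + 1 + l = i + l + 1 by ring, Nat.factorial_succ]
  simp only [Nat.add_sub_cancel]
  push_cast
  field_simp
  ring

theorem exists_polynomial_laplaceSum_zero (hγ : 0 < γ) (m : ℕ) :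
    ∃ P : Polynomial ℂ, P.natDegree ≤ m ∧ ∀ k : ℝ,
      laplaceSum γ m 0 k = P.eval (k : ℂ) * (((γ : ℂ) ^ 2 + (k : ℂ) ^ 2) ^ (m + 1))⁻¹ := by
  open Polynomial in
  refine ⟨C (2 * (γ : ℂ) ^ (m + 1)) * ∑ a ∈ Finset.range (m + 1),
    (C (γ : ℂ) + C Complex.I * X) ^ a * (C (γ : ℂ) - C Complex.I * X) ^ (m - a), ?_, fun k => ?_⟩
  · refine (natDegree_C_mul_le _ _).trans (natDegree_sum_le_of_forall_le _ _ fun a ha => ?_)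
    have ha : a ≤ m := Nat.lt_succ_iff.1 (Finset.mem_range.1 ha)
    refine (natDegree_mul_le_of_le (natDegree_pow_le_of_le a (m := 1) (by compute_degree))
      (natDegree_pow_le_of_le (m - a) (m := 1) (by compute_degree))).trans ?_
    omega
  · have h1 := ofReal_add_I_mul_ne_zero hγ k
    have h2 := ofReal_sub_I_mul_ne_zero hγ k
    simp only [eval_mul, eval_C, eval_finsetSum, eval_pow, eval_add, eval_sub, eval_X]
    set s := (γ : ℂ) + Complex.I * k with hs
    set t := (γ : ℂ) - Complex.I * k with ht
    have hq : (γ : ℂ) ^ 2 + (k : ℂ) ^ 2 = s * t := by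
      rw [hs, ht]
      linear_combination (k : ℂ) ^ 2 * Complex.I_sq
    have hst : 2 * (γ : ℂ) = s + t := by rw [hs, ht]; ring
    rw [hq]
    induction m with
    | zero =>
      simp only [laplaceSum, zero_add, Finset.range_one, Finset.sum_singleton, ← hs, ← ht]
      simp
      field_simp
      linear_combination -hst
    | succ m ih =>
      rw [laplaceSum, Finset.sum_range_succ, ← laplaceSum, ih, ← hs, ← ht]
      have e1 := geom_sum₂_succ_eq s t (n := m + 1)
      have e2 := geom_sum₂_succ_eq t s (n := m + 1)
      have e3 := geom_sum₂_comm s t (m + 1)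
      have e4 := geom_sum₂_comm s t (m + 2)
      simp only [Nat.add_sub_cancel] at e1 e2 e3 e4
      set G := ∑ a ∈ Finset.range (m + 1), s ^ a * t ^ (m - a)
      set G' := ∑ a ∈ Finset.range (m + 1 + 1), s ^ a * t ^ (m + 1 - a)
      have e5 : (s + t) * G' = 2 * (s * t) * G + s ^ (m + 2) + t ^ (m + 2) := by
        have e6 : G' = t ^ (m + 1) + s * G := by
          rw [e3, ← e2]
          exact e4
        linear_combination s * e1 + t * e6
      have hfac : ((m + 1).factorial : ℂ) ≠ 0 := by exact_mod_cast Nat.factorial_ne_zero _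
      simp only [zero_add, pow_zero, one_mul, mul_pow]
      rw [show 2 * (γ : ℂ) ^ (m + 1 + 1) * G' = γ ^ (m + 1) * ((s + t) * G') by rw [← hst]; ring, e5]
      field_simp
      ring

theorem exists_polynomial_laplaceSum (hγ : 0 < γ) (m i : ℕ) :
    ∃ P : Polynomial ℂ, P.natDegree ≤ m + i ∧ ∀ k : ℝ,
      laplaceSum γ m i k = P.eval (k : ℂ) * (((γ : ℂ) ^ 2 + (k : ℂ) ^ 2) ^ (m + i + 1))⁻¹ := by
  induction i with
  | zero => exact exists_polynomial_laplaceSum_zero hγ m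
  | succ i ih =>
    obtain ⟨P, hP, h⟩ := ih
    open Polynomial in
    refine ⟨C Complex.I * (derivative P * (C ((γ : ℂ) ^ 2) + X ^ 2) -
      C ((m + i + 1 : ℕ) : ℂ) * (P * (C 2 * X))), ?_, fun k => ?_⟩
    · refine (natDegree_C_mul_le _ _).trans ((natDegree_sub_le_of_le (m := m + (i + 1))
      (n := m + (i + 1)) ?_ ?_).trans (max_self _).le)
      · rcases Nat.eq_zero_or_pos P.natDegree with h0 | h0
        · rw [derivative_of_natDegree_zero h0]
          simp
        · refine (natDegree_mul_le_of_le (natDegree_derivative_le P)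
            (n := 2) (by compute_degree)).trans ?_
          omega
      · refine (natDegree_C_mul_le _ _).trans ((natDegree_mul_le_of_le hP (n := 1)
          (by compute_degree)).trans ?_)
        omega
    · have hq : (γ : ℂ) ^ 2 + (k : ℂ) ^ 2 ≠ 0 := by
        have : (0 : ℝ) < γ ^ 2 + k ^ 2 := by positivity
        exact_mod_cast this.ne'
      have hd := (hasDerivAt_laplaceSum hγ m i k).comp_ofReal
      have hsq : HasDerivAt (fun z : ℂ => (γ : ℂ) ^ 2 + z ^ 2) (2 * k) (k : ℂ) := by
        simpa using (hasDerivAt_pow 2 (k : ℂ)).const_add ((γ : ℂ) ^ 2)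
      have hd' := ((P.hasDerivAt (k : ℂ)).fun_mul
        ((hsq.fun_pow (m + i + 1)).fun_inv (pow_ne_zero _ hq))).comp_ofReal
      have hu := hd.unique (hd'.congr_of_eventuallyEq (Filter.Eventually.of_forall fun z => h z))
      have hu' : laplaceSum γ m (i + 1) k = Complex.I * (-Complex.I * laplaceSum γ m (i + 1) k) := by
        linear_combination laplaceSum γ m (i + 1) k * Complex.I_sq
      rw [hu', hu]
      simp only [Polynomial.eval_mul, Polynomial.eval_C, Polynomial.eval_pow, Polynomial.eval_add,
        Polynomial.eval_sub, Polynomial.eval_X, Nat.add_sub_cancel]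
      rw [show m + (i + 1) + 1 = m + i + 1 + 1 by ring]
      field_simp
      ring
end

theorem norm_pow_mul_cexp_neg_mul (s : ℂ) (n : ℕ) {x : ℝ} (hx : 0 < x) :
    ‖(x : ℂ) ^ n * Complex.exp (-s * x)‖ = x ^ (n : ℝ) * Real.exp (-s.re * x) := by
  rw [norm_mul, norm_pow, Complex.norm_real, Real.norm_of_nonneg hx.le, Complex.norm_exp,
    Real.rpow_natCast]
  simp

theorem integrableOn_pow_mul_cexp_neg_mul {s : ℂ} (hs : 0 < s.re) (n : ℕ) :
    IntegrableOn (fun x : ℝ => (x : ℂ) ^ n * Complex.exp (-s * x)) (Set.Ioi 0) := by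
  have h := integrableOn_rpow_mul_exp_neg_mul_rpow (p := 1) (s := n) (b := s.re)
    (by linarith [n.cast_nonneg (α := ℝ)]) one_pos hs
  refine Integrable.mono' h (Continuous.aestronglyMeasurable (by fun_prop)) ?_
  filter_upwards [ae_restrict_mem measurableSet_Ioi] with x hx
  rw [norm_pow_mul_cexp_neg_mul s n hx, Real.rpow_one]

theorem integral_pow_mul_cexp_neg_mul {s : ℂ} (hs : 0 < s.re) (n : ℕ) :
    ∫ x : ℝ in Set.Ioi 0, (x : ℂ) ^ n * Complex.exp (-s * x) =
      n.factorial * (s ^ (n + 1))⁻¹ := by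
  have hs0 : s ≠ 0 := fun h => by simp [h] at hs
  induction n with
  | zero =>
    simp only [pow_zero, one_mul]
    rw [integral_exp_mul_complex_Ioi (a := -s) (by simpa using hs) 0]
    simp
  | succ n ih =>
    have hderiv : ∀ x ∈ Set.Ici (0 : ℝ), HasDerivAt
        (fun x : ℝ => (x : ℂ) ^ (n + 1) * Complex.exp (-s * x))
        ((n + 1) * ((x : ℂ) ^ n * Complex.exp (-s * x)) -
          s * ((x : ℂ) ^ (n + 1) * Complex.exp (-s * x))) x := fun x _ => by
      have h1 := (hasDerivAt_pow (n + 1) (x : ℂ)).fun_mul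
        (((hasDerivAt_id (x : ℂ)).const_mul (-s)).cexp)
      refine h1.comp_ofReal.congr_deriv ?_
      simp
      ring
    have hlim : Filter.Tendsto (fun x : ℝ => (x : ℂ) ^ (n + 1) * Complex.exp (-s * x))
        Filter.atTop (nhds 0) := by
      rw [tendsto_zero_iff_norm_tendsto_zero]
      refine (tendsto_rpow_mul_exp_neg_mul_atTop_nhds_zero ((n + 1 : ℕ) : ℝ) s.re hs).congr' ?_
      filter_upwards [Filter.eventually_gt_atTop 0] with x hx
      rw [norm_pow_mul_cexp_neg_mul s _ hx]
    have i1 := (integrableOn_pow_mul_cexp_neg_mul hs n).const_mul ((n : ℂ) + 1)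
    have i2 := (integrableOn_pow_mul_cexp_neg_mul hs (n + 1)).const_mul s
    have h := integral_Ioi_of_hasDerivAt_of_tendsto' hderiv (i1.sub i2) hlim
    rw [integral_sub i1 i2, integral_const_mul, integral_const_mul, ih] at h
    simp only [Complex.ofReal_zero, ne_eq, Nat.add_eq_zero_iff, one_ne_zero, and_false,
      not_false_eq_true, zero_pow, zero_mul, sub_zero] at h
    rw [Nat.factorial_succ]
    push_cast
    apply mul_left_cancel₀ hs0
    rw [pow_succ s (n + 1)]
    field_simp
    field_simp at h
    linear_combination -h

section

variable {γ : ℝ} {M i : ℕ}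

theorem continuous_gMn (γ : ℝ) (M n : ℕ) : Continuous (gMn γ M n) := by
  unfold gMn
  fun_prop

theorem gMn_mul_cexp (hγ : 0 < γ) (k : ℝ) {x : ℝ} (hx : 0 < x) :
    (gMn γ M (i + 1) x : ℂ) * Complex.exp (-Complex.I * k * x) =
      ∑ l ∈ Finset.range (M - (i + 1) + 1), (γ : ℂ) ^ l / l.factorial *
        ((x : ℂ) ^ (i + l) * Complex.exp (-(γ + Complex.I * k) * x)) := by
  have h1 : Complex.exp (-(γ + Complex.I * k) * x) =
      Complex.exp (-γ * x) * Complex.exp (-Complex.I * k * x) := by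
    rw [← Complex.exp_add]
    congr 1
    ring
  rw [gMn, abs_of_pos hx, abs_of_pos (mul_pos hγ hx), h1]
  push_cast
  rw [Finset.mul_sum, Finset.sum_mul]
  refine Finset.sum_congr rfl fun l _ => ?_
  ring

theorem gMn_neg (x : ℝ) : gMn γ M (i + 1) (-x) = (-1) ^ i * gMn γ M (i + 1) x := by
  rw [gMn, gMn, abs_neg, mul_neg, abs_neg, Nat.add_sub_cancel, neg_pow x]
  ring

theorem integrableOn_gMn_mul_cexp (hγ : 0 < γ) (k : ℝ) :
    IntegrableOn (fun x : ℝ => (gMn γ M (i + 1) x : ℂ) * Complex.exp (-Complex.I * k * x))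
      (Set.Ioi 0) := by
  refine (integrable_finsetSum (Finset.range (M - (i + 1) + 1)) fun l _ =>
    (integrableOn_pow_mul_cexp_neg_mul (s := γ + Complex.I * k) (by simpa using hγ)
      (i + l)).const_mul ((γ : ℂ) ^ l / l.factorial)).congr ?_
  filter_upwards [ae_restrict_mem measurableSet_Ioi] with x hx
  rw [gMn_mul_cexp hγ k hx]

theorem integral_Ioi_gMn_mul_cexp (hγ : 0 < γ) (k : ℝ) :
    ∫ x : ℝ in Set.Ioi 0, (gMn γ M (i + 1) x : ℂ) * Complex.exp (-Complex.I * k * x) =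
      ∑ l ∈ Finset.range (M - (i + 1) + 1), (γ : ℂ) ^ l / l.factorial * (i + l).factorial *
        ((γ + Complex.I * k) ^ (i + l + 1))⁻¹ := by
  have hre : 0 < ((γ : ℂ) + Complex.I * k).re := by simpa using hγ
  rw [setIntegral_congr_fun measurableSet_Ioi fun x hx => gMn_mul_cexp hγ k hx,
    integral_finsetSum _ fun l _ => (integrableOn_pow_mul_cexp_neg_mul hre _).const_mul _]
  refine Finset.sum_congr rfl fun l _ => ?_
  rw [integral_const_mul, integral_pow_mul_cexp_neg_mul hre, mul_assoc]

theorem gMn_neg_mul_cexp (k x : ℝ) :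
    (gMn γ M (i + 1) (-x) : ℂ) * Complex.exp (-Complex.I * k * (-x : ℝ)) =
      (-1) ^ i * ((gMn γ M (i + 1) x : ℂ) * Complex.exp (-Complex.I * (-k : ℝ) * x)) := by
  rw [gMn_neg]
  push_cast
  rw [show -Complex.I * k * -(x : ℂ) = -Complex.I * -k * x by ring]
  ring

theorem integrableOn_Iic_gMn_mul_cexp (hγ : 0 < γ) (k : ℝ) :
    IntegrableOn (fun x : ℝ => (gMn γ M (i + 1) x : ℂ) * Complex.exp (-Complex.I * k * x))
      (Set.Iic 0) := by
  have h : IntegrableOn (fun x : ℝ =>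
      (gMn γ M (i + 1) (-x) : ℂ) * Complex.exp (-Complex.I * k * (-x : ℝ))) (Set.Ici (-0)) := by
    rw [neg_zero, integrableOn_Ici_iff_integrableOn_Ioi]
    simp only [gMn_neg_mul_cexp]
    exact (integrableOn_gMn_mul_cexp hγ (-k)).const_mul _
  simpa using h.comp_neg_Iic

theorem integral_gMn_mul_cexp (hγ : 0 < γ) (k : ℝ) :
    ∫ x : ℝ, (gMn γ M (i + 1) x : ℂ) * Complex.exp (-Complex.I * k * x) =
      laplaceSum γ (M - (i + 1)) i k := by
  rw [← intervalIntegral.integral_Iic_add_Ioi (integrableOn_Iic_gMn_mul_cexp hγ k)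
    (integrableOn_gMn_mul_cexp hγ k), integral_Ioi_gMn_mul_cexp hγ]
  have h := integral_comp_neg_Ioi 0 fun x : ℝ =>
    (gMn γ M (i + 1) x : ℂ) * Complex.exp (-Complex.I * k * x)
  simp only [gMn_neg_mul_cexp, neg_zero] at h
  rw [← h, integral_const_mul, integral_Ioi_gMn_mul_cexp hγ, laplaceSum, Finset.mul_sum,
    ← Finset.sum_add_distrib]
  refine Finset.sum_congr rfl fun l _ => ?_
  push_cast
  rw [mul_neg, ← sub_eq_add_neg]
  ring

theorem integrable_gMn (hγ : 0 < γ) :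
    Integrable fun x : ℝ => (gMn γ M (i + 1) x : ℂ) := by
  have h1 := integrableOn_Iic_gMn_mul_cexp (M := M) (i := i) hγ 0
  have h2 := integrableOn_gMn_mul_cexp (M := M) (i := i) hγ 0
  have h := h1.union h2
  rw [Set.Iic_union_Ioi, integrableOn_univ] at h
  simpa using h

open FourierTransform in
theorem fourier_gMn (hγ : 0 < γ) (w : ℝ) :
    𝓕 (fun x : ℝ => (gMn γ M (i + 1) x : ℂ)) w =
      laplaceSum γ (M - (i + 1)) i (2 * Real.pi * w : ℝ) := by
  rw [Real.fourier_real_eq_integral_exp_smul, ← integral_gMn_mul_cexp hγ]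
  refine integral_congr_ae (Filter.Eventually.of_forall fun x => ?_)
  beta_reduce
  rw [smul_eq_mul, mul_comm]
  congr 2
  push_cast
  ring

open FourierTransform in
/-- Fourier inversion for `gMn`. -/
theorem exists_polynomial_gMn (hγ : 0 < γ) (hi : i < M) :
    ∃ P : Polynomial ℂ, P.natDegree < M ∧ ∀ x : ℝ, (gMn γ M (i + 1) x : ℂ) =
      ∫ k : ℝ, P.eval (k : ℂ) * (cauchyWeightReal γ 0 M k : ℂ) *
        Complex.exp (-Complex.I * x * k) := by
  obtain ⟨Q, hQ, h⟩ := exists_polynomial_laplaceSum hγ (M - (i + 1)) i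
  have hM : M - (i + 1) + i + 1 = M := by omega
  rw [hM] at h
  have hw : ∀ k : ℝ, (((γ : ℂ) ^ 2 + (k : ℂ) ^ 2) ^ M)⁻¹ = (cauchyWeightReal γ 0 M k : ℂ) :=
    fun k => by simp [cauchyWeightReal]
  simp only [hw] at h
  have hfi : ∀ P : Polynomial ℂ, P.natDegree < M →
      Integrable fun k : ℝ => P.eval (k : ℂ) * (cauchyWeightReal γ 0 M k : ℂ) := fun P hP => by
    simp only [Polynomial.eval_eq_sum_range' hP, Finset.sum_mul, mul_assoc]
    exact integrable_finsetSum _ fun l hl =>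
      (integrable_pow_mul_cauchyWeightReal hγ 0 (Finset.mem_range.1 hl)).const_mul _
  have hQM : Q.natDegree < M := by omega
  have hfour : Integrable (𝓕 (fun x : ℝ => (gMn γ M (i + 1) x : ℂ))) := by
    have := (hfi Q hQM).comp_mul_left' (R := 2 * Real.pi) (by positivity)
    refine this.congr (Filter.Eventually.of_forall fun w => ?_)
    beta_reduce
    rw [fourier_gMn hγ, h]
  have hinv := (Complex.continuous_ofReal.comp (continuous_gMn γ M (i + 1))).fourierInv_fourier_eq
    (integrable_gMn hγ) hfour
  refine ⟨Polynomial.C (1 / (2 * Real.pi) : ℂ) * Q.comp (-Polynomial.X), ?_, fun x => ?_⟩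
  · refine (Polynomial.natDegree_C_mul_le _ _).trans_lt ?_
    rw [Polynomial.natDegree_comp, Polynomial.natDegree_neg, Polynomial.natDegree_X, mul_one]
    exact hQM
  · have hx := congrFun hinv x
    change _ = (gMn γ M (i + 1) x : ℂ) at hx
    rw [← hx, Real.fourierInv_eq']
    have e1 : ∀ w : ℝ, Complex.exp (((2 * Real.pi * inner ℝ w x : ℝ) : ℂ) * Complex.I) •
        𝓕 (fun x : ℝ => (gMn γ M (i + 1) x : ℂ)) w =
        (fun k : ℝ => Complex.exp (Complex.I * x * k) *
          (Q.eval (k : ℂ) * (cauchyWeightReal γ 0 M k : ℂ))) (2 * Real.pi * w) := fun w => by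
      rw [fourier_gMn hγ, h, smul_eq_mul]
      congr 2
      simp
      ring
    refine (integral_congr_ae (Filter.Eventually.of_forall e1)).trans ?_
    refine (Measure.integral_comp_mul_left (fun k : ℝ => Complex.exp (Complex.I * x * k) *
      (Q.eval (k : ℂ) * (cauchyWeightReal γ 0 M k : ℂ))) (2 * Real.pi)).trans ?_
    rw [← integral_neg_eq_self, ← integral_smul]
    refine integral_congr_ae (Filter.Eventually.of_forall fun k => ?_)
    have hwn : cauchyWeightReal γ 0 M (-k) = cauchyWeightReal γ 0 M k := by
      simp [cauchyWeightReal]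
    beta_reduce
    rw [hwn, abs_of_pos (by positivity), Complex.real_smul]
    simp
    ring

/-- `gMn`, modulated by `γα`, is a combination of the transforms of `z ^ l * w(z)`. -/
theorem exists_gMn_eq_sum (hγ : 0 < γ) (α : ℝ) (hi : i < M) :
    ∃ A : Fin M → ℂ, ∀ x : ℝ,
      Complex.exp (-Complex.I * γ * α * x) * (gMn γ M (i + 1) x : ℂ) =
      ∑ l : Fin M, A l * ∫ z : ℝ, (z : ℂ) ^ (l : ℕ) * (cauchyWeightReal γ α M z : ℂ) *
        Complex.exp (-Complex.I * x * z) := by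
  obtain ⟨P, hP, h⟩ := exists_polynomial_gMn hγ hi
  set Q := P.comp (Polynomial.X - Polynomial.C ((γ : ℂ) * α)) with hQ
  have hQM : Q.natDegree < M := by
    rw [hQ, Polynomial.natDegree_comp, Polynomial.natDegree_X_sub_C, mul_one]
    exact hP
  refine ⟨fun l => Q.coeff l, fun x => ?_⟩
  have hfi : ∀ l : Fin M, Integrable fun z : ℝ => Q.coeff l * ((z : ℂ) ^ (l : ℕ) *
      (cauchyWeightReal γ α M z : ℂ) * Complex.exp (-Complex.I * x * z)) := fun l =>
    ((integrable_pow_mul_cauchyWeightReal hγ α l.2).mul_bdd (c := 1)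
      (Continuous.aestronglyMeasurable (by fun_prop))
      (Filter.Eventually.of_forall fun z => (norm_cexp_neg_I_mul x z).le)).const_mul _
  simp only [← integral_const_mul]
  rw [h, ← integral_finsetSum _ fun l _ => hfi l, ← integral_const_mul,
    ← integral_sub_right_eq_self _ (γ * α)]
  refine integral_congr_ae (Filter.Eventually.of_forall fun z => ?_)
  have hw : cauchyWeightReal γ 0 M (z - γ * α) = cauchyWeightReal γ α M z := by
    simp [cauchyWeightReal]
  have hev : P.eval ((z - γ * α : ℝ) : ℂ) = ∑ l : Fin M, Q.coeff l * (z : ℂ) ^ (l : ℕ) := by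
    rw [Fin.sum_univ_eq_sum_range fun l => Q.coeff l * (z : ℂ) ^ l,
      ← Polynomial.eval_eq_sum_range' hQM, hQ, Polynomial.eval_comp]
    simp
  have he : Complex.exp (-Complex.I * γ * α * x) *
      Complex.exp (-Complex.I * x * (z - γ * α : ℝ)) = Complex.exp (-Complex.I * x * z) := by
    rw [← Complex.exp_add]
    congr 1
    push_cast
    ring
  beta_reduce
  rw [hw, hev, mul_left_comm, he, Finset.sum_mul, Finset.sum_mul]
  exact Finset.sum_congr rfl fun l _ => by ring

end

section

variable {γ : ℝ} {M : ℕ}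

theorem gMn_eq_sum_of_pos (hγ : 0 < γ) (i : Fin M) {x : ℝ} (hx : 0 < x) :
    gMn γ M (i + 1) x = Real.exp (-γ * x) * ∑ k : Fin M,
      (if i ≤ k then γ ^ ((k : ℕ) - i) / ((k : ℕ) - i).factorial else 0) * x ^ (k : ℕ) := by
  obtain ⟨m, hm⟩ := Nat.exists_eq_add_of_lt i.2
  have hsum := Fin.sum_univ_eq_sum_range (fun k : ℕ =>
    (if (i : ℕ) ≤ k then γ ^ (k - (i : ℕ)) / (k - (i : ℕ)).factorial else 0) * x ^ k) M
  have hr : M - ((i : ℕ) + 1) + 1 = m + 1 := by omega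
  have hM : Finset.range M = Finset.range (i + (m + 1)) :=
    congrArg Finset.range (by omega)
  have hlow : ∀ k ∈ Finset.range (i : ℕ),
      (if (i : ℕ) ≤ k then γ ^ (k - (i : ℕ)) / (k - (i : ℕ)).factorial else 0) * x ^ k = 0 :=
    fun k hk => by rw [if_neg (not_le.2 (Finset.mem_range.1 hk)), zero_mul]
  simp only [← Fin.val_fin_le] at hsum ⊢
  rw [hsum, gMn, abs_of_pos hx, abs_of_pos (mul_pos hγ hx), hr, congrArg (Finset.sum · _) hM,
    Finset.sum_range_add _ (i : ℕ) (m + 1), Finset.sum_eq_zero hlow, zero_add, Nat.add_sub_cancel, mul_assoc,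
    Finset.mul_sum]
  congr 1
  refine Finset.sum_congr rfl fun l _ => ?_
  rw [if_pos (Nat.le_add_right _ _), Nat.add_sub_cancel_left]
  ring

theorem det_gMn_of_pos (hγ : 0 < γ) {x : Fin M → ℝ} (hx : ∀ j, 0 < x j) :
    det (of fun i j : Fin M => gMn γ M (i + 1) (x j)) =
      Real.exp (-γ * ∑ j, x j) * vandermondeProd x := by
  set T : Matrix (Fin M) (Fin M) ℝ := of fun i k : Fin M =>
    if i ≤ k then γ ^ ((k : ℕ) - i) / ((k : ℕ) - i).factorial else 0 with hT
  have hdet : T.det = 1 := by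
    rw [det_of_isUpperTriangular (M := T) fun i j hij => by
      exact if_neg (not_le.2 hij)]
    simp [hT]
  have h : (of fun i j : Fin M => gMn γ M (i + 1) (x j)) =
      of fun i j => Real.exp (-γ * x j) * (T * (vandermonde x)ᵀ) i j := by
    ext i j
    rw [of_apply, of_apply, gMn_eq_sum_of_pos hγ i (hx j), mul_apply]
    simp [hT, vandermonde_apply]
  rw [h, det_mul_row, det_mul, hdet, one_mul, det_transpose, det_vandermonde, ← Real.exp_sum,
    Finset.mul_sum, vandermondeProd]

theorem ofReal_det_of (f : Fin M → Fin M → ℝ) :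
    det (of fun i j => (f i j : ℂ)) = ((det (of f) : ℝ) : ℂ) :=
  (RingHom.map_det Complex.ofRealHom (of f)).symm ▸ rfl

/-- The modulated determinant of `gMn` is a nonzero multiple of the determinant of the transforms
of `z ^ l * w(z)`. -/
theorem exists_det_gMn_eq (hγ : 0 < γ) (α : ℝ) :
    ∃ a : ℂ, a ≠ 0 ∧ ∀ x : Fin M → ℝ,
      Complex.exp (-Complex.I * γ * α * ∑ j, (x j : ℂ)) *
        det (of fun i j : Fin M => (gMn γ M (i + 1) (x j) : ℂ)) =
      a * det (of fun i j : Fin M => ∫ z : ℝ, (z : ℂ) ^ (i : ℕ) *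
        (cauchyWeightReal γ α M z : ℂ) * Complex.exp (-Complex.I * x j * z)) := by
  choose A hA using fun i : Fin M => exists_gMn_eq_sum hγ α i.2
  have key : ∀ x : Fin M → ℝ,
      Complex.exp (-Complex.I * γ * α * ∑ j, (x j : ℂ)) *
        det (of fun i j : Fin M => (gMn γ M (i + 1) (x j) : ℂ)) =
      det (of A) * det (of fun i j : Fin M => ∫ z : ℝ, (z : ℂ) ^ (i : ℕ) *
        (cauchyWeightReal γ α M z : ℂ) * Complex.exp (-Complex.I * x j * z)) := fun x => by
    rw [← det_mul, Finset.mul_sum, Complex.exp_sum, ← det_mul_row]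
    congr 1
    ext i j
    rw [of_apply, of_apply, hA, mul_apply]
    rfl
  refine ⟨det (of A), fun h0 => ?_, key⟩
  have hpos : ∀ j : Fin M, (0 : ℝ) < (j : ℕ) + 1 := fun j => by positivity
  have hinj : Function.Injective fun j : Fin M => ((j : ℕ) + 1 : ℝ) := fun i j hij =>
    Fin.ext (by exact_mod_cast add_right_cancel hij)
  have h := key fun j => (j : ℕ) + 1
  rw [h0, zero_mul, ofReal_det_of fun i j : Fin M => gMn γ M (i + 1) ((j : ℕ) + 1),
    det_gMn_of_pos hγ hpos] at h
  refine mul_ne_zero (Complex.exp_ne_zero _) (Complex.ofReal_ne_zero.2 ?_) h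
  exact mul_ne_zero (Real.exp_ne_zero _) (vandermondeProd_ne_zero hinj)

theorem tendsto_integral_cexp_sum_diag {μ : Measure (HermitianSpace M)} {x : Fin M → ℝ}
    {f : HermitianSpace M → ℂ} (hf : Integrable f μ) :
    Filter.Tendsto (fun t : ℝ => ∫ K : HermitianSpace M,
      Complex.exp (-Complex.I * ∑ i, K.1 i i * ((t * x i : ℝ) : ℂ)) * f K ∂μ)
      (nhdsWithin 0 (Set.Ioi 0)) (nhds (∫ K, f K ∂μ)) := by
  refine tendsto_integral_filter_of_dominated_convergence (fun K => ‖f K‖)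
    (Filter.Eventually.of_forall fun t => ?_) (Filter.Eventually.of_forall fun t =>
      Filter.Eventually.of_forall fun K => ?_) hf.norm (Filter.Eventually.of_forall fun K => ?_)
  · exact (HermitianSpace.continuous_cexp_sum_diag _).aestronglyMeasurable.mul
      hf.aestronglyMeasurable
  · rw [norm_mul, norm_cexp_neg_I_mul_sum_diag K.2 (fun i => t * x i), one_mul]
  · have hc : Continuous fun t : ℝ =>
        Complex.exp (-Complex.I * ∑ i, K.1 i i * ((t * x i : ℝ) : ℂ)) * f K := by fun_prop
    have h := hc.tendsto 0
    simp only [zero_mul, Complex.ofReal_zero, mul_zero, Finset.sum_const_zero, Complex.exp_zero,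
      one_mul] at h
    exact h.mono_left nhdsWithin_le_nhds

/-- The Fourier transform of the matrix Cauchy weight at a diagonal matrix. -/
theorem vandermondeProd_mul_fourier_cauchyWeight (hγ : 0 < γ) (α : ℝ)
    (μ : Measure (HermitianSpace M)) [μ.IsAddHaarMeasure]
    (hfi : Integrable (fun K : HermitianSpace M => cauchyWeight γ α M K.1) μ)
    {x : Fin M → ℝ} (hx : Function.Injective x) :
    ((vandermondeProd x : ℝ) : ℂ) * ∫ K : HermitianSpace M,
        Complex.exp (-Complex.I * ∑ i, K.1 i i * (x i : ℂ)) * cauchyWeight γ α M K.1 ∂μ =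
      (Complex.exp (-Complex.I * γ * α * ∑ j, (x j : ℂ)) *
        det (of fun i j : Fin M => (gMn γ M (i + 1) (x j) : ℂ))) *
      ∫ K : HermitianSpace M, cauchyWeight γ α M K.1 ∂μ := by
  obtain ⟨c, hc⟩ := exists_fourier_cauchyWeight hγ α μ hfi
  obtain ⟨a, ha, h⟩ := exists_det_gMn_eq (M := M) hγ α
  have key : ∀ x : Fin M → ℝ, Function.Injective x →
      ((vandermondeProd x : ℝ) : ℂ) * ∫ K : HermitianSpace M,
        Complex.exp (-Complex.I * ∑ i, K.1 i i * (x i : ℂ)) * cauchyWeight γ α M K.1 ∂μ =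
      c / a * (Complex.exp (-Complex.I * γ * α * ∑ j, (x j : ℂ)) *
        det (of fun i j : Fin M => (gMn γ M (i + 1) (x j) : ℂ))) := fun x hx => by
    rw [hc x hx, h x, div_mul_eq_mul_div, mul_left_comm, mul_div_cancel_left₀ _ ha]
  suffices hI : ∫ K : HermitianSpace M, cauchyWeight γ α M K.1 ∂μ = c / a by
    rw [key x hx, hI, mul_comm]
  set y : Fin M → ℝ := fun j => (j : ℕ) + 1 with hy
  have hpos : ∀ j, 0 < y j := fun j => by positivity
  have hinj : Function.Injective y := fun i j hij =>
    Fin.ext (by exact_mod_cast add_right_cancel hij)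
  have hlim : Filter.Tendsto (fun t : ℝ => c / a *
      (Complex.exp (-Complex.I * γ * α * ∑ j, ((t * y j : ℝ) : ℂ)) *
        (Real.exp (-γ * ∑ j, t * y j) : ℂ))) (nhdsWithin 0 (Set.Ioi 0)) (nhds (c / a)) := by
    have hcont : Continuous fun t : ℝ => c / a *
      (Complex.exp (-Complex.I * γ * α * ∑ j, ((t * y j : ℝ) : ℂ)) *
        (Real.exp (-γ * ∑ j, t * y j) : ℂ)) := by fun_prop
    have h0 := hcont.tendsto 0
    simp only [zero_mul, Complex.ofReal_zero, Finset.sum_const_zero, mul_zero, Complex.exp_zero,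
      Real.exp_zero, Complex.ofReal_one, mul_one] at h0
    exact h0.mono_left nhdsWithin_le_nhds
  refine tendsto_nhds_unique (tendsto_integral_cexp_sum_diag (x := y) hfi) (hlim.congr' ?_)
  filter_upwards [self_mem_nhdsWithin] with t ht
  have htinj : Function.Injective fun j => t * y j := fun i j hij =>
    hinj (mul_left_cancel₀ (ne_of_gt ht) hij)
  have hV : ((vandermondeProd fun j => t * y j : ℝ) : ℂ) ≠ 0 :=
    Complex.ofReal_ne_zero.2 (vandermondeProd_ne_zero htinj)
  have hk := key _ htinj
  rw [ofReal_det_of fun i j : Fin M => gMn γ M (i + 1) (t * y j),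
    det_gMn_of_pos hγ fun j => mul_pos ht (hpos j), Complex.ofReal_mul] at hk
  apply mul_left_cancel₀ hV
  rw [hk]
  ring

end

namespace HermitianSpace

variable {M : ℕ} {U : Matrix (Fin M) (Fin M) ℂ}

/-- Conjugation of Hermitian matrices by a unitary matrix. -/
def conjEquiv (hU : U ∈ unitaryGroup (Fin M) ℂ) : HermitianSpace M ≃+ HermitianSpace M where
  toFun K := ⟨U * K.1 * star U, by
    rw [selfAdjoint.mem_iff, star_mul, star_mul, star_star, K.2, mul_assoc]⟩
  invFun K := ⟨star U * K.1 * U, by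
    rw [selfAdjoint.mem_iff, star_mul, star_mul, star_star, K.2, mul_assoc]⟩
  left_inv K := Subtype.ext <| by
    have h := mem_unitaryGroup_iff'.1 hU
    change star U * (U * K.1 * star U) * U = K.1
    rw [mul_assoc, mul_assoc, h, mul_one, ← mul_assoc, h, one_mul]
  right_inv K := Subtype.ext <| by
    have h := mem_unitaryGroup_iff.1 hU
    change U * (star U * K.1 * U) * star U = K.1
    rw [mul_assoc, mul_assoc, h, mul_one, ← mul_assoc, h, one_mul]
  map_add' K L := Subtype.ext <| by
    change U * (K.1 + L.1) * star U = U * K.1 * star U + U * L.1 * star U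
    rw [mul_add, add_mul]

theorem continuous_conjEquiv (hU : U ∈ unitaryGroup (Fin M) ℂ) : Continuous (conjEquiv hU) :=
  Continuous.subtype_mk (by fun_prop) _

theorem continuous_conjEquiv_symm (hU : U ∈ unitaryGroup (Fin M) ℂ) :
    Continuous (conjEquiv hU).symm :=
  Continuous.subtype_mk (by fun_prop) _

/-- Unitary conjugation scales integrals by a nonzero constant. -/
theorem exists_integral_conj_eq (μ : Measure (HermitianSpace M)) [μ.IsAddHaarMeasure]
    (hU : U ∈ unitaryGroup (Fin M) ℂ) : ∃ c : ℂ, c ≠ 0 ∧ ∀ f : Matrix (Fin M) (Fin M) ℂ → ℂ,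
      ∫ K : HermitianSpace M, f (U * K.1 * star U) ∂μ = c * ∫ K : HermitianSpace M, f K.1 ∂μ := by
  have hHaar := (conjEquiv hU).isAddHaarMeasure_map μ (continuous_conjEquiv hU)
    (continuous_conjEquiv_symm hU)
  obtain ⟨c, hc⟩ := exists_smul_eq (μ.map (conjEquiv hU)) μ
  refine ⟨(c : ℝ), fun h0 => ?_, fun f => ?_⟩
  · have hc0 : c = 0 := by simpa using h0
    rw [hc0, zero_smul] at hc
    exact NeZero.ne (μ.map (conjEquiv hU)) hc
  · let e : HermitianSpace M ≃ₜ HermitianSpace M :=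
      { (conjEquiv hU).toEquiv with
        continuous_toFun := continuous_conjEquiv hU
        continuous_invFun := continuous_conjEquiv_symm hU }
    have h := e.measurableEmbedding.integral_map (μ := μ) fun K : HermitianSpace M => f K.1
    change ∫ K, f K.1 ∂(μ.map (conjEquiv hU)) = _ at h
    rw [hc, integral_smul_nnreal_measure, NNReal.smul_def, Complex.real_smul] at h
    exact h.symm

end HermitianSpace

theorem prod_Ioi_sub_eq {R : Type*} [CommRing R] {M : ℕ} (x : Fin M → R) :
    ∏ i, ∏ j ∈ Finset.Ioi i, (x i - x j) = (-1) ^ (M * (M - 1) / 2) * vandermondeProd x := by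
  have h : ∀ i, ∏ j ∈ Finset.Ioi i, (x i - x j) =
      (-1) ^ (M - 1 - (i : ℕ)) * ∏ j ∈ Finset.Ioi i, (x j - x i) := fun i => by
    rw [← Fin.card_Ioi, ← Finset.prod_const, ← Finset.prod_mul_distrib]
    exact Finset.prod_congr rfl fun j _ => by ring
  rw [Finset.prod_congr rfl fun i _ => h i, Finset.prod_mul_distrib, Finset.prod_pow_eq_pow_sum,
    Fin.sum_univ_eq_sum_range fun i => M - 1 - i, Finset.sum_range_reflect (fun i => i) M,
    Finset.sum_range_id, vandermondeProd]

section

variable {γ : ℝ} {M : ℕ}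

theorem trace_mul_diagonal (K : Matrix (Fin M) (Fin M) ℂ) (d : Fin M → ℂ) :
    trace (K * diagonal d) = ∑ i, K i i * d i := by
  simp [trace]

/-- `vandermondeProd_mul_fourier_cauchyWeight` without the integrability assumption. -/
theorem vandermondeProd_mul_integral_cauchyWeight (hγ : 0 < γ) (α : ℝ)
    (μ : Measure (HermitianSpace M)) [μ.IsAddHaarMeasure]
    {x : Fin M → ℝ} (hx : Function.Injective x) :
    ((vandermondeProd x : ℝ) : ℂ) * ∫ K : HermitianSpace M,
        Complex.exp (-Complex.I * ∑ i, K.1 i i * (x i : ℂ)) * cauchyWeight γ α M K.1 ∂μ =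
      (Complex.exp (-Complex.I * γ * α * ∑ j, (x j : ℂ)) *
        det (of fun i j : Fin M => (gMn γ M (i + 1) (x j) : ℂ))) *
      ∫ K : HermitianSpace M, cauchyWeight γ α M K.1 ∂μ := by
  by_cases hfi : Integrable (fun K : HermitianSpace M => cauchyWeight γ α M K.1) μ
  · exact vandermondeProd_mul_fourier_cauchyWeight hγ α μ hfi hx
  have hmeas : AEStronglyMeasurable (fun K : HermitianSpace M => cauchyWeight γ α M K.1) μ :=
    ((measurable_cauchyWeight γ α).comp measurable_subtype_coe).aestronglyMeasurable
  have hfi' : ¬ Integrable (fun K : HermitianSpace M =>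
      Complex.exp (-Complex.I * ∑ i, K.1 i i * (x i : ℂ)) * cauchyWeight γ α M K.1) μ :=
    fun h => hfi <| (integrable_congr'
      ((HermitianSpace.continuous_cexp_sum_diag x).aestronglyMeasurable.mul hmeas) hmeas
      (Filter.Eventually.of_forall fun K => by
        rw [Pi.mul_apply, norm_mul, norm_cexp_neg_I_mul_sum_diag K.2, one_mul])).1 h
  rw [integral_undef hfi, integral_undef hfi', mul_zero, mul_zero]

theorem vandermondeProd_mul_integral_cauchyWeight_of_isHermitian (hγ : 0 < γ) (α : ℝ)
    (μ : Measure (HermitianSpace M)) [μ.IsAddHaarMeasure] {X : Matrix (Fin M) (Fin M) ℂ}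
    (hX : X.IsHermitian) (hx : Function.Injective hX.eigenvalues) :
    ((vandermondeProd hX.eigenvalues : ℝ) : ℂ) * ∫ K : HermitianSpace M,
        Complex.exp (-Complex.I * trace (K.1 * X)) * cauchyWeight γ α M K.1 ∂μ =
      (Complex.exp (-Complex.I * γ * α * ∑ j, (hX.eigenvalues j : ℂ)) *
        det (of fun i j : Fin M => (gMn γ M (i + 1) (hX.eigenvalues j) : ℂ))) *
      ∫ K : HermitianSpace M, cauchyWeight γ α M K.1 ∂μ := by
  obtain ⟨U, hU, hXU⟩ := exists_unitary_eq_conj_diagonal hX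
  obtain ⟨c, hc0, hc⟩ := HermitianSpace.exists_integral_conj_eq μ hU
  have h1 := hc (cauchyWeight γ α M)
  have h2 := hc fun K => Complex.exp (-Complex.I * trace (K * X)) * cauchyWeight γ α M K
  have htr : ∀ K : Matrix (Fin M) (Fin M) ℂ, trace (U * K * star U * X) =
      ∑ i, K i i * (hX.eigenvalues i : ℂ) := fun K => by
    have hs : star U * X * U = diagonal fun i => (hX.eigenvalues i : ℂ) := by
      have h := mem_unitaryGroup_iff'.1 hU
      conv_lhs => rw [hXU]
      rw [mul_assoc, mul_assoc, h, mul_one, ← mul_assoc, h, one_mul]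
    rw [← trace_mul_diagonal, ← hs, mul_assoc, mul_assoc, trace_mul_comm]
    simp only [mul_assoc]
  simp only [cauchyWeight_unitary_conj γ α hU, htr] at h1 h2
  have h := vandermondeProd_mul_integral_cauchyWeight hγ α μ hx
  rw [h2] at h
  apply mul_left_cancel₀ hc0
  rw [mul_left_comm, h, mul_left_comm c, ← h1]

end

/-- Proposition 2, characteristic-function form: for every `M×M`
Hermitian `X` with pairwise distinct eigenvalues `x_1, …, x_M`,
`∫ e^{-i·Tr(KX)} det[γ²1+(K-γα1)²]^{-M} dK
  = F(x_1,…,x_M) · ∫ det[γ²1+(K-γα1)²]^{-M} dK` with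
`F(x) = (-1)^{M(M-1)/2} e^{-iγα∑x_c} det[g_{M-i}(x_j)] / ∏_{i<j}(x_i - x_j)`,
the integrals being over Hermitian `K` with respect to an additive Haar measure. -/
theorem cauchy_char_function (M : ℕ) (hM : 1 ≤ M) (γ : ℝ) (hγ : 0 < γ) (α : ℝ)
    (μ : Measure (selfAdjoint (Matrix (Fin M) (Fin M) ℂ))) (hμ : μ.IsAddHaarMeasure)
    (X : Matrix (Fin M) (Fin M) ℂ) (hX : X.IsHermitian)
    (hdist : Function.Injective hX.eigenvalues) :
    (∫ K : selfAdjoint (Matrix (Fin M) (Fin M) ℂ),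
        Complex.exp (-Complex.I * Matrix.trace ((K : Matrix (Fin M) (Fin M) ℂ) * X)) *
          (Matrix.det (((γ : ℂ) ^ 2) • (1 : Matrix (Fin M) (Fin M) ℂ) +
            ((K : Matrix (Fin M) (Fin M) ℂ) - ((γ : ℂ) * (α : ℂ)) • 1) ^ 2) ^ M)⁻¹ ∂μ)
      = ((-1 : ℂ) ^ (M * (M - 1) / 2) *
          Complex.exp (-Complex.I * (γ : ℂ) * (α : ℂ) * ∑ c : Fin M, (hX.eigenvalues c : ℂ)) *
          (Matrix.det (Matrix.of fun i j : Fin M =>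
              ((gMn γ M ((i : ℕ) + 1) (hX.eigenvalues j) : ℝ) : ℂ)) /
            ∏ i : Fin M, ∏ j ∈ Finset.Ioi i,
              ((hX.eigenvalues i : ℂ) - (hX.eigenvalues j : ℂ)))) *
        ∫ K : selfAdjoint (Matrix (Fin M) (Fin M) ℂ),
          (Matrix.det (((γ : ℂ) ^ 2) • (1 : Matrix (Fin M) (Fin M) ℂ) +
            ((K : Matrix (Fin M) (Fin M) ℂ) - ((γ : ℂ) * (α : ℂ)) • 1) ^ 2) ^ M)⁻¹ ∂μ := by
  have h := vandermondeProd_mul_integral_cauchyWeight_of_isHermitian hγ α μ hX hdist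
  have hV : ((vandermondeProd hX.eigenvalues : ℝ) : ℂ) ≠ 0 :=
    Complex.ofReal_ne_zero.2 (vandermondeProd_ne_zero hdist)
  have hV' : vandermondeProd (fun i => (hX.eigenvalues i : ℂ)) =
      ((vandermondeProd hX.eigenvalues : ℝ) : ℂ) := by
    simp [vandermondeProd]
  unfold cauchyWeight at h
  rw [prod_Ioi_sub_eq fun i => (hX.eigenvalues i : ℂ), hV',
    eq_div_of_mul_eq hV ((mul_comm _ _).trans h)]
  field_simp
end

section
/- Fix an integer M ≥ 1, γ > 0 and a real number α. Let x_1, …, x_M be pairwise distinct nonzero real numbers and set ζ_c = iγx_c/π for c = 1, …, M. Then the limit, as the tuple (η_1, …, η_M) of pairwise distinct real numbers tends to (0, …, 0), of (-1)^{M(M-1)/2} · exp( -πα·∑_{c=1}^M (ζ_c - η_c) ) · ( ∏_{i=1}^M ∏_{j=1}^M (ζ_i - η_j) ) / ( Δ{ζ} · Δ{η} ) · det[ exp( iπ·sgn(x_i)·(ζ_i - η_j) ) / (ζ_i - η_j) ]_{i,j=1}^{M} exists and equals F(x_1,…,x_M) = (-1)^{M(M-1)/2} · e^{-iγα·∑_{c=1}^M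 x_c} · det[ g_{M-i}(x_j) ]_{i,j=1}^{M} / ∏_{1≤i<j≤M}(x_i - x_j). -/
open MeasureTheory Filter

/-- Newton interpolation of the Cauchy kernel, with remainder. -/
theorem inv_sub_eq_newton_sum_add {M : ℕ} (η : Fin M → ℂ) (w y : ℂ) (hw : ∀ l, w - η l ≠ 0)
    (hy : w - y ≠ 0) :
    (w - y)⁻¹ = ∑ k, (∏ l ∈ Finset.Ioi k, (y - η l)) *
        ((w - η k) * ∏ l ∈ Finset.Ioi k, (w - η l))⁻¹ +
      (∏ l, (y - η l)) * (∏ l, (w - η l))⁻¹ * (w - y)⁻¹ := by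
  induction M with
  | zero => simp
  | succ n ih =>
    have key := ih (fun l => η l.succ) (fun l => hw l.succ)
    have h0 := hw 0
    have hP : (∏ l : Fin n, (w - η l.succ)) ≠ 0 := Finset.prod_ne_zero_iff.2 fun l _ => hw l.succ
    rw [Fin.sum_univ_succ]
    simp only [Fin.prod_Ioi_succ, Fin.prod_Ioi_zero, Fin.prod_univ_succ]
    rw [← sub_eq_iff_eq_add] at key
    rw [add_assoc, add_comm, add_assoc, ← sub_eq_iff_eq_add', ← key]
    field_simp
    ring

/-- Newton interpolation of the Cauchy kernel at a node. -/
theorem inv_sub_eq_newton_sum {M : ℕ} (η : Fin M → ℂ) (w : ℂ) (hw : ∀ l, w - η l ≠ 0)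
    (j : Fin M) :
    (w - η j)⁻¹ = ∑ k, (∏ l ∈ Finset.Ioi k, (η j - η l)) *
        ((w - η k) * ∏ l ∈ Finset.Ioi k, (w - η l))⁻¹ := by
  have h := inv_sub_eq_newton_sum_add η w (η j) hw (hw j)
  rwa [Finset.prod_eq_zero (Finset.mem_univ j) (sub_self _), zero_mul, zero_mul, add_zero] at h

/-- The divided difference `f[η_k, …, η_{M-1}]`, written as a Cauchy integral over `|w| = R`. -/
noncomputable def cauchyDividedDiff {M : ℕ} (R : ℝ) (f : ℂ → ℂ) (η : Fin M → ℂ) (k : Fin M) : ℂ :=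
  (2 * Real.pi * Complex.I)⁻¹ *
    ∮ w in C(0, R), ((w - η k) * ∏ l ∈ Finset.Ioi k, (w - η l))⁻¹ * f w

theorem continuousOn_newton_kernel {M : ℕ} {R : ℝ} {f : ℂ → ℂ}
    (hf : ContinuousOn f (Metric.sphere 0 R)) (k : Fin M) :
    ContinuousOn (Function.uncurry fun (η : Fin M → ℂ) w =>
        ((w - η k) * ∏ l ∈ Finset.Ioi k, (w - η l))⁻¹ * f w)
      (Metric.ball 0 R ×ˢ Metric.sphere 0 R) := by
  refine ContinuousOn.mul (ContinuousOn.inv₀ (by fun_prop) ?_)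
    (hf.comp continuousOn_snd fun p hp => hp.2)
  rintro ⟨η, w⟩ ⟨hη, hw⟩
  have hne : ∀ l, w - η l ≠ 0 := fun l h => by
    have hl := (norm_le_pi_norm η l).trans_lt (mem_ball_zero_iff.1 hη)
    rw [← sub_eq_zero.1 h, mem_sphere_zero_iff_norm.1 hw] at hl
    exact lt_irrefl _ hl
  exact mul_ne_zero (hne k) (Finset.prod_ne_zero_iff.2 fun l _ => hne l)

theorem newton_interpolation {M : ℕ} {R : ℝ} (hR : 0 < R) {f : ℂ → ℂ}
    (hf : DifferentiableOn ℂ f (Metric.closedBall 0 R)) (η : Fin M → ℂ)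
    (hη : η ∈ Metric.ball 0 R) (j : Fin M) :
    f (η j) = ∑ k, cauchyDividedDiff R f η k * ∏ l ∈ Finset.Ioi k, (η j - η l) := by
  have hηl : ∀ l, ‖η l‖ < R := fun l =>
    (norm_le_pi_norm η l).trans_lt (mem_ball_zero_iff.1 hη)
  have hc := Complex.two_pi_I_inv_smul_circleIntegral_sub_inv_smul_of_differentiable_on_off_countable
    Set.countable_empty (w := η j)
    (mem_ball_zero_iff.2 (hηl j)) hf.continuousOn
    (fun x hx => hf.differentiableAt
      (Filter.mem_of_superset (Metric.isOpen_ball.mem_nhds hx.1) Metric.ball_subset_closedBall))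
  have hcont := hf.continuousOn.mono Metric.sphere_subset_closedBall
  have hint : ∀ k : Fin M, CircleIntegrable
      (fun w => ((w - η k) * ∏ l ∈ Finset.Ioi k, (w - η l))⁻¹ * f w) 0 R := fun k =>
    ((continuousOn_newton_kernel hcont k).uncurry_left η hη).circleIntegrable hR.le
  have hexp : (∮ w in C(0, R), (w - η j)⁻¹ • f w) =
      ∮ w in C(0, R), ∑ k, (∏ l ∈ Finset.Ioi k, (η j - η l)) *
        (((w - η k) * ∏ l ∈ Finset.Ioi k, (w - η l))⁻¹ * f w) := by
    refine circleIntegral.integral_congr hR.le fun w hw => ?_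
    have hne : ∀ l, w - η l ≠ 0 := fun l h => by
      have hl := hηl l
      rw [← sub_eq_zero.1 h, mem_sphere_zero_iff_norm.1 hw] at hl
      exact lt_irrefl _ hl
    simp only [smul_eq_mul]
    rw [inv_sub_eq_newton_sum η w hne j, Finset.sum_mul]
    exact Finset.sum_congr rfl fun k _ => mul_assoc _ _ _
  rw [← hc, hexp, circleIntegral.integral_fun_sum fun k _ =>
      by simpa using (hint k).const_fun_smul (a := ∏ l ∈ Finset.Ioi k, (η j - η l)),
    smul_eq_mul, Finset.mul_sum]
  refine Finset.sum_congr rfl fun k _ => ?_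
  rw [circleIntegral.integral_const_mul, cauchyDividedDiff]
  ring

theorem tendsto_cauchyDividedDiff {M : ℕ} {R : ℝ} (hR : 0 < R) {f : ℂ → ℂ}
    (hf : ContinuousOn f (Metric.sphere 0 R)) (k : Fin M) :
    Tendsto (fun η : Fin M → ℂ => cauchyDividedDiff R f η k) (nhds 0)
      (nhds (cauchyDividedDiff R f 0 k)) := by
  have h0 := Metric.mem_ball_self (x := (0 : Fin M → ℂ)) hR
  have hk := continuousOn_newton_kernel hf k
  refine Tendsto.const_mul _
    (TendstoUniformlyOn.tendsto_circleIntegral_of_continuousOn hR.le ?_ ?_)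
  · filter_upwards [Metric.isOpen_ball.mem_nhds h0] with η hη
    exact hk.uncurry_left η hη
  · refine Metric.tendstoUniformlyOn_iff.2 fun ε hε => ?_
    obtain ⟨v, hv, hvu⟩ := (isCompact_sphere (0 : ℂ) R).mem_uniformity_of_prod hk h0
      (Metric.dist_mem_uniformity hε)
    rw [Metric.isOpen_ball.nhdsWithin_eq h0] at hv
    filter_upwards [hv] with η hη w hw
    rw [dist_comm]
    exact hvu η hη w hw

/-- A determinant `det (f_i(η_j))` divided by the Vandermonde product in `η` is the determinant
of divided differences. -/
theorem det_eq_det_cauchyDividedDiff_mul {M : ℕ} {R : Fin M → ℝ} (hR : ∀ i, 0 < R i)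
    {f : Fin M → ℂ → ℂ} (hf : ∀ i, DifferentiableOn ℂ (f i) (Metric.closedBall 0 (R i)))
    (η : Fin M → ℂ) (hη : ∀ i, η ∈ Metric.ball 0 (R i)) :
    Matrix.det (Matrix.of fun i j => f i (η j)) =
      Matrix.det (Matrix.of fun i k => cauchyDividedDiff (R i) (f i) η k) *
        ∏ i, ∏ j ∈ Finset.Ioi i, (η i - η j) := by
  have hN : Matrix.det (Matrix.of fun k j => ∏ l ∈ Finset.Ioi k, (η j - η l)) =
      ∏ i, ∏ j ∈ Finset.Ioi i, (η i - η j) := by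
    rw [Matrix.det_of_isLowerTriangular]
    · rfl
    · intro k j hkj
      exact Finset.prod_eq_zero (Finset.mem_Ioi.2 hkj) (sub_self _)
  rw [← hN, ← Matrix.det_mul]
  congr 1
  ext i j
  simp only [Matrix.mul_apply, Matrix.of_apply]
  exact newton_interpolation (hR i) (hf i) η (hη i) j

theorem tendsto_det_div_vandermonde {M : ℕ} {R : Fin M → ℝ} (hR : ∀ i, 0 < R i)
    {f : Fin M → ℂ → ℂ} (hf : ∀ i, DifferentiableOn ℂ (f i) (Metric.closedBall 0 (R i))) :
    Tendsto (fun η : Fin M → ℂ => Matrix.det (Matrix.of fun i j => f i (η j)) /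
        ∏ i, ∏ j ∈ Finset.Ioi i, (η i - η j))
      (nhdsWithin 0 {η | Function.Injective η})
      (nhds (Matrix.det (Matrix.of fun i k => cauchyDividedDiff (R i) (f i) 0 k))) := by
  have hlim : Tendsto (fun η : Fin M → ℂ =>
      Matrix.det (Matrix.of fun i k => cauchyDividedDiff (R i) (f i) η k)) (nhds 0)
      (nhds (Matrix.det (Matrix.of fun i k => cauchyDividedDiff (R i) (f i) 0 k))) := by
    refine ((continuous_id.matrix_det (R := ℂ)).tendsto _).comp ?_
    refine tendsto_pi_nhds.2 fun i => tendsto_pi_nhds.2 fun k => ?_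
    exact tendsto_cauchyDividedDiff (hR i)
      ((hf i).continuousOn.mono Metric.sphere_subset_closedBall) k
  refine (hlim.mono_left nhdsWithin_le_nhds).congr' ?_
  have hsmall : ∀ᶠ η : Fin M → ℂ in nhds 0, ∀ i, η ∈ Metric.ball 0 (R i) :=
    eventually_all.2 fun i => Metric.ball_mem_nhds 0 (hR i)
  filter_upwards [nhdsWithin_le_nhds hsmall, self_mem_nhdsWithin] with η hη hinj
  rw [det_eq_det_cauchyDividedDiff_mul hR hf η hη, mul_div_cancel_right₀]
  refine Finset.prod_ne_zero_iff.2 fun i _ => Finset.prod_ne_zero_iff.2 fun j hj => ?_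
  exact sub_ne_zero.2 (hinj.ne (Finset.mem_Ioi.1 hj).ne)

theorem differentiableOn_exp_div_sub {R : ℝ} {ζ : ℂ} (hζ : R < ‖ζ‖) (a : ℂ) :
    DifferentiableOn ℂ (fun w => Complex.exp (a * (ζ - w)) / (ζ - w)) (Metric.closedBall 0 R) := by
  refine DifferentiableOn.div (by fun_prop) (by fun_prop) fun w hw h => ?_
  rw [mem_closedBall_zero_iff, ← sub_eq_zero.1 h] at hw
  exact hw.not_gt hζ

theorem circleIntegral_exp_mul_sub {R : ℝ} (hR : 0 < R) (a ζ : ℂ) (n : ℕ) :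
    (∮ w in C(0, R), (w ^ (n + 1))⁻¹ * Complex.exp (a * (ζ - w))) =
      2 * Real.pi * Complex.I * (Complex.exp (a * ζ) * ((-a) ^ n / n.factorial)) := by
  have h := DifferentiableOn.circleIntegral_one_div_sub_center_pow_smul (c := 0)
    (f := fun w : ℂ => Complex.exp (-a * w)) hR n (by fun_prop)
  have hsplit : ∀ w : ℂ, (w ^ (n + 1))⁻¹ * Complex.exp (a * (ζ - w)) =
      Complex.exp (a * ζ) * ((1 / (w - 0) ^ (n + 1)) • Complex.exp (-a * w)) := fun w => by
    rw [show a * (ζ - w) = a * ζ + -a * w by ring, Complex.exp_add, sub_zero, smul_eq_mul]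
    ring
  simp_rw [hsplit]
  rw [circleIntegral.integral_const_mul, h, iteratedDeriv_cexp_const_mul]
  simp only [smul_eq_mul, mul_zero, Complex.exp_zero]
  ring

/-- Taylor coefficients at `0` of `w ↦ exp (a (ζ - w)) / (ζ - w)`, as Cauchy integrals. -/
theorem circleIntegral_exp_div_sub {R : ℝ} (hR : 0 < R) {ζ : ℂ} (hζ : R < ‖ζ‖) (a : ℂ) (n : ℕ) :
    (∮ w in C(0, R), (w ^ (n + 1))⁻¹ * (Complex.exp (a * (ζ - w)) / (ζ - w))) =
      2 * Real.pi * Complex.I * (Complex.exp (a * ζ) * (ζ ^ (n + 1))⁻¹ *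
        ∑ l ∈ Finset.range (n + 1), (-(a * ζ)) ^ l / l.factorial) := by
  have hζ0 : ζ ≠ 0 := norm_pos_iff.1 (hR.trans hζ)
  have hd := differentiableOn_exp_div_sub hζ a
  have hw0 : ∀ w ∈ Metric.sphere (0 : ℂ) R, w ≠ 0 := fun w hw =>
    norm_pos_iff.1 (by rwa [mem_sphere_zero_iff_norm.1 hw])
  have hwζ : ∀ w ∈ Metric.sphere (0 : ℂ) R, ζ - w ≠ 0 := fun w hw h => by
    rw [mem_sphere_zero_iff_norm, ← sub_eq_zero.1 h] at hw
    exact hζ.ne' hw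
  have hcont := hd.continuousOn.mono Metric.sphere_subset_closedBall
  have hint : ∀ m : ℕ, CircleIntegrable
      (fun w => (w ^ m)⁻¹ * (Complex.exp (a * (ζ - w)) / (ζ - w))) 0 R := fun m =>
    (ContinuousOn.mul (ContinuousOn.inv₀ (by fun_prop) fun w hw => pow_ne_zero _ (hw0 w hw))
      hcont).circleIntegrable hR.le
  induction n with
  | zero =>
    have h := DifferentiableOn.circleIntegral_one_div_sub_center_pow_smul hR 0 hd
    simpa [div_eq_mul_inv] using h
  | succ n ih =>
    have hrec : ζ * (∮ w in C(0, R), (w ^ (n + 1 + 1))⁻¹ *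
          (Complex.exp (a * (ζ - w)) / (ζ - w))) -
        (∮ w in C(0, R), (w ^ (n + 1))⁻¹ * (Complex.exp (a * (ζ - w)) / (ζ - w))) =
        ∮ w in C(0, R), (w ^ (n + 1 + 1))⁻¹ * Complex.exp (a * (ζ - w)) := by
      rw [← circleIntegral.integral_const_mul,
        ← circleIntegral.integral_sub
          (by simpa using (hint (n + 1 + 1)).const_fun_smul (a := ζ)) (hint _)]
      refine circleIntegral.integral_congr hR.le fun w hw => ?_
      have h1 := hw0 w hw
      have h2 := hwζ w hw
      field_simp
      ring
    rw [ih, circleIntegral_exp_mul_sub hR, sub_eq_iff_eq_add] at hrec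
    rw [Finset.sum_range_succ]
    refine mul_left_cancel₀ hζ0 (hrec.trans ?_)
    rw [show -(a * ζ) = -a * ζ by ring, mul_pow (-a) ζ (n + 1)]
    field_simp
    ring

theorem cauchyDividedDiff_exp_div_sub {M : ℕ} {R : ℝ} (hR : 0 < R) {ζ : ℂ} (hζ : R < ‖ζ‖) (a : ℂ)
    (k : Fin M) :
    cauchyDividedDiff R (fun w => Complex.exp (a * (ζ - w)) / (ζ - w)) (0 : Fin M → ℂ) k =
      Complex.exp (a * ζ) * (ζ ^ (M - k))⁻¹ *
        ∑ l ∈ Finset.range (M - k), (-(a * ζ)) ^ l / l.factorial := by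
  have hk : M - (k : ℕ) = (M - 1 - k) + 1 := by omega
  rw [cauchyDividedDiff, hk, inv_mul_eq_iff_eq_mul₀ Complex.two_pi_I_ne_zero,
    ← circleIntegral_exp_div_sub hR hζ]
  simp [pow_succ']

theorem prod_prod_Ioi_mul_sub {M : ℕ} (c : ℂ) (x : Fin M → ℂ) :
    (∏ i, ∏ j ∈ Finset.Ioi i, (c * x i - c * x j)) =
      (∏ i : Fin M, c ^ (i : ℕ)) * ∏ i, ∏ j ∈ Finset.Ioi i, (x i - x j) := by
  simp_rw [← mul_sub, Finset.prod_mul_distrib, Finset.prod_const, Fin.card_Ioi]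
  congr 1
  refine Fintype.prod_equiv Fin.revPerm _ _ fun i => ?_
  rw [Fin.revPerm_apply, Fin.val_rev, Nat.add_comm, Nat.sub_add_eq]

theorem exp_phase_eq_gMn {M : ℕ} {γ : ℝ} (hγ : 0 < γ) {x : ℝ} (hx : x ≠ 0) (k : Fin M) :
    ((Complex.I * γ / Real.pi * x) ^ M : ℂ) *
        (Complex.exp (Complex.I * Real.pi * x.sign * (Complex.I * γ / Real.pi * x)) *
          ((Complex.I * γ / Real.pi * x) ^ (M - (k : ℕ)))⁻¹ *
          ∑ l ∈ Finset.range (M - k),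
            (-(Complex.I * Real.pi * x.sign * (Complex.I * γ / Real.pi * x))) ^ l / l.factorial) =
      (Complex.I * γ / Real.pi) ^ (k : ℕ) * (gMn γ M (k + 1) x : ℂ) := by
  have hπ : (Real.pi : ℂ) ≠ 0 := Complex.ofReal_ne_zero.2 Real.pi_ne_zero
  have hγ' : (γ : ℂ) ≠ 0 := Complex.ofReal_ne_zero.2 hγ.ne'
  have hx' : (x : ℂ) ≠ 0 := Complex.ofReal_ne_zero.2 hx
  have hc : (Complex.I * γ / Real.pi : ℂ) ≠ 0 := div_ne_zero (mul_ne_zero Complex.I_ne_zero hγ') hπ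
  have hphase : Complex.I * Real.pi * x.sign * (Complex.I * γ / Real.pi * x) =
      ((-γ * |x| : ℝ) : ℂ) := by
    have hsign : x.sign * x = |x| := by
      rcases hx.lt_or_gt with h | h
      · rw [Real.sign_of_neg h, abs_of_neg h, neg_one_mul]
      · rw [Real.sign_of_pos h, abs_of_pos h, one_mul]
    rw [← hsign]
    push_cast
    field_simp
    rw [Complex.I_sq, neg_one_mul]
  have habs : |γ * x| = γ * |x| := by rw [abs_mul, abs_of_pos hγ]
  have hpow : ((Complex.I * γ / Real.pi * x) ^ M : ℂ) =
      (Complex.I * γ / Real.pi * x) ^ (k : ℕ) * (Complex.I * γ / Real.pi * x) ^ (M - (k : ℕ)) := by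
    rw [← pow_add, Nat.add_sub_of_le k.is_lt.le]
  have hrange : M - ((k : ℕ) + 1) + 1 = M - k := by omega
  have hne : ((Complex.I * γ / Real.pi * x) ^ (M - (k : ℕ)) : ℂ) ≠ 0 :=
    pow_ne_zero _ (mul_ne_zero hc hx')
  rw [hphase, gMn, hrange, habs, hpow, Nat.add_sub_cancel]
  push_cast
  rw [mul_pow (Complex.I * γ / Real.pi : ℂ) x k, neg_mul, neg_neg,
    mul_assoc (Complex.exp _), mul_left_comm (Complex.exp _), mul_assoc, mul_assoc,
    mul_inv_cancel_left₀ hne]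
  ring

/-- with `ζ_c = iγx_c/π`, as the tuple `(η_1,…,η_M)` of pairwise distinct
reals tends to `0`,
`(-1)^{M(M-1)/2} · exp(-πα ∑_c (ζ_c - η_c)) · (∏_{i,j}(ζ_i - η_j))/(Δ{ζ}Δ{η}) ·
    det[ exp(iπ sgn(x_i)(ζ_i - η_j))/(ζ_i - η_j) ]`
tends to
`F(x) = (-1)^{M(M-1)/2} · e^{-iγα ∑_c x_c} · det[g_{M-i}(x_j)] / ∏_{i<j}(x_i - x_j)`. -/
theorem limit_eta_to_zero (M : ℕ) (hM : 1 ≤ M) (γ : ℝ) (hγ : 0 < γ) (α : ℝ)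
    (x : Fin M → ℝ) (hinj : Function.Injective x) (hx : ∀ c, x c ≠ 0) :
    Filter.Tendsto
      (fun η : Fin M → ℝ =>
        ((-1 : ℂ) ^ (M * (M - 1) / 2) *
          Complex.exp (-(Real.pi : ℂ) * (α : ℂ) *
            ∑ c : Fin M, (Complex.I * (γ : ℂ) * (x c : ℂ) / (Real.pi : ℂ) - (η c : ℂ))) *
          ((∏ i : Fin M, ∏ j : Fin M,
              (Complex.I * (γ : ℂ) * (x i : ℂ) / (Real.pi : ℂ) - (η j : ℂ))) /
            ((∏ i : Fin M, ∏ j ∈ Finset.Ioi i,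
                (Complex.I * (γ : ℂ) * (x i : ℂ) / (Real.pi : ℂ) -
                  Complex.I * (γ : ℂ) * (x j : ℂ) / (Real.pi : ℂ))) *
              (∏ i : Fin M, ∏ j ∈ Finset.Ioi i, ((η i : ℂ) - (η j : ℂ))))) *
          Matrix.det (Matrix.of fun i j : Fin M =>
            Complex.exp (Complex.I * (Real.pi : ℂ) * ((x i).sign : ℂ) *
                (Complex.I * (γ : ℂ) * (x i : ℂ) / (Real.pi : ℂ) - (η j : ℂ))) /
              (Complex.I * (γ : ℂ) * (x i : ℂ) / (Real.pi : ℂ) - (η j : ℂ)))))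
      (nhdsWithin 0 {η : Fin M → ℝ | Function.Injective η})
      (nhds ((-1 : ℂ) ^ (M * (M - 1) / 2) *
        Complex.exp (-Complex.I * (γ : ℂ) * (α : ℂ) * ∑ c : Fin M, (x c : ℂ)) *
        (Matrix.det (Matrix.of fun i j : Fin M => ((gMn γ M ((i : ℕ) + 1) (x j) : ℝ) : ℂ)) /
          ∏ i : Fin M, ∏ j ∈ Finset.Ioi i, ((x i : ℂ) - (x j : ℂ))))) := by
  have hπ : (Real.pi : ℂ) ≠ 0 := Complex.ofReal_ne_zero.2 Real.pi_ne_zero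
  have hγ' : (γ : ℂ) ≠ 0 := Complex.ofReal_ne_zero.2 hγ.ne'
  have hζ : ∀ i, Complex.I * (γ : ℂ) * (x i : ℂ) / (Real.pi : ℂ) =
      Complex.I * γ / Real.pi * x i := fun i => by ring
  simp only [hζ]
  set c : ℂ := Complex.I * γ / Real.pi with hc_def
  have hc : c ≠ 0 := div_ne_zero (mul_ne_zero Complex.I_ne_zero hγ') hπ
  have hζ0 : ∀ i, 0 < ‖c * x i‖ := fun i =>
    norm_pos_iff.2 (mul_ne_zero hc (Complex.ofReal_ne_zero.2 (hx i)))
  have hdet := tendsto_det_div_vandermonde (fun i => half_pos (hζ0 i)) fun i =>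
    differentiableOn_exp_div_sub (half_lt_self (hζ0 i)) (Complex.I * Real.pi * (x i).sign)
  simp only [cauchyDividedDiff_exp_div_sub (half_pos (hζ0 _)) (half_lt_self (hζ0 _))] at hdet
  have hcast : Tendsto (fun (η : Fin M → ℝ) j => (η j : ℂ))
      (nhdsWithin 0 {η | Function.Injective η}) (nhdsWithin 0 {η | Function.Injective η}) := by
    refine tendsto_nhdsWithin_iff.2 ⟨?_, ?_⟩
    · have hcont : Continuous fun (η : Fin M → ℝ) j => (η j : ℂ) := by fun_prop
      exact (hcont.tendsto' 0 0 (by ext; simp)).mono_left nhdsWithin_le_nhds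
    · filter_upwards [self_mem_nhdsWithin] with η hη
      exact Complex.ofReal_injective.comp hη
  have hpre : Tendsto (fun η : Fin M → ℝ => (-1 : ℂ) ^ (M * (M - 1) / 2) *
        Complex.exp (-(Real.pi : ℂ) * α * ∑ i, (c * x i - η i)) *
        ((∏ i, ∏ j, (c * x i - η j)) / ∏ i, ∏ j ∈ Finset.Ioi i, (c * x i - c * x j)))
      (nhdsWithin 0 {η | Function.Injective η})
      (nhds ((-1 : ℂ) ^ (M * (M - 1) / 2) *
        Complex.exp (-(Real.pi : ℂ) * α * ∑ i, c * x i) *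
        ((∏ i, (c * x i) ^ M) / ∏ i, ∏ j ∈ Finset.Ioi i, (c * x i - c * x j)))) := by
    have hcont : Continuous fun η : Fin M → ℝ => (-1 : ℂ) ^ (M * (M - 1) / 2) *
        Complex.exp (-(Real.pi : ℂ) * α * ∑ i, (c * x i - η i)) *
        ((∏ i, ∏ j, (c * x i - η j)) / ∏ i, ∏ j ∈ Finset.Ioi i, (c * x i - c * x j)) := by
      fun_prop
    have h0 := hcont.tendsto 0
    simp only [Pi.zero_apply, Complex.ofReal_zero, sub_zero, Finset.prod_const, Finset.card_univ,
      Fintype.card_fin] at h0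
    exact h0.mono_left nhdsWithin_le_nhds
  have hlim := hpre.mul (hdet.comp hcast)
  have hrows : (∏ i, (c * x i) ^ M) * Matrix.det (Matrix.of fun i k : Fin M =>
        Complex.exp (Complex.I * Real.pi * (x i).sign * (c * x i)) *
          ((c * x i) ^ (M - (k : ℕ)))⁻¹ *
          ∑ l ∈ Finset.range (M - k),
            (-(Complex.I * Real.pi * (x i).sign * (c * x i))) ^ l / l.factorial) =
      (∏ k : Fin M, c ^ (k : ℕ)) *
        Matrix.det (Matrix.of fun i j : Fin M => ((gMn γ M ((i : ℕ) + 1) (x j) : ℝ) : ℂ)) := by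
    rw [← Matrix.det_mul_column, ← Matrix.det_mul_column, ← Matrix.det_transpose]
    congr 1
    ext k i
    exact exp_phase_eq_gMn hγ (hx i) k
  have hprod : (∏ k : Fin M, c ^ (k : ℕ)) ≠ 0 :=
    Finset.prod_ne_zero_iff.2 fun k _ => pow_ne_zero _ hc
  have hexp : -(Real.pi : ℂ) * α * ∑ i, c * x i = -Complex.I * γ * α * ∑ i, (x i : ℂ) := by
    rw [← Finset.mul_sum, hc_def]
    field_simp
  convert hlim using 2
  · simp only [Function.comp_apply, div_eq_mul_inv, mul_inv]
    ring
  · rw [hexp, mul_assoc _ (_ / _) (Matrix.det _), div_mul_eq_mul_div, hrows, prod_prod_Ioi_mul_sub,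
      mul_div_mul_left _ _ hprod]
end

section
/- (Proposition 1, conditional form.) Fix an integer M ≥ 1, γ > 0, ρ > 0, and real numbers E and α. For each N ≥ 1 let μ_N be a probability measure on the space of N×N Hermitian complex matrices that is absolutely continuous with respect to Lebesgue (additive Haar) measure. Assume that for all pairwise distinct nonzero real numbers x_1, …, x_M: lim_{N→∞} ∫ ∏_{c=1}^{M} [ det(E·1_N - H) / det( (E + iγx_c/(πNρ))·1_N - H ) ] dμ_N(H) = F(x_1,…,x_M), where F(x_1,…,x_M) = (-1)^{M(M-1)/2} · e^{-iγα·∑_c x_c} · det[ g_{M-i}(x_j) ]_{i,j=1}^{M} / ∏_{1≤i<j≤M}(x_i - x_j). Then, with W an N×M complex random matrix independent of H with Gaussian density proportional to exp(-(N/γ)·Tr(W†W)), for every M×M Hermitian matrix X with pairwise distinct nonzero eigenvalues x_1, …, x_M: lim_{N→∞} E_{H,W}[ exp( -(i/(πρ)) · Tr( X W† (E·1_N - H)^{-1} W ) ) ] = F(x_1,…,x_M). -/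
open MeasureTheory Matrix Filter

/-- The universal limit
`F(x_1,…,x_M) = (-1)^{M(M-1)/2} e^{-iγα ∑_c x_c} det[g_{M-i}(x_j)] / ∏_{i<j}(x_i - x_j)`. -/
noncomputable def Fchar (M : ℕ) (γ α : ℝ) (x : Fin M → ℝ) : ℂ :=
  (-1 : ℂ) ^ (M * (M - 1) / 2) *
    Complex.exp (-Complex.I * (γ : ℂ) * (α : ℂ) * ∑ c : Fin M, (x c : ℂ)) *
    (Matrix.det (Matrix.of fun i j : Fin M => ((gMn γ M ((i : ℕ) + 1) (x j) : ℝ) : ℂ)) /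
      ∏ i : Fin M, ∏ j ∈ Finset.Ioi i, ((x i : ℂ) - (x j : ℂ)))

/-- The integral of a Gaussian with complex variance parameter over the complex plane. -/
lemma integral_cexp_neg_mul_star_mul {b : ℂ} (hb : 0 < b.re) :
    ∫ z : ℂ, Complex.exp (-b * (star z * z)) = Real.pi / b := by
  have h1 : ∫ z : ℂ, Complex.exp (-b * (star z * z)) =
      ∫ p : ℝ × ℝ, Complex.exp (-b * (p.1 : ℂ) ^ 2) * Complex.exp (-b * (p.2 : ℂ) ^ 2) := by
    rw [← (Complex.volume_preserving_equiv_real_prod).integral_comp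
      Complex.measurableEquivRealProd.measurableEmbedding]
    congr 1
    ext z
    rw [← Complex.exp_add]
    congr 1
    simp only [Complex.measurableEquivRealProd_apply, Complex.star_def, ← Complex.normSq_eq_conj_mul_self,
      Complex.normSq_apply]
    push_cast
    ring
  have hb0 : b ≠ 0 := by
    rintro rfl
    simp at hb
  have hne : (Real.pi : ℂ) / b ≠ 0 := div_ne_zero (by exact_mod_cast Real.pi_ne_zero) hb0
  rw [h1, Measure.volume_eq_prod, integral_prod_mul (fun x : ℝ => Complex.exp (-b * (x : ℂ) ^ 2))
    (fun x : ℝ => Complex.exp (-b * (x : ℂ) ^ 2)), integral_gaussian_complex hb,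
    ← Complex.cpow_add _ _ hne]
  norm_num

/-- A product Gaussian integral over complex rectangular arrays. -/
lemma integral_cexp_neg_sum_mul_star_mul {n m : Type*} [Fintype n] [Fintype m] (b : n → m → ℂ)
    (hb : ∀ j c, 0 < (b j c).re) :
    ∫ W : n → m → ℂ, Complex.exp (-∑ j, ∑ c, b j c * (star (W j c) * W j c)) =
      ∏ j, ∏ c, (Real.pi / b j c : ℂ) := by
  calc _ = ∫ W : n → m → ℂ, ∏ j, ∏ c, Complex.exp (-b j c * (star (W j c) * W j c)) := by
        simp_rw [← Complex.exp_sum, neg_mul, Finset.sum_neg_distrib]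
    _ = ∏ j, ∫ w : m → ℂ, ∏ c, Complex.exp (-b j c * (star (w c) * w c)) :=
        integral_fintype_prod_volume_eq_prod
          (fun j (w : m → ℂ) => ∏ c, Complex.exp (-b j c * (star (w c) * w c)))
    _ = _ := by
        refine Finset.prod_congr rfl fun j _ => ?_
        rw [integral_fintype_prod_volume_eq_prod
          (fun c (z : ℂ) => Complex.exp (-b j c * (star z * z)))]
        exact Finset.prod_congr rfl fun c _ => integral_cexp_neg_mul_star_mul (hb j c)

/-- Ratios of Lebesgue integrals are invariant under linear changes of variables. -/
lemma integral_comp_linearEquiv_div_integral_comp_linearEquiv {V : Type*} [NormedAddCommGroup V]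
    [NormedSpace ℝ V] [FiniteDimensional ℝ V] [MeasurableSpace V] [BorelSpace V]
    (ν : Measure V) [ν.IsAddHaarMeasure] (e : V ≃ₗ[ℝ] V) (f g : V → ℂ) :
    (∫ v, f (e v) ∂ν) / (∫ v, g (e v) ∂ν) = (∫ v, f v ∂ν) / ∫ v, g v ∂ν := by
  have hdet : LinearMap.det (e : V →ₗ[ℝ] V) ≠ 0 := (LinearEquiv.isUnit_det' e).ne_zero
  have hemb : MeasurableEmbedding e :=
    e.toContinuousLinearEquiv.toHomeomorph.measurableEmbedding
  have key (h : V → ℂ) : ∫ v, h (e v) ∂ν = |(LinearMap.det (e : V →ₗ[ℝ] V))⁻¹| • ∫ v, h v ∂ν := by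
    rw [← hemb.integral_map]
    have := Measure.map_linearMap_addHaar_eq_smul_addHaar ν hdet
    rw [LinearEquiv.coe_coe] at this
    rw [this, integral_smul_measure, ENNReal.toReal_ofReal (abs_nonneg _)]
  rw [key f, key g, Complex.real_smul, Complex.real_smul, mul_div_mul_left]
  exact_mod_cast abs_ne_zero.2 (inv_ne_zero hdet)

/-- Two-sided multiplication by matrices with one-sided inverses, as a real linear equivalence of
rectangular arrays. -/
noncomputable def mulMulLinearEquiv {n m : Type*} [Fintype n] [Fintype m] [DecidableEq n]
    [DecidableEq m] (U U' : Matrix n n ℂ) (Y Y' : Matrix m m ℂ) (hU : U' * U = 1)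
    (hY : Y * Y' = 1) : (n → m → ℂ) ≃ₗ[ℝ] (n → m → ℂ) where
  toFun W := Matrix.of.symm (U * Matrix.of W * Y)
  invFun W := Matrix.of.symm (U' * Matrix.of W * Y')
  map_add' V W := by
    change U * (Matrix.of V + Matrix.of W) * Y = U * Matrix.of V * Y + U * Matrix.of W * Y
    rw [Matrix.mul_add, Matrix.add_mul]
  map_smul' r W := by
    change U * (r • Matrix.of W) * Y = r • (U * Matrix.of W * Y)
    rw [Matrix.mul_smul, Matrix.smul_mul]
  left_inv W := by
    change U' * (U * Matrix.of W * Y) * Y' = Matrix.of W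
    rw [Matrix.mul_assoc U, ← Matrix.mul_assoc U', hU, Matrix.one_mul, Matrix.mul_assoc, hY,
      Matrix.mul_one]
  right_inv W := by
    change U * (U' * Matrix.of W * Y') * Y = Matrix.of W
    rw [Matrix.mul_assoc U', ← Matrix.mul_assoc U, mul_eq_one_comm.1 hU, Matrix.one_mul,
      Matrix.mul_assoc, mul_eq_one_comm.1 hY, Matrix.mul_one]

lemma exists_unitary_diagonalization {n : Type*} [Fintype n] [DecidableEq n] {A : Matrix n n ℂ}
    (hA : A.IsHermitian) : ∃ U : Matrix n n ℂ, Uᴴ * U = 1 ∧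
      A = U * Matrix.diagonal (fun j => (hA.eigenvalues j : ℂ)) * Uᴴ := by
  refine ⟨hA.eigenvectorUnitary, Unitary.coe_star_mul_self hA.eigenvectorUnitary, ?_⟩
  conv_lhs => rw [hA.spectral_theorem, Unitary.conjStarAlgAut_apply]
  rfl

lemma det_one_add_smul_eq_prod {n : Type*} [Fintype n] [DecidableEq n] {A : Matrix n n ℂ}
    (hA : A.IsHermitian) (s : ℂ) :
    (1 + s • A).det = ∏ j, (1 + s * (hA.eigenvalues j : ℂ)) := by
  obtain ⟨U, hU, hAU⟩ := exists_unitary_diagonalization hA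
  have hU' : U * Uᴴ = 1 := mul_eq_one_comm.1 hU
  have h : 1 + s • A =
      U * Matrix.diagonal (fun j => 1 + s * (hA.eigenvalues j : ℂ)) * Uᴴ := by
    have hd : Matrix.diagonal (fun j => 1 + s * (hA.eigenvalues j : ℂ)) =
        1 + s • Matrix.diagonal (fun j => (hA.eigenvalues j : ℂ)) := by
      rw [← Matrix.diagonal_one, ← Matrix.diagonal_smul, Matrix.diagonal_add]
      rfl
    rw [hd, Matrix.mul_add, Matrix.add_mul, Matrix.mul_one, hU', Matrix.mul_smul, Matrix.smul_mul,
      ← hAU]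
  rw [h, Matrix.det_mul, Matrix.det_mul, Matrix.det_diagonal, mul_right_comm, ← Matrix.det_mul,
    hU', Matrix.det_one, one_mul]

lemma trace_diagonal_mul_conjTranspose_mul_diagonal_mul {n m : Type*} [Fintype n] [Fintype m]
    [DecidableEq n] [DecidableEq m] (a : n → ℂ) (x : m → ℂ) (W : Matrix n m ℂ) :
    Matrix.trace (Matrix.diagonal x * Wᴴ * Matrix.diagonal a * W) =
      ∑ j, ∑ c, x c * a j * (star (W j c) * W j c) := by
  rw [Finset.sum_comm]
  simp only [Matrix.trace, Matrix.diag_apply, Matrix.mul_apply (N := W), Matrix.mul_diagonal,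
    Matrix.diagonal_mul, Matrix.conjTranspose_apply]
  exact Finset.sum_congr rfl fun c _ => Finset.sum_congr rfl fun j _ => by ring

/-- The characteristic function of the Hermitian form `W ↦ Tr (X W† A W)` of a complex Gaussian
matrix. -/
lemma gaussian_average_trace {n m : Type*} [Fintype n] [Fintype m] [DecidableEq n]
    [DecidableEq m] {A : Matrix n n ℂ} (hA : A.IsHermitian) {X : Matrix m m ℂ}
    (hX : X.IsHermitian) {b : ℝ} (hb : 0 < b) (s : ℝ) :
    (∫ W : n → m → ℂ, Complex.exp (-(b : ℂ) * Matrix.trace ((Matrix.of W)ᴴ * Matrix.of W)) *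
        Complex.exp (-(Complex.I * s) *
          Matrix.trace (X * (Matrix.of W)ᴴ * A * Matrix.of W))) /
      (∫ W : n → m → ℂ, Complex.exp (-(b : ℂ) * Matrix.trace ((Matrix.of W)ᴴ * Matrix.of W))) =
    ∏ c, (1 + (Complex.I * s * hX.eigenvalues c / b) • A).det⁻¹ := by
  obtain ⟨U, hU, hAU⟩ := exists_unitary_diagonalization hA
  obtain ⟨Y, hY, hXY⟩ := exists_unitary_diagonalization hX
  set a := hA.eigenvalues with ha
  set x := hX.eigenvalues
  have hb0 : (b : ℂ) ≠ 0 := by exact_mod_cast hb.ne'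
  have hquad (W : Matrix n m ℂ) :
      Matrix.trace ((U * W * Yᴴ)ᴴ * (U * W * Yᴴ)) = ∑ j, ∑ c, star (W j c) * W j c := by
    have h : (U * W * Yᴴ)ᴴ * (U * W * Yᴴ) = Y * (Wᴴ * (Uᴴ * U) * W * Yᴴ) := by
      simp only [Matrix.conjTranspose_mul, Matrix.conjTranspose_conjTranspose, Matrix.mul_assoc]
    have := trace_diagonal_mul_conjTranspose_mul_diagonal_mul (fun _ : n => (1 : ℂ))
      (fun _ : m => (1 : ℂ)) W
    rw [Matrix.diagonal_one, Matrix.diagonal_one, Matrix.one_mul, Matrix.mul_one] at this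
    rw [h, Matrix.trace_mul_comm, Matrix.mul_assoc, hY, hU, Matrix.mul_one, Matrix.mul_one, this]
    simp
  have hform (W : Matrix n m ℂ) :
      Matrix.trace (X * (U * W * Yᴴ)ᴴ * A * (U * W * Yᴴ)) =
        ∑ j, ∑ c, (x c : ℂ) * a j * (star (W j c) * W j c) := by
    have h : X * (U * W * Yᴴ)ᴴ * A * (U * W * Yᴴ) =
        Y * (Matrix.diagonal (fun c => (x c : ℂ)) * (Yᴴ * Y) * Wᴴ * (Uᴴ * U) *
          Matrix.diagonal (fun j => (a j : ℂ)) * (Uᴴ * U) * W * Yᴴ) := by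
      rw [hXY, hAU]
      simp only [Matrix.conjTranspose_mul, Matrix.conjTranspose_conjTranspose, Matrix.mul_assoc]
    rw [h, Matrix.trace_mul_comm, Matrix.mul_assoc _ Yᴴ Y, hY, hU, Matrix.mul_one, Matrix.mul_one,
      Matrix.mul_one, Matrix.mul_one,
      trace_diagonal_mul_conjTranspose_mul_diagonal_mul]
  have hvol : (volume : Measure (n → m → ℂ)).IsAddHaarMeasure := Measure.pi.isAddHaarMeasure _
  rw [← integral_comp_linearEquiv_div_integral_comp_linearEquiv volume
    (mulMulLinearEquiv U Uᴴ Yᴴ Y hU hY)]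
  have hnum : ∫ W : n → m → ℂ, Complex.exp (-(b : ℂ) *
        Matrix.trace ((U * Matrix.of W * Yᴴ)ᴴ * (U * Matrix.of W * Yᴴ))) *
      Complex.exp (-(Complex.I * s) * Matrix.trace (X * (U * Matrix.of W * Yᴴ)ᴴ * A *
        (U * Matrix.of W * Yᴴ))) =
      ∏ j, ∏ c, (Real.pi / (b + Complex.I * s * (x c * a j)) : ℂ) := by
    rw [← integral_cexp_neg_sum_mul_star_mul (fun j c => (b + Complex.I * s * (x c * a j) : ℂ))
      (fun j c => by simpa using hb)]
    congr 1
    ext W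
    rw [hquad, hform, ← Complex.exp_add]
    congr 1
    simp only [add_mul, Finset.sum_add_distrib, Finset.mul_sum, neg_mul, neg_add, Matrix.of_apply,
      Finset.sum_neg_distrib, mul_assoc]
  have hden : ∫ W : n → m → ℂ, Complex.exp (-(b : ℂ) *
        Matrix.trace ((U * Matrix.of W * Yᴴ)ᴴ * (U * Matrix.of W * Yᴴ))) =
      ∏ _j : n, ∏ _c : m, (Real.pi / b : ℂ) := by
    rw [← integral_cexp_neg_sum_mul_star_mul (fun (_ : n) (_ : m) => (b : ℂ))
      (fun _ _ => by simpa using hb)]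
    congr 1
    ext W
    rw [hquad]
    simp only [Finset.mul_sum, neg_mul, Finset.sum_neg_distrib, Matrix.of_apply]
  refine (congrArg₂ (· / ·) hnum hden).trans ?_
  simp only [det_one_add_smul_eq_prod hA, ← Finset.prod_inv_distrib, ← Finset.prod_div_distrib]
  rw [Finset.prod_comm]
  refine Finset.prod_congr rfl fun c _ => Finset.prod_congr rfl fun j _ => ?_
  have hpi : (Real.pi : ℂ) ≠ 0 := by exact_mod_cast Real.pi_ne_zero
  have hne : (b + Complex.I * s * (x c * a j) : ℂ) ≠ 0 := fun h => hb.ne' <| by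
    simpa using congrArg Complex.re h
  have hrw : (1 + Complex.I * s * x c / b * a j : ℂ) = (b + Complex.I * s * (x c * a j)) / b := by
    field_simp
  rw [← ha, hrw]
  field_simp

lemma borelSpace_selfAdjoint_matrix {n : Type*} [Fintype n] :
    BorelSpace (selfAdjoint (Matrix n n ℂ)) :=
  have : BorelSpace (Matrix n n ℂ) := inferInstanceAs (BorelSpace (n → n → ℂ))
  Subtype.borelSpace _

attribute [local instance] Matrix.normedAddCommGroup Matrix.normedSpace in
/-- For a measure absolutely continuous with respect to Lebesgue measure on Hermitian matrices,
a fixed real number is almost surely not an eigenvalue. -/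
lemma ae_det_smul_one_sub_ne_zero {n : Type*} [Fintype n] [DecidableEq n]
    (ν : Measure (selfAdjoint (Matrix n n ℂ))) [hν : ν.IsAddHaarMeasure] (E : ℝ) :
    ∀ᵐ H : selfAdjoint (Matrix n n ℂ) ∂ν,
      ((E : ℂ) • (1 : Matrix n n ℂ) - (H : Matrix n n ℂ)).det ≠ 0 := by
  have : FiniteDimensional ℝ (selfAdjoint (Matrix n n ℂ)) :=
    inferInstanceAs (FiniteDimensional ℝ (selfAdjoint.submodule ℝ (Matrix n n ℂ)))
  let normTopology : TopologicalSpace (selfAdjoint (Matrix n n ℂ)) :=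
    PseudoMetricSpace.toUniformSpace.toTopologicalSpace
  have : @BorelSpace (selfAdjoint (Matrix n n ℂ)) normTopology _ :=
    borelSpace_selfAdjoint_matrix
  have : @Measure.IsAddHaarMeasure (selfAdjoint (Matrix n n ℂ)) _ normTopology _ ν := hν
  have : ProperSpace (selfAdjoint (Matrix n n ℂ)) := FiniteDimensional.proper ℝ _
  have hcont : Continuous fun H : selfAdjoint (Matrix n n ℂ) =>
      ((E : ℂ) • (1 : Matrix n n ℂ) - (H : Matrix n n ℂ)).det :=
    (continuous_const.sub continuous_subtype_val).matrix_det
  let L : ℝ →ₗ[ℝ] selfAdjoint (Matrix n n ℂ) := LinearMap.toSpanSingleton ℝ _ 1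
  refine ae_mem_of_ae_add_linearMap_mem L volume ν
    (s := {H | ((E : ℂ) • (1 : Matrix n n ℂ) - (H : Matrix n n ℂ)).det ≠ 0})
    (isOpen_compl_singleton.preimage hcont).measurableSet fun H => ?_
  let p := (((E : ℂ) • (1 : Matrix n n ℂ) - (H : Matrix n n ℂ))).charpoly
  have hfin : {t : ℝ | p.IsRoot (t : ℂ)}.Finite :=
    (Polynomial.finite_setOfPred_isRoot (Matrix.charpoly_monic _).ne_zero).preimage
      Complex.ofReal_injective.injOn
  filter_upwards [hfin.countable.ae_notMem volume] with t ht hdet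
  apply ht
  change Polynomial.eval _ _ = 0
  rw [Matrix.eval_charpoly]
  have h : Matrix.scalar n (t : ℂ) - ((E : ℂ) • (1 : Matrix n n ℂ) - (H : Matrix n n ℂ)) =
      -((E : ℂ) • (1 : Matrix n n ℂ) - ((H + L t : selfAdjoint (Matrix n n ℂ)) : Matrix n n ℂ)) := by
    have hL : ((L t : selfAdjoint (Matrix n n ℂ)) : Matrix n n ℂ) = (t : ℂ) • 1 := by
      change (t : ℝ) • (1 : Matrix n n ℂ) = _
      ext i j
      simp
    rw [AddSubgroup.coe_add, hL, Matrix.scalar_apply, ← Matrix.smul_one_eq_diagonal]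
    abel
  rw [h, Matrix.det_neg, hdet, mul_zero]

/-- Proposition 1, conditional form: if the averaged products of ratios of
characteristic polynomials converge to `F`, then the characteristic function of the rescaled
`K`-matrix in the random (Gaussian) amplitude model converges to `F` as well. -/
theorem prop1_conditional (M : ℕ) (hM : 1 ≤ M) (γ : ℝ) (hγ : 0 < γ) (ρ : ℝ) (hρ : 0 < ρ)
    (E α : ℝ)
    (μ : (N : ℕ) → Measure (selfAdjoint (Matrix (Fin N) (Fin N) ℂ)))
    (hprob : ∀ N, 1 ≤ N → IsProbabilityMeasure (μ N))
    (hac : ∀ N, 1 ≤ N → ∃ ν : Measure (selfAdjoint (Matrix (Fin N) (Fin N) ℂ)),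
      ν.IsAddHaarMeasure ∧ μ N ≪ ν)
    (hlim : ∀ x : Fin M → ℝ, Function.Injective x → (∀ c, x c ≠ 0) →
      Filter.Tendsto
        (fun N : ℕ => ∫ H : selfAdjoint (Matrix (Fin N) (Fin N) ℂ),
          ∏ c : Fin M,
            (Matrix.det ((E : ℂ) • (1 : Matrix (Fin N) (Fin N) ℂ) - (H : Matrix (Fin N) (Fin N) ℂ)) /
              Matrix.det (((E : ℂ) + Complex.I * (γ : ℂ) * (x c : ℂ) /
                  ((Real.pi : ℂ) * (N : ℂ) * (ρ : ℂ))) • (1 : Matrix (Fin N) (Fin N) ℂ) -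
                (H : Matrix (Fin N) (Fin N) ℂ))) ∂(μ N))
        Filter.atTop (nhds (Fchar M γ α x)))
    (X : Matrix (Fin M) (Fin M) ℂ) (hX : X.IsHermitian)
    (hinj : Function.Injective hX.eigenvalues) (hx : ∀ c, hX.eigenvalues c ≠ 0) :
    Filter.Tendsto
      (fun N : ℕ =>
        (∫ H : selfAdjoint (Matrix (Fin N) (Fin N) ℂ),
          (∫ W : Fin N → Fin M → ℂ,
            Complex.exp (-((N : ℂ) / (γ : ℂ)) * Matrix.trace ((Matrix.of W)ᴴ * Matrix.of W)) *
              Complex.exp (-(Complex.I / ((Real.pi : ℂ) * (ρ : ℂ))) *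
                Matrix.trace (X * (Matrix.of W)ᴴ *
                  ((E : ℂ) • (1 : Matrix (Fin N) (Fin N) ℂ) -
                    (H : Matrix (Fin N) (Fin N) ℂ))⁻¹ * Matrix.of W))) ∂(μ N)) /
          ∫ W : Fin N → Fin M → ℂ,
            Complex.exp (-((N : ℂ) / (γ : ℂ)) * Matrix.trace ((Matrix.of W)ᴴ * Matrix.of W)))
      Filter.atTop (nhds (Fchar M γ α hX.eigenvalues)) := by
  refine (hlim hX.eigenvalues hinj hx).congr' ?_
  filter_upwards [eventually_ge_atTop 1] with N hN
  obtain ⟨ν, hν, hμν⟩ := hac N hN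
  have hNpos : (0 : ℝ) < N := by exact_mod_cast hN
  have hN0 : (N : ℂ) ≠ 0 := by exact_mod_cast hNpos.ne'
  have hγ0 : (γ : ℂ) ≠ 0 := by exact_mod_cast hγ.ne'
  have hρ0 : (ρ : ℂ) ≠ 0 := by exact_mod_cast hρ.ne'
  have hpi : (Real.pi : ℂ) ≠ 0 := by exact_mod_cast Real.pi_ne_zero
  rw [← integral_div]
  refine integral_congr_ae ?_
  filter_upwards [hμν.ae_le (ae_det_smul_one_sub_ne_zero ν E)] with H hH
  set B : Matrix (Fin N) (Fin N) ℂ :=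
    (E : ℂ) • (1 : Matrix (Fin N) (Fin N) ℂ) - (H : Matrix (Fin N) (Fin N) ℂ) with hB
  have hHherm : (H : Matrix (Fin N) (Fin N) ℂ).IsHermitian := H.2
  have hBherm : B.IsHermitian := by
    refine Matrix.IsHermitian.sub ?_ hHherm
    rw [Matrix.IsHermitian, Matrix.conjTranspose_smul, Matrix.conjTranspose_one]
    simp
  have havg := gaussian_average_trace hBherm.inv hX (div_pos hNpos hγ) (1 / (Real.pi * ρ))
  push_cast at havg
  simp only [mul_one_div] at havg
  rw [havg]
  refine Finset.prod_congr rfl fun c _ => ?_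
  have hshift : ((E : ℂ) + Complex.I * (γ : ℂ) * (hX.eigenvalues c : ℂ) /
      ((Real.pi : ℂ) * (N : ℂ) * (ρ : ℂ))) • (1 : Matrix (Fin N) (Fin N) ℂ) -
        (H : Matrix (Fin N) (Fin N) ℂ) =
      B * (1 + (Complex.I / ((Real.pi : ℂ) * ρ) * hX.eigenvalues c / ((N : ℂ) / γ)) • B⁻¹) := by
    rw [Matrix.mul_add, Matrix.mul_one, Matrix.mul_smul,
      Matrix.mul_nonsing_inv _ (isUnit_iff_ne_zero.2 hH), hB, add_smul, sub_add_eq_add_sub]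
    congr 3
    field_simp
  rw [hshift, Matrix.det_mul, div_mul_eq_div_div, div_self hH, one_div]
end
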